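/- arXiv:2201.12777 — 2 statements merged into one kernel-verified Lean document; each statement's English description precedes it below -/
import Mathlib

section
/- Let n ≥ 3 be even and let q = p^r be a prime power with q ≠ 2. Let Λ(n,q) be the number of equivalence classes of the set {(s,θ) : s an integer with 1 ≤ s < n/2 and gcd(s,n) = 1, θ ∈ F_{q^n}^* with N_{q^n/q}(θ) ≠ 1} under the relation (s,θ) ~ (t,δ) if and only if the linear sets L_f and L_g with f(x) = x^{q^s} + θ·x^{q^{n−s}} and g(x) = x^{q^t} + δ·x^{q^{n−t}} are PΓL-equivalent. Then Λ(n,q) = (Σ_{r' | r, r' > 1} (|F(r')| + |K(r')|)/(2r') + Σ_{r' | 2r, r' ∤ r} (|F(r')| − |K(r')|)/(2r') + ε)·φ(n)/2, where ε = (p−3)/2 if p is odd and ε = 0 if p = 2. -/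
/-- The `F_q`-linear set `L_f = {⟨(x, f x)⟩ : x ∈ F_{q^n}^*}` on the projective line
`PG(1, q^n) = ℙ(F_{q^n}²)`. -/
def LSet (F : Type*) [Field F] (f : F → F) : Set (Projectivization F (Fin 2 → F)) :=
  {P | ∃ x : F, ∃ _hx : x ≠ 0, ∃ h : (![x, f x] : Fin 2 → F) ≠ 0,
    P = Projectivization.mk F ![x, f x] h}

/-- `L_f` and `L_g` are PΓL-equivalent. -/
def PGammaLEquiv (F : Type*) [Field F] (f g : F → F) : Prop :=
  ∃ τ : F ≃+* F, ∃ φ : (Fin 2 → F) ≃ (Fin 2 → F),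
    (∀ v w : Fin 2 → F, φ (v + w) = φ v + φ w) ∧
    (∀ (c : F) (v : Fin 2 → F), φ (c • v) = τ c • φ v) ∧
    {P | ∃ x : F, ∃ _hx : x ≠ 0, ∃ h : φ ![x, f x] ≠ 0,
      P = Projectivization.mk F (φ ![x, f x]) h} = LSet F g

/-- The parameter set of Lunardon–Polverino polynomials
`x^{q^s} + θ x^{q^{n-s}}`:  pairs `(s, θ)` with `1 ≤ s < n/2`, `gcd(s,n) = 1`,
`θ ≠ 0` and `N_{q^n/q}(θ) ≠ 1`. -/
def LPparams (q n : ℕ) (F : Type*) [Field F] [Fintype F] : Set (ℕ × F) :=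
  {a | 1 ≤ a.1 ∧ 2 * a.1 < n ∧ Nat.gcd a.1 n = 1 ∧ a.2 ≠ 0 ∧
    a.2 ^ ((q ^ n - 1) / (q - 1)) ≠ 1}

/-- The elements of `F_{p^m}` lying in no proper subfield. -/
def noProperSubfield (p m : ℕ) [Fact p.Prime] : Set (GaloisField p m) :=
  {x | ∀ d : ℕ, d ∣ m → d < m → x ^ p ^ d ≠ x}

/-- `K(m)`: elements of `F(m)` satisfying `x^{p^k+1} = 1` for some `0 ≤ k < m`. -/
def Kset (p m : ℕ) [Fact p.Prime] : Set (GaloisField p m) :=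
  {x | x ∈ noProperSubfield p m ∧ ∃ k : ℕ, k < m ∧ x ^ (p ^ k + 1) = 1}


namespace LPC

lemma sum_zmod {M : Type*} [AddCommMonoid M] (n : ℕ) [NeZero n] (G : ZMod n → M) :
    ∑ j : ZMod n, G j = ∑ i ∈ Finset.range n, G (i : ZMod n) := by
  obtain ⟨m, rfl⟩ : ∃ m, n = m + 1 := ⟨n - 1, (Nat.succ_pred (NeZero.ne n)).symm⟩
  rw [← Fin.sum_univ_eq_sum_range (fun i => G ((i : ℕ) : ZMod (m+1)))]
  apply Finset.sum_congr rfl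
  intro i _
  congr 1
  exact (ZMod.natCast_zmod_val (n := m+1) i).symm

lemma digit_bound (q : ℕ) (hq : 2 ≤ q) (n : ℕ) : ∀ (c : ℕ → ℕ) (_ : ∀ i, c i < q),
    ∑ i ∈ Finset.range n, c i * q ^ i < q ^ n := by
  induction n with
  | zero => intro c _; simp
  | succ n ih =>
    intro c hc
    rw [Finset.sum_range_succ, pow_succ]
    have h1 := ih c hc
    have h2 : c n ≤ q - 1 := by have := hc n; omega
    have h3 : c n * q ^ n ≤ (q - 1) * q ^ n := Nat.mul_le_mul_right _ h2
    have h4 : (q - 1) * q ^ n + q ^ n = q ^ n * q := by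
      obtain ⟨k, rfl⟩ : ∃ k, q = k + 1 := ⟨q - 1, by omega⟩
      simp; ring
    omega

lemma digit_inj (q : ℕ) (hq : 2 ≤ q) (n : ℕ) : ∀ (c e : ℕ → ℕ) (_ : ∀ i, c i < q) (_ : ∀ i, e i < q)
    (_ : ∑ i ∈ Finset.range n, c i * q ^ i = ∑ i ∈ Finset.range n, e i * q ^ i),
    ∀ i < n, c i = e i := by
  induction n with
  | zero => intro c e _ _ _ i hi; omega
  | succ n ih =>
    intro c e hc he h
    rw [Finset.sum_range_succ', Finset.sum_range_succ'] at h
    have e1 : ∀ c : ℕ → ℕ, ∑ i ∈ Finset.range n, c (i+1) * q ^ (i+1) =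
        q * ∑ i ∈ Finset.range n, c (i+1) * q ^ i := by
      intro c; rw [Finset.mul_sum]; apply Finset.sum_congr rfl; intros; ring
    rw [e1 c, e1 e] at h
    simp only [pow_zero, mul_one] at h
    have h0 : c 0 = e 0 := by
      have := congrArg (· % q) h
      simpa [Nat.mul_add_mod, Nat.mod_eq_of_lt (hc 0), Nat.mod_eq_of_lt (he 0)] using this
    have h1 : ∑ i ∈ Finset.range n, c (i+1) * q ^ i = ∑ i ∈ Finset.range n, e (i+1) * q ^ i := by
      rw [h0] at h
      exact Nat.eq_of_mul_eq_mul_left (by omega) (Nat.add_right_cancel h)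
    have := ih (fun i => c (i+1)) (fun i => e (i+1)) (fun i => hc _) (fun i => he _) h1
    intro i hi
    cases i with
    | zero => exact h0
    | succ i => exact this i (by omega)

lemma pow_mod_modEq (q n a : ℕ) (hq : 1 ≤ q) : q ^ (a % n) ≡ q ^ a [MOD q ^ n - 1] := by
  conv_rhs => rw [← Nat.mod_add_div a n, pow_add, pow_mul]
  have h : q ^ n ≡ 1 [MOD q ^ n - 1] := by
    have h1 : 1 ≤ q ^ n := Nat.one_le_pow _ _ hq
    exact ((Nat.modEq_iff_dvd' h1).2 dvd_rfl).symm
  have := (h.pow (a / n)).mul_left (q ^ (a % n))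
  simpa using this.symm

lemma digits_min (q n : ℕ) (hq : 3 ≤ q) [NeZero n] (e : ZMod n → ℕ) (he : ∀ j, e j ≤ 1) (N : ℕ) :
    ∀ (c : ZMod n → ℕ) (_ : ∑ j, c j = N)
    (_ : ∑ j, c j * q ^ j.val ≡ ∑ j, e j * q ^ j.val [MOD q ^ n - 1]),
    ∑ j, e j ≤ N ∧ (N = ∑ j, e j → c = e) := by
  induction N using Nat.strong_induction_on with
  | _ N ih =>
  intro c hc h
  by_cases hbig : ∃ j, q ≤ c j
  · obtain ⟨j, hj⟩ := hbig
    obtain ⟨c0, hc0⟩ : ∃ c0 : ZMod n → ℕ, c = c0 + Pi.single j q := by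
      refine ⟨c - Pi.single j q, ?_⟩
      funext i
      by_cases hi : i = j
      · subst hi; simp [hj]
      · simp [hi]
    have hs : ∀ (k : ZMod n) (a : ℕ), ∑ i, (c0 + Pi.single k a : ZMod n → ℕ) i = ∑ i, c0 i + a := by
      intro k a
      simp [Finset.sum_add_distrib]
    have hw : ∀ (k : ZMod n) (a : ℕ), ∑ i, (c0 + Pi.single k a : ZMod n → ℕ) i * q ^ i.val
        = ∑ i, c0 i * q ^ i.val + a * q ^ k.val := by
      intro k a
      simp [Finset.sum_add_distrib, add_mul, Pi.single_apply, ite_mul]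
    rw [hc0, hs] at hc
    have key : ∑ i, (c0 + Pi.single (j+1) 1 : ZMod n → ℕ) i * q ^ i.val ≡ ∑ j, e j * q ^ j.val [MOD q ^ n - 1] := by
      refine Nat.ModEq.trans ?_ h
      rw [hc0, hw, hw]
      apply Nat.ModEq.add_left
      have h1 := pow_mod_modEq q n (j.val + 1) (by omega)
      have h2 : (j+1).val = (j.val + 1) % n := by
        rw [ZMod.val_add, ZMod.val_one_eq_one_mod]
        simp
      rw [h2, one_mul]
      refine h1.trans ?_
      rw [pow_succ, mul_comm]
    have := ih (∑ i, c0 i + 1) (by omega) _ (hs _ _) key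
    constructor
    · omega
    · intro hN; omega
  · push Not at hbig
    have hce : c = e ∨ ∑ j, e j < ∑ j, c j := by
      have hb1 := digit_bound q (by omega) n (fun i => c (i : ZMod n)) (fun i => hbig _)
      have hb2 := digit_bound q (by omega) n (fun i => e (i : ZMod n)) (fun i => lt_of_le_of_lt (he _) (by omega))
      have hb3 : 2 * ∑ i ∈ Finset.range n, e (i : ZMod n) * q ^ i < q ^ n := by
        rw [Finset.mul_sum]
        have := digit_bound q (by omega) n (fun i => 2 * e (i : ZMod n)) (fun i => by have := he i; omega)
        simpa [mul_assoc] using this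
      have hr : ∀ d : ZMod n → ℕ, ∑ j, d j * q ^ j.val = ∑ i ∈ Finset.range n, d (i : ZMod n) * q ^ i := by
        intro d
        rw [sum_zmod]
        apply Finset.sum_congr rfl
        intro i hi
        rw [ZMod.val_natCast_of_lt (Finset.mem_range.1 hi)]
      rw [hr, hr] at h
      have hqn : 3 ≤ q ^ n := le_trans hq (Nat.le_self_pow (NeZero.ne n) q)
      have hcong : ∑ i ∈ Finset.range n, c (i : ZMod n) * q ^ i = ∑ i ∈ Finset.range n, e (i : ZMod n) * q ^ i ∨
          (∑ i ∈ Finset.range n, c (i : ZMod n) * q ^ i = q ^ n - 1 ∧ ∑ i ∈ Finset.range n, e (i : ZMod n) * q ^ i = 0) := by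
        generalize ∑ i ∈ Finset.range n, c (i : ZMod n) * q ^ i = A at *
        generalize ∑ i ∈ Finset.range n, e (i : ZMod n) * q ^ i = B at *
        unfold Nat.ModEq at h
        rw [Nat.mod_eq_of_lt (b := q ^ n - 1) (a := B) (by omega)] at h
        rcases Nat.lt_or_ge A (q ^ n - 1) with hA | hA
        · rw [Nat.mod_eq_of_lt hA] at h; left; exact h
        · have : A = q ^ n - 1 := by omega
          rw [this, Nat.mod_self] at h
          right; omega
      rcases hcong with hc1 | ⟨hc1, hc2⟩
      · left
        have := digit_inj q (by omega) n (fun i => c (i : ZMod n)) (fun i => e (i : ZMod n))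
          (fun i => hbig _) (fun i => lt_of_le_of_lt (he _) (by omega)) hc1
        funext j
        have := this j.val (ZMod.val_lt j)
        simpa using this
      · right
        have he0 : ∀ i ∈ Finset.range n, e (i : ZMod n) = 0 := by
          intro i hi
          have := (Finset.sum_eq_zero_iff.1 hc2) i hi
          rcases Nat.mul_eq_zero.1 this with h | h
          · exact h
          · exact absurd h (by positivity)
        rw [sum_zmod n e, Finset.sum_eq_zero he0]
        by_contra hcon
        have : ∑ j, c j = 0 := by omega
        have hz := Finset.sum_eq_zero_iff.1 this
        have : ∑ i ∈ Finset.range n, c (i : ZMod n) * q ^ i = 0 := by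
          apply Finset.sum_eq_zero
          intro i _
          rw [hz _ (Finset.mem_univ _), zero_mul]
        omega
    rcases hce with rfl | hlt
    · exact ⟨hc.le, fun _ => rfl⟩
    · exact ⟨by omega, fun h => by omega⟩

end LPC


set_option linter.unusedSectionVars false
set_option linter.style.haveILetI false

namespace LPC

section Fr
variable (p r n : ℕ) [Fact p.Prime] [NeZero n] {F : Type*} [Field F] [Fintype F] [CharP F p]

/-- `fr k x = x ^ (q ^ k)`, where `q = p ^ r` and `k` is an integer modulo `n`. -/
noncomputable def fr (k : ZMod n) : F →+* F := iterateFrobenius F p (r * k.val)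

lemma fr_apply (k : ZMod n) (x : F) : fr p r n k x = x ^ ((p ^ r) ^ k.val) := by
  rw [fr, iterateFrobenius_def, pow_mul]

variable (hF : Fintype.card F = (p ^ r) ^ n)
include hF

lemma pow_mod_eq (a : ℕ) (x : F) : x ^ ((p ^ r) ^ (a % n)) = x ^ ((p ^ r) ^ a) := by
  conv_rhs => rw [← Nat.mod_add_div a n, pow_add, pow_mul (p ^ r) n, ← hF, pow_mul x,
    FiniteField.pow_card_pow]

lemma fr_natCast (k : ℕ) (x : F) : fr p r n (k : ZMod n) x = x ^ ((p ^ r) ^ k) := by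
  rw [fr_apply, ZMod.val_natCast, pow_mod_eq p r n hF]

lemma fr_add (i j : ZMod n) (x : F) : fr p r n (i + j) x = fr p r n i (fr p r n j x) := by
  rw [fr_apply, fr_apply, fr_apply, ZMod.val_add, pow_mod_eq p r n hF, ← pow_mul x, ← pow_add,
    add_comm]

omit hF in
lemma fr_zero (x : F) : fr p r n 0 x = x := by
  rw [fr_apply]; simp

lemma fr_neg_apply (k : ZMod n) (x : F) : fr p r n (-k) (fr p r n k x) = x := by
  rw [← fr_add p r n hF]; simp [fr_zero]

lemma fr_apply_neg (k : ZMod n) (x : F) : fr p r n k (fr p r n (-k) x) = x := by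
  rw [← fr_add p r n hF]; simp [fr_zero]

lemma fr_inj (hr : 0 < r) (i j : ZMod n) (h : ∀ x : F, fr p r n i x = fr p r n j x) : i = j := by
  have hq : 2 ≤ p ^ r := le_trans (Fact.out : p.Prime).two_le (Nat.le_self_pow hr.ne' p)
  have main : ∀ i j : ZMod n, (∀ x : F, fr p r n i x = fr p r n j x) → ¬ i.val < j.val := by
    intro i j h hij
    have hlt : (p ^ r) ^ i.val < (p ^ r) ^ j.val := Nat.pow_lt_pow_right hq hij
    have hle : (p ^ r) ^ j.val < (p ^ r) ^ n := Nat.pow_lt_pow_right hq (ZMod.val_lt j)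
    have h1 : 1 ≤ (p ^ r) ^ i.val := Nat.one_le_pow _ _ (by omega)
    have hdvd : Fintype.card F - 1 ∣ (p ^ r) ^ j.val - (p ^ r) ^ i.val := by
      rw [← FiniteField.forall_pow_eq_one_iff F]
      intro x
      have hx := h x
      rw [fr_apply, fr_apply] at hx
      rw [← mul_left_inj (x ^ ((p ^ r) ^ i.val)), ← pow_add, Nat.sub_add_cancel hlt.le, one_mul]
      ext
      push_cast
      exact hx.symm
    rw [hF] at hdvd
    have := Nat.le_of_dvd (by omega) hdvd
    omega
  have h1 := main i j h
  have h2 := main j i (fun x => (h x).symm)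
  exact ZMod.val_injective n (by omega)

lemma fr_linInd (hr : 0 < r) : LinearIndependent F (fun k : ZMod n => (fr p r n k : F → F)) := by
  have h := linearIndependent_monoidHom F F
  have := h.comp (fun k : ZMod n => ((fr p r n k : F →+* F) : F →* F)) (by
    intro i j hij
    apply fr_inj p r n hF hr
    intro x
    exact DFunLike.congr_fun hij x)
  exact this

lemma fr_indep (hr : 0 < r) (c : ZMod n → F) (h : ∀ x : F, ∑ k, c k * fr p r n k x = 0) : ∀ k, c k = 0 := by
  have h1 := fr_linInd p r n hF hr
  rw [Fintype.linearIndependent_iff] at h1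
  apply h1 c
  funext x
  rw [Finset.sum_apply]
  exact h x

lemma exists_alg (hr : 0 < r) : Nonempty (GaloisField p r →+* F) := by
  letI : Algebra (ZMod p) F := ZMod.algebra F p
  have hf : Module.finrank (ZMod p) F = r * n := by
    have := FiniteField.pow_finrank_eq_card p F
    rw [hF, ← pow_mul] at this
    exact Nat.pow_right_injective (Fact.out : p.Prime).two_le this
  have : Nonempty (GaloisField p r →ₐ[ZMod p] F) := by
    apply FiniteField.nonempty_algHom_of_finrank_dvd
    rw [hf, GaloisField.finrank p hr.ne']
    exact dvd_mul_right _ _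
  exact ⟨this.some.toRingHom⟩

lemma fr_rep (hr : 0 < r) (f : F → F) (hadd : ∀ x y, f (x + y) = f x + f y)
    (hsm : ∀ c x : F, c ^ (p ^ r) = c → f (c * x) = c * f x) :
    ∃ a : ZMod n → F, ∀ x, f x = ∑ k, a k * fr p r n k x := by
  obtain ⟨ι⟩ := exists_alg p r n hF hr
  letI : Algebra (GaloisField p r) F := ι.toAlgebra
  have hcard : Nat.card (GaloisField p r) = p ^ r := GaloisField.card p r hr.ne'
  haveI : Fintype (GaloisField p r) := Fintype.ofFinite _
  have hcard' : Fintype.card (GaloisField p r) = p ^ r := by rw [← hcard, Nat.card_eq_fintype_card]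
  have hfix : ∀ e : GaloisField p r, (algebraMap _ F e) ^ (p ^ r) = algebraMap _ F e := by
    intro e
    rw [← map_pow, ← hcard', FiniteField.pow_card]
  have hfixk : ∀ (e : GaloisField p r) (k : ℕ), (algebraMap _ F e) ^ ((p ^ r) ^ k) = algebraMap _ F e := by
    intro e k
    rw [← map_pow, ← hcard', FiniteField.pow_card_pow]
  have hfin : Module.finrank (GaloisField p r) F = n := by
    have := Module.card_eq_pow_finrank (K := GaloisField p r) (V := F)
    rw [hF, hcard'] at this
    have hq : 2 ≤ p ^ r := le_trans (Fact.out : p.Prime).two_le (Nat.le_self_pow hr.ne' p)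
    exact (Nat.pow_right_injective hq this).symm
  let L : ZMod n → (F →ₗ[GaloisField p r] F) := fun k =>
    { toFun := fr p r n k
      map_add' := map_add _
      map_smul' := by
        intro e x
        simp only [Algebra.smul_def, map_mul, RingHom.id_apply]
        rw [fr_apply p r n k (algebraMap _ F e), hfixk] }
  have hli : LinearIndependent F L := by
    rw [Fintype.linearIndependent_iff]
    intro g hg
    apply fr_indep p r n hF hr
    intro x
    have := congrArg (fun T : F →ₗ[GaloisField p r] F => T x) hg
    simpa [L] using this
  have hspan := hli.span_eq_top_of_card_eq_finrank' (by
    rw [Module.finrank_linearMap_self, hfin, ZMod.card])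
  let f' : F →ₗ[GaloisField p r] F :=
    { toFun := f
      map_add' := hadd
      map_smul' := by
        intro e x
        simp only [Algebra.smul_def, RingHom.id_apply]
        exact hsm _ _ (hfix e) }
  have hmem : f' ∈ Submodule.span F (Set.range L) := by rw [hspan]; trivial
  rw [Submodule.mem_span_range_iff_exists_fun] at hmem
  obtain ⟨c, hc⟩ := hmem
  refine ⟨c, fun x => ?_⟩
  have := congrArg (fun T : F →ₗ[GaloisField p r] F => T x) hc
  simpa [L, f'] using this.symm

end Fr
end LPC


set_option linter.unusedSectionVars false
set_option linter.style.haveILetI false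

namespace LPC

section Perm
variable (p r n : ℕ) [Fact p.Prime] [NeZero n] {F : Type*} [Field F] [Fintype F] [CharP F p] [DecidableEq F]
variable (hF : Fintype.card F = (p ^ r) ^ n)
include hF

lemma fiber_card (f : F → F) (hadd : ∀ x y, f (x + y) = f x + f y) (c : F)
    (hc : ∃ x : Fˣ, f x / x = c) :
    ((Finset.univ.filter (fun x : Fˣ => f x / x = c)).card : F) = -1 := by
  let φ : F →+ F := AddMonoidHom.mk' f hadd - AddMonoidHom.mulLeft c
  have hφ : ∀ x, φ x = f x - c * x := fun x => rfl
  have hmem : ∀ x : Fˣ, f x / x = c ↔ (x : F) ∈ φ.ker := by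
    intro x
    rw [AddMonoidHom.mem_ker, hφ, sub_eq_zero, div_eq_iff x.ne_zero]
  have hcard : Nat.card φ.ker = (Finset.univ.filter (fun x : Fˣ => f x / x = c)).card + 1 := by
    have h1 : (Finset.univ.filter (fun y : F => y ∈ φ.ker)) =
        insert 0 ((Finset.univ.filter (fun x : Fˣ => f x / x = c)).image (fun x : Fˣ => (x : F))) := by
      ext y
      simp only [Finset.mem_filter, Finset.mem_univ, true_and, Finset.mem_insert, Finset.mem_image]
      constructor
      · intro hy
        by_cases h0 : y = 0
        · exact Or.inl h0
        · exact Or.inr ⟨Units.mk0 y h0, (hmem _).2 hy, rfl⟩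
      · rintro (rfl | ⟨x, hx, rfl⟩)
        · exact zero_mem _
        · exact (hmem x).1 hx
    rw [Nat.card_eq_fintype_card, Fintype.card_subtype, h1, Finset.card_insert_of_notMem,
      Finset.card_image_of_injective _ Units.val_injective]
    simp
  have hdvd : p ∣ Nat.card φ.ker := by
    have h1 : Nat.card φ.ker ∣ p ^ (r * n) := by
      have := AddSubgroup.card_addSubgroup_dvd_card φ.ker
      rwa [Nat.card_eq_fintype_card (α := F), hF, ← pow_mul] at this
    obtain ⟨k, hk, hk2⟩ := (Nat.dvd_prime_pow (Fact.out : p.Prime)).1 h1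
    rw [hk2]
    apply dvd_pow_self
    rintro rfl
    rw [pow_zero, hcard] at hk2
    obtain ⟨x, hx⟩ := hc
    have : 0 < (Finset.univ.filter (fun x : Fˣ => f x / x = c)).card :=
      Finset.card_pos.2 ⟨x, by simp [hx]⟩
    omega
  have h2 : ((Nat.card φ.ker : ℕ) : F) = 0 := (CharP.cast_eq_zero_iff F p _).2 hdvd
  rw [hcard] at h2
  push_cast at h2
  linear_combination h2

lemma sum_range_eq (f : F → F) (hadd : ∀ x y, f (x + y) = f x + f y) (h : F → F) :
    ∑ x : Fˣ, h (f x / x) = - ∑ c ∈ Finset.univ.image (fun x : Fˣ => f x / x), h c := by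
  rw [Finset.sum_comp h (fun x : Fˣ => f x / x), ← Finset.sum_neg_distrib]
  apply Finset.sum_congr rfl
  intro c hc
  have hc' : ∃ x : Fˣ, f x / x = c := by simpa using hc
  have := fiber_card p r n hF f hadd c hc'
  rw [nsmul_eq_mul]
  rw [this]; ring

/-- The set of slopes of the linear set `L_f`. -/
def slopes {F : Type*} [Field F] (f : F → F) : Set F := {c | ∃ x : Fˣ, f x / x = c}

lemma sum_eq_of_slopes (f g : F → F) (hf : ∀ x y, f (x + y) = f x + f y)
    (hg : ∀ x y, g (x + y) = g x + g y) (hs : slopes f = slopes g) (h : F → F) :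
    ∑ x : Fˣ, h (f x / x) = ∑ x : Fˣ, h (g x / x) := by
  rw [sum_range_eq p r n hF f hf, sum_range_eq p r n hF g hg]
  congr 2
  ext c
  have := Set.ext_iff.1 hs c
  simpa [slopes] using this

lemma char_sum (hr : 0 < r) (hq : p ^ r ≠ 2) {J : Type*} [Fintype J] [DecidableEq J] (ι g : J → ZMod n)
    (hι : Function.Injective ι) :
    ((∃ π : Equiv.Perm J, g = ι ∘ π) → ∑ x : Fˣ, ∏ l, (fr p r n (g l) (x : F) / fr p r n (ι l) (x : F)) = -1) ∧
    ((¬ ∃ π : Equiv.Perm J, g = ι ∘ π) → ∑ x : Fˣ, ∏ l, (fr p r n (g l) (x : F) / fr p r n (ι l) (x : F)) = 0) := by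
  constructor
  · rintro ⟨π, rfl⟩
    have h1 : ∀ x : Fˣ, ∏ l, (fr p r n ((ι ∘ π) l) (x : F) / fr p r n (ι l) (x : F)) = 1 := by
      intro x
      rw [Finset.prod_div_distrib]
      have := Equiv.prod_comp π (fun l => fr p r n (ι l) (x : F))
      simp only [Function.comp]
      rw [this]
      apply div_self
      rw [Finset.prod_ne_zero_iff]
      intro l _
      exact (map_ne_zero _).2 x.ne_zero
    simp only [h1]
    have := FiniteField.sum_pow_units F 0
    simpa using this
  · intro hno
    have hq3 : 3 ≤ p ^ r := by
      have hq : 2 ≤ p ^ r := le_trans (Fact.out : p.Prime).two_le (Nat.le_self_pow hr.ne' p)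
      omega
    set q := p ^ r with hqdef
    have hQ : 3 ≤ q ^ n := le_trans hq3 (Nat.le_self_pow (NeZero.ne n) q)
    set A := ∑ l, q ^ (g l).val with hA
    set B := ∑ l, q ^ (ι l).val with hB
    have hterm : ∀ x : Fˣ, ∏ l, (fr p r n (g l) (x : F) / fr p r n (ι l) (x : F)) =
        ((x ^ (A + B * (q ^ n - 2)) : Fˣ) : F) := by
      intro x
      have h2 : ∏ l, (fr p r n (g l) (x : F) / fr p r n (ι l) (x : F)) = (x : F) ^ A / (x : F) ^ B := by
        rw [Finset.prod_div_distrib, hA, hB, ← Finset.prod_pow_eq_pow_sum, ← Finset.prod_pow_eq_pow_sum]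
        simp only [fr_apply, hqdef]
      rw [h2, div_eq_iff (pow_ne_zero _ x.ne_zero)]
      push_cast
      rw [← pow_add]
      have : A + B * (q ^ n - 2) + B = A + (q ^ n - 1) * B := by
        obtain ⟨k, hk⟩ : ∃ k, q ^ n = k + 2 := ⟨q ^ n - 2, by omega⟩
        rw [hk]
        simp
        ring
      rw [this, pow_add, pow_mul, ← hF, FiniteField.pow_card_sub_one_eq_one _ x.ne_zero]
      simp
    simp only [hterm]
    have hsum := FiniteField.sum_pow_units F (A + B * (q ^ n - 2))
    push_cast
    rw [hsum, if_neg]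
    intro hdvd
    apply hno
    rw [hF] at hdvd
    have hmod : A ≡ B [MOD q ^ n - 1] := by
      have h1 : A + B * (q ^ n - 2) + B = A + (q ^ n - 1) * B := by
        obtain ⟨k, hk⟩ : ∃ k, q ^ n = k + 2 := ⟨q ^ n - 2, by omega⟩
        rw [hk]
        simp
        ring
      have h2 : A + B * (q ^ n - 2) + B ≡ 0 + B [MOD q ^ n - 1] :=
        ((Nat.modEq_zero_iff_dvd).2 hdvd).add_right B
      rw [h1, zero_add] at h2
      refine Nat.ModEq.trans ?_ h2
      have : (q ^ n - 1) * B ≡ 0 [MOD q ^ n - 1] := (Nat.modEq_zero_iff_dvd).2 (dvd_mul_right _ _)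
      simpa using (this.add_left A).symm
    let c : ZMod n → ℕ := fun j => (Finset.univ.filter (fun l => g l = j)).card
    let e : ZMod n → ℕ := fun j => (Finset.univ.filter (fun l => ι l = j)).card
    have hw : ∀ (u : J → ZMod n), ∑ l, q ^ (u l).val =
        ∑ j, (Finset.univ.filter (fun l => u l = j)).card * q ^ j.val := by
      intro u
      rw [← Finset.sum_fiberwise Finset.univ u]
      apply Finset.sum_congr rfl
      intro j _
      rw [Finset.sum_congr rfl (g := fun _ => q ^ j.val), Finset.sum_const, smul_eq_mul]
      intro l hl
      rw [(Finset.mem_filter.1 hl).2]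
    have ht : ∀ (u : J → ZMod n), ∑ j, (Finset.univ.filter (fun l => u l = j)).card = Fintype.card J := by
      intro u
      have := Finset.card_eq_sum_card_fiberwise (f := u) (s := Finset.univ) (t := Finset.univ) (by simp)
      rw [Finset.card_univ] at this
      exact this.symm
    have he1 : ∀ j, e j ≤ 1 := by
      intro j
      apply Finset.card_le_one.2
      intro a ha b hb
      apply hι
      rw [(Finset.mem_filter.1 ha).2, (Finset.mem_filter.1 hb).2]
    rw [hA, hB, hw, hw] at hmod
    have hce := (digits_min q n hq3 e he1 (Fintype.card J) c (ht g) hmod).2 (ht ι).symm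
    have hex : ∀ l, ∃ l', ι l' = g l := by
      intro l
      have h1 : 0 < c (g l) := Finset.card_pos.2 ⟨l, by simp⟩
      rw [hce] at h1
      obtain ⟨l', hl'⟩ := Finset.card_pos.1 h1
      exact ⟨l', (Finset.mem_filter.1 hl').2⟩
    choose π hπ using hex
    have hinj : Function.Injective π := by
      intro a b hab
      have h1 : g a = g b := by rw [← hπ, ← hπ, hab]
      have h2 : c (g b) ≤ 1 := by rw [hce]; exact he1 _
      exact Finset.card_le_one.1 h2 a (by simp [h1]) b (by simp)
    refine ⟨Equiv.ofBijective π (Finite.injective_iff_bijective.1 hinj), ?_⟩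
    funext l
    exact (hπ l).symm

lemma perm_sum (hr : 0 < r) (hq : p ^ r ≠ 2) {J : Type*} [Fintype J] [DecidableEq J] (ι : J → ZMod n)
    (hι : Function.Injective ι) (a : ZMod n → F) (f : F → F) (hf : ∀ x, f x = ∑ k, a k * fr p r n k x) :
    ∑ x : Fˣ, ∏ l, fr p r n (ι l) (f x / x) =
      - ∑ π : Equiv.Perm J, ∏ l, fr p r n (ι l) (a (ι (π l) - ι l)) := by
  have h1 : ∀ (x : F) (i : ZMod n), fr p r n i (f x) = ∑ j, fr p r n i (a (j - i)) * fr p r n j x := by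
    intro x i
    rw [hf, map_sum, ← Equiv.sum_comp (Equiv.addLeft i)
      (fun j => fr p r n i (a (j - i)) * fr p r n j x)]
    apply Finset.sum_congr rfl
    intro k _
    simp [fr_add p r n hF]
  have h2 : ∀ x : Fˣ, ∏ l, fr p r n (ι l) (f x / x) =
      ∑ g : J → ZMod n, (∏ l, fr p r n (ι l) (a (g l - ι l))) *
        ∏ l, (fr p r n (g l) (x : F) / fr p r n (ι l) (x : F)) := by
    intro x
    have : ∀ l, fr p r n (ι l) (f x / x) =
        ∑ j, fr p r n (ι l) (a (j - ι l)) * (fr p r n j (x : F) / fr p r n (ι l) (x : F)) := by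
      intro l
      rw [map_div₀, h1, Finset.sum_div]
      apply Finset.sum_congr rfl
      intro j _
      ring
    rw [Finset.prod_congr rfl (fun l _ => this l), Finset.prod_univ_sum, Fintype.piFinset_univ]
    apply Finset.sum_congr rfl
    intro g _
    rw [Finset.prod_mul_distrib]
  rw [Finset.sum_congr rfl (fun x _ => h2 x), Finset.sum_comm]
  simp only [← Finset.mul_sum]
  have hinj : Function.Injective (fun (π : Equiv.Perm J) (l : J) => ι (π l)) := by
    intro π π' h
    ext l
    exact hι (congrFun h l)
  rw [← Finset.sum_neg_distrib]
  symm
  have h3 := Finset.sum_image (s := (Finset.univ : Finset (Equiv.Perm J)))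
    (g := fun (π : Equiv.Perm J) (l : J) => ι (π l))
    (f := fun g : J → ZMod n => (∏ l, fr p r n (ι l) (a (g l - ι l))) *
        ∑ x : Fˣ, ∏ l, (fr p r n (g l) (x : F) / fr p r n (ι l) (x : F))) (hinj.injOn)
  rw [← Finset.sum_subset (Finset.subset_univ
    ((Finset.univ : Finset (Equiv.Perm J)).image (fun (π : Equiv.Perm J) (l : J) => ι (π l)))), h3]
  · apply Finset.sum_congr rfl
    intro π _
    rw [(char_sum p r n hF hr hq ι (fun l => ι (π l)) hι).1 ⟨π, rfl⟩]
    ring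
  · intro g _ hg
    rw [(char_sum p r n hF hr hq ι g hι).2, mul_zero]
    rintro ⟨π, rfl⟩
    exact hg (Finset.mem_image.2 ⟨π, Finset.mem_univ _, rfl⟩)

/-- Two `q`-polynomials with the same slopes have the same principal permanents. -/
lemma perm_eq (hr : 0 < r) (hq : p ^ r ≠ 2) {J : Type*} [Fintype J] [DecidableEq J] (ι : J → ZMod n)
    (hι : Function.Injective ι) (a b : ZMod n → F)
    (hs : slopes (fun x : F => ∑ k, a k * fr p r n k x) = slopes (fun x : F => ∑ k, b k * fr p r n k x)) :
    ∑ π : Equiv.Perm J, ∏ l, fr p r n (ι l) (a (ι (π l) - ι l)) =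
      ∑ π : Equiv.Perm J, ∏ l, fr p r n (ι l) (b (ι (π l) - ι l)) := by
  have hadd : ∀ (a : ZMod n → F) (x y : F), (fun x : F => ∑ k, a k * fr p r n k x) (x + y) =
      (fun x : F => ∑ k, a k * fr p r n k x) x + (fun x : F => ∑ k, a k * fr p r n k x) y := by
    intro a x y
    simp [mul_add, Finset.sum_add_distrib]
  have h1 := sum_eq_of_slopes p r n hF _ _ (hadd a) (hadd b) hs (fun c => ∏ l, fr p r n (ι l) c)
  have h2 := perm_sum p r n hF hr hq ι hι a _ (fun x => rfl)
  have h3 := perm_sum p r n hF hr hq ι hι b _ (fun x => rfl)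
  rw [← neg_inj, ← h2, ← h3]
  exact h1

end Perm
end LPC


set_option linter.unusedSectionVars false
set_option linter.style.haveILetI false

namespace LPC

section Supp
variable (p r n : ℕ) [Fact p.Prime] [NeZero n] {F : Type*} [Field F] [Fintype F] [CharP F p]
  (hF : Fintype.card F = (p ^ r) ^ n)

/-- All the principal permanents of the Dickson matrices of `a` and `b` coincide. -/
def SamePerm (a b : ZMod n → F) : Prop :=
  ∀ (m : ℕ) (ι : Fin m → ZMod n), Function.Injective ι →
    ∑ π : Equiv.Perm (Fin m), ∏ l, fr p r n (ι l) (a (ι (π l) - ι l)) =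
      ∑ π : Equiv.Perm (Fin m), ∏ l, fr p r n (ι l) (b (ι (π l) - ι l))

lemma same_zero (a b : ZMod n → F) (h : SamePerm p r n a b) : a 0 = b 0 := by
  have := h 1 (fun _ => 0) (fun x y _ => Subsingleton.elim x y)
  simpa [fr_zero] using this

lemma same_two (a b : ZMod n → F) (h : SamePerm p r n a b) (hb : b 0 = 0) (k : ZMod n) (hk : k ≠ 0) :
    a k * fr p r n k (a (-k)) = b k * fr p r n k (b (-k)) := by
  have ha : a 0 = 0 := (same_zero p r n a b h).trans hb
  have := h 2 ![0, k] (by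
    intro x y hxy
    fin_cases x <;> fin_cases y <;> simp_all)
  have hu : (Finset.univ : Finset (Equiv.Perm (Fin 2))) = {1, Equiv.swap 0 1} := by decide
  rw [hu, Finset.sum_pair (by decide), Finset.sum_pair (by decide)] at this
  simpa [Fin.prod_univ_two, ha, hb, fr_zero] using this

include hF in
lemma corner (hn : 4 ≤ n) (a b : ZMod n → F) (h : SamePerm p r n a b) (t : ZMod n)
    (htu : ∀ d : ℕ, (d : ZMod n) * t = 0 → n ∣ d)
    (hbt : b t ≠ 0) (hbt' : b (-t) ≠ 0) (hb : ∀ k, k ≠ t → k ≠ -t → b k = 0)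
    (j : ℕ) (hj2 : 2 ≤ j) (hjn : j + 2 ≤ n)
    (hz : ∀ d : ℕ, 2 ≤ d → d < j → a (d * t) = 0 ∧ a (-(d * t)) = 0) : a (j * t) = 0 := by
  have hnd : ∀ d : ℕ, 0 < d → d < n → (d : ZMod n) * t ≠ 0 := by
    intro d h0 h1 h2
    have := Nat.le_of_dvd h0 (htu d h2)
    omega
  have hbd : ∀ d : ℕ, d ≠ 1 → d + 2 ≤ n → b (d * t) = 0 ∧ b (-(d * t)) = 0 := by
    intro d hd1 hdn
    have h1 : (d : ZMod n) * t ≠ t := by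
      intro h1
      rcases Nat.eq_zero_or_pos d with rfl | hpos
      · have : ((1 : ℕ) : ZMod n) * t = 0 := by simp at h1; simp [← h1]
        exact hnd 1 (by omega) (by omega) this
      · have : ((d - 1 : ℕ) : ZMod n) * t = 0 := by
          rw [Nat.cast_sub hpos]; push_cast; linear_combination h1
        exact hnd (d - 1) (by omega) (by omega) this
    have h2 : (d : ZMod n) * t ≠ -t := by
      intro h1
      have : ((d + 1 : ℕ) : ZMod n) * t = 0 := by
        push_cast; linear_combination h1
      exact hnd (d + 1) (by omega) (by omega) this
    refine ⟨hb _ h1 h2, hb _ ?_ ?_⟩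
    · intro h3; exact h2 (by linear_combination -h3)
    · intro h3; exact h1 (by linear_combination -h3)
  have hb0 : b 0 = 0 := by have := (hbd 0 (by omega) (by omega)).1; simpa using this
  have ha0 : a 0 = 0 := (same_zero p r n a b h).trans hb0
  have ht0 : t ≠ 0 := by
    rintro rfl
    exact hbt hb0
  have htt := same_two p r n a b h hb0 t ht0
  have hprod : a t * fr p r n t (a (-t)) ≠ 0 := by
    rw [htt]; exact mul_ne_zero hbt ((map_ne_zero _).2 hbt')
  have hat : a t ≠ 0 := left_ne_zero_of_mul hprod
  have hat' : a (-t) ≠ 0 := by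
    intro h0; apply right_ne_zero_of_mul hprod; rw [h0, map_zero]
  by_contra haj
  have haj' : a (-(j * t)) = 0 := by
    have h1 := same_two p r n a b h hb0 (j * t) (hnd j (by omega) (by omega))
    rw [(hbd j (by omega) hjn).1, zero_mul] at h1
    rcases mul_eq_zero.1 h1 with h1 | h1
    · exact absurd h1 haj
    · exact (map_eq_zero _).1 h1
  let ι : Fin (j+1) → ZMod n := fun l => ((l : ℕ) : ZMod n) * t
  have hι : Function.Injective ι := by
    have main : ∀ l m : Fin (j+1), ι l = ι m → ¬ l.val < m.val := by
      intro l m hlm hlt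
      apply hnd (m.val - l.val) (by omega) (by have := m.2; omega)
      rw [Nat.cast_sub hlt.le]
      simp only [ι] at hlm
      linear_combination -hlm
    intro l m hlm
    have h1 := main l m hlm
    have h2 := main m l hlm.symm
    ext; omega
  have hdif : ∀ (l m : Fin (j+1)) (d : ℕ), m.val = l.val + d → ι m - ι l = d * t := by
    intro l m d hd
    simp only [ι, hd]; push_cast; ring
  have hdif' : ∀ (l m : Fin (j+1)) (d : ℕ), l.val = m.val + d → ι m - ι l = -(d * t) := by
    intro l m d hd
    simp only [ι, hd]; push_cast; ring
  have hup : ∀ (l m : Fin (j+1)), m.val = l.val + 1 → ι m - ι l = t := by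
    intro l m hd
    have := hdif l m 1 hd
    simpa using this
  have hdn : ∀ (l m : Fin (j+1)), l.val = m.val + 1 → ι m - ι l = -t := by
    intro l m hd
    have := hdif' l m 1 hd
    simpa using this
  -- vanishing
  have hEz : ∀ l m : Fin (j+1), ¬ (m.val = l.val + 1 ∨ l.val = m.val + 1) → b (ι m - ι l) = 0 := by
    intro l m hlm
    rcases le_total l.val m.val with hle | hle
    · obtain ⟨d, hd⟩ := Nat.exists_eq_add_of_le hle
      rw [hdif l m d hd]
      exact (hbd d (by omega) (by have := m.2; omega)).1
    · obtain ⟨d, hd⟩ := Nat.exists_eq_add_of_le hle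
      rw [hdif' l m d hd]
      exact (hbd d (by omega) (by have := l.2; omega)).2
  have hE'z : ∀ l m : Fin (j+1), ¬ (m.val = l.val + 1 ∨ l.val = m.val + 1) →
      ¬ (l.val = 0 ∧ m.val = j) → a (ι m - ι l) = 0 := by
    intro l m hlm hc
    rcases le_total l.val m.val with hle | hle
    · obtain ⟨d, hd⟩ := Nat.exists_eq_add_of_le hle
      rw [hdif l m d hd]
      rcases Nat.eq_zero_or_pos d with rfl | hpos
      · simpa using ha0
      · exact (hz d (by omega) (by have := m.2; omega)).1
    · obtain ⟨d, hd⟩ := Nat.exists_eq_add_of_le hle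
      rw [hdif' l m d hd]
      rcases Nat.eq_zero_or_pos d with rfl | hpos
      · simpa using ha0
      · by_cases hdj : d = j
        · rw [hdj]; exact haj'
        · exact (hz d (by omega) (by have := l.2; omega)).2
  -- scaling
  let s : ℕ → F := fun l => ∏ i ∈ Finset.range l, fr p r n ((i : ZMod n) * t) (a t / b t)
  have hs0 : ∀ l, s l ≠ 0 := by
    intro l
    rw [Finset.prod_ne_zero_iff]
    intro i _
    exact (map_ne_zero _).2 (div_ne_zero hat hbt)
  have hs1 : ∀ l, s (l+1) = s l * fr p r n ((l : ZMod n) * t) (a t / b t) := by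
    intro l
    exact Finset.prod_range_succ _ _
  have hscale : ∀ l m : Fin (j+1), (m.val = l.val + 1 ∨ l.val = m.val + 1) →
      fr p r n (ι l) (a (ι m - ι l)) = s m.val / s l.val * fr p r n (ι l) (b (ι m - ι l)) := by
    intro l m hlm
    rcases hlm with hlm | hlm
    · rw [hup l m hlm, hlm, hs1, mul_div_cancel_left₀ _ (hs0 _), ← map_mul, div_mul_cancel₀ _ hbt]
    · rw [hdn l m hlm, hlm, hs1]
      have h1 := congrArg (fr p r n ((m.val : ZMod n) * t)) htt
      have hιl : ι l = (m.val : ZMod n) * t + t := by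
        simp only [ι, hlm]; push_cast; ring
      rw [hιl, fr_add p r n hF, fr_add p r n hF]
      rw [map_mul, map_mul] at h1
      rw [map_div₀]
      have h2 : fr p r n ((m.val : ZMod n) * t) (a t) ≠ 0 := (map_ne_zero _).2 hat
      have h3 : fr p r n ((m.val : ZMod n) * t) (b t) ≠ 0 := (map_ne_zero _).2 hbt
      have h4 := hs0 m.val
      field_simp
      linear_combination h1
  let T' : Equiv.Perm (Fin (j+1)) → F := fun π => ∏ l, fr p r n (ι l) (a (ι (π l) - ι l))
  let T : Equiv.Perm (Fin (j+1)) → F := fun π => ∏ l, fr p r n (ι l) (b (ι (π l) - ι l))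
  have hsum : ∑ π, (T' π - T π) = 0 := by
    rw [Finset.sum_sub_distrib, sub_eq_zero]
    exact h (j+1) ι hι
  have hTz : ∀ π, (¬ ∀ l, ((π l).val = l.val + 1 ∨ l.val = (π l).val + 1)) → T π = 0 := by
    intro π hπ
    push Not at hπ
    obtain ⟨l, hl⟩ := hπ
    apply Finset.prod_eq_zero (Finset.mem_univ l)
    rw [hEz l (π l) (by omega), map_zero]
  let c : Equiv.Perm (Fin (j+1)) := (finRotate (j+1)).symm
  have hc0 : (c 0).val = j := by
    have : c 0 = Fin.last j := by
      rw [Equiv.symm_apply_eq, finRotate_last]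
    rw [this]; rfl
  have hc1 : ∀ l : Fin (j+1), 0 < l.val → l.val = (c l).val + 1 := by
    intro l hl
    have : c l = ⟨l.val - 1, by omega⟩ := by
      rw [Equiv.symm_apply_eq, finRotate_of_lt (by have := l.2; omega)]
      ext; simp; omega
    rw [this]; simp; omega
  rw [Finset.sum_eq_single c] at hsum
  · rw [hTz c, sub_zero] at hsum
    · rw [Finset.prod_eq_zero_iff] at hsum
      obtain ⟨l, _, hl⟩ := hsum
      rw [map_eq_zero] at hl
      rcases Nat.eq_zero_or_pos l.val with h0 | hpos
      · have : l = 0 := Fin.ext h0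
        subst this
        rw [hdif 0 (c 0) j (by simp [hc0])] at hl
        exact haj hl
      · rw [hdn l (c l) (hc1 l hpos)] at hl
        exact hat' hl
    · intro hgood
      have := hgood 0
      rw [hc0] at this
      simp at this
      omega
  · intro π _ hπc
    by_cases hgood : ∀ l, ((π l).val = l.val + 1 ∨ l.val = (π l).val + 1)
    · have : T' π = T π := by
        simp only [T', T]
        rw [Finset.prod_congr rfl (fun l _ => hscale l (π l) (hgood l)), Finset.prod_mul_distrib,
          Finset.prod_div_distrib, Equiv.prod_comp π (fun l => s l.val), div_self, one_mul]
        rw [Finset.prod_ne_zero_iff]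
        intro l _; exact hs0 _
      rw [this, sub_self]
    · rw [hTz π hgood, sub_zero]
      by_contra hne
      have hne' : ∀ l, a (ι (π l) - ι l) ≠ 0 := by
        intro l h0
        apply hne
        apply Finset.prod_eq_zero (Finset.mem_univ l)
        rw [h0, map_zero]
      have hcases : ∀ l, ((π l).val = l.val + 1 ∨ l.val = (π l).val + 1) ∨ (l.val = 0 ∧ (π l).val = j) := by
        intro l
        by_contra hcon
        rw [not_or] at hcon
        exact hne' l (hE'z l (π l) hcon.1 hcon.2)
      have hπ0 : (π 0).val = j := by
        push Not at hgood
        obtain ⟨l, hl⟩ := hgood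
        rcases hcases l with h1 | ⟨h1, h2⟩
        · omega
        · have : l = 0 := Fin.ext h1
          rw [← this]; exact h2
      have hdown : ∀ k : ℕ, ∀ l : Fin (j+1), j - l.val = k → 0 < l.val → l.val = (π l).val + 1 := by
        intro k
        induction k using Nat.strong_induction_on with
        | _ k ih =>
        intro l hlk hpos
        rcases hcases l with (h1 | h1) | h1
        · exfalso
          have hlt := (π l).2
          by_cases hlj : l.val + 1 = j
          · have : π l = π 0 := Fin.ext (by omega)
            have := π.injective this
            rw [this] at hpos
            simp at hpos
          · have h2 := ih (j - (l.val + 2)) (by omega) ⟨l.val + 2, by omega⟩ rfl (by simp)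
            simp only at h2
            have : π l = π ⟨l.val + 2, by omega⟩ := Fin.ext (by omega)
            have := congrArg Fin.val (π.injective this)
            simp at this
        · exact h1
        · omega
      apply hπc
      ext l
      rcases Nat.eq_zero_or_pos l.val with h0 | hpos
      · have : l = 0 := Fin.ext h0
        rw [this, hπ0, hc0]
      · have h1 := hdown _ l rfl hpos
        have h2 := hc1 l hpos
        omega
  · intro h0; exact absurd (Finset.mem_univ c) h0

include hF in
lemma supp_all (hn : 4 ≤ n) (a b : ZMod n → F) (h : SamePerm p r n a b) (t : ZMod n)
    (htu : ∀ d : ℕ, (d : ZMod n) * t = 0 → n ∣ d)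
    (hbt : b t ≠ 0) (hbt' : b (-t) ≠ 0) (hb : ∀ k, k ≠ t → k ≠ -t → b k = 0) (j : ℕ) :
    2 ≤ j → j + 2 ≤ n → a (j * t) = 0 ∧ a (-(j * t)) = 0 := by
  induction j using Nat.strong_induction_on with
  | _ j ih =>
  intro hj2 hjn
  constructor
  · exact corner p r n hF hn a b h t htu hbt hbt' hb j hj2 hjn (fun d h1 h2 => ih d h2 h1 (by omega))
  · have := corner p r n hF hn a b h (-t) (fun d hd => htu d (by linear_combination -hd))
      hbt' (by rwa [neg_neg]) (fun k h1 h2 => hb k (by rwa [neg_neg] at h2) h1) j hj2 hjn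
      (fun d h1 h2 => by
        have := ih d h2 h1 (by omega)
        rw [mul_neg, neg_neg]
        exact this.symm)
    rwa [mul_neg] at this

include hF in
lemma supp (hn : 4 ≤ n) (a b : ZMod n → F) (h : SamePerm p r n a b) (t : ZMod n) (ht : IsUnit t)
    (hbt : b t ≠ 0) (hbt' : b (-t) ≠ 0) (hb : ∀ k, k ≠ t → k ≠ -t → b k = 0)
    (k : ZMod n) (hk : k ≠ t) (hk' : k ≠ -t) : a k = 0 := by
  have htu : ∀ d : ℕ, (d : ZMod n) * t = 0 → n ∣ d := by
    intro d hd
    rw [ht.mul_left_eq_zero] at hd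
    exact (ZMod.natCast_eq_zero_iff d n).1 hd
  obtain ⟨u, hu⟩ := ht
  have hkj : k = (((k * (u⁻¹ : (ZMod n)ˣ)).val : ℕ) : ZMod n) * t := by
    rw [ZMod.natCast_zmod_val, mul_assoc, ← hu, Units.inv_mul, mul_one]
  set j := (k * (u⁻¹ : (ZMod n)ˣ)).val with hj
  have hjn : j < n := ZMod.val_lt _
  have ht0 : t ≠ 0 := by
    rintro rfl
    have := htu 1 (by simp)
    have := Nat.le_of_dvd (by omega) this
    omega
  rcases Nat.lt_or_ge j 2 with hj2 | hj2
  · interval_cases j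
    · have : k = 0 := by simpa using hkj
      rw [this, same_zero p r n a b h]
      exact hb 0 ht0.symm (by intro h0; exact ht0 (by linear_combination h0))
    · exact absurd (by simpa using hkj) hk
  · rcases Nat.lt_or_ge n (j + 2) with hjn2 | hjn2
    · exfalso
      apply hk'
      have : j = n - 1 := by omega
      rw [hkj, this, Nat.cast_sub (by omega)]
      simp
    · rw [hkj]
      exact (supp_all p r n hF hn a b h t htu hbt hbt' hb j hj2 hjn2).1

end Supp
end LPC


set_option linter.unusedSectionVars false
set_option linter.style.haveILetI false

namespace LPC

section Full
variable (p r n : ℕ) [Fact p.Prime] [NeZero n] {F : Type*} [Field F] [Fintype F] [CharP F p]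
  (hF : Fintype.card F = (p ^ r) ^ n) (h2 : 2 ∣ n)

/-- Parity of an integer modulo the even number `n`. -/
def par : ZMod n →+* ZMod 2 := ZMod.castHom h2 (ZMod 2)

/-- The norm from `F_{q^n}` to `F_{q^2}`. -/
noncomputable def N2 (x : F) : F := ∏ i ∈ Finset.univ.filter (fun i : ZMod n => par n h2 i = 0), fr p r n i x

lemma zmod2 (x : ZMod 2) : x = 0 ∨ x = 1 := by
  revert x; decide

lemma N2_mul (x y : F) : N2 p r n h2 (x * y) = N2 p r n h2 x * N2 p r n h2 y := by
  simp [N2, Finset.prod_mul_distrib]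

lemma N2_one : N2 p r n h2 (1 : F) = 1 := by
  simp [N2]

lemma N2_inv (x : F) : N2 p r n h2 x⁻¹ = (N2 p r n h2 x)⁻¹ := by
  simp [N2, Finset.prod_inv_distrib]

lemma N2_ne_zero (x : F) (hx : x ≠ 0) : N2 p r n h2 x ≠ 0 := by
  rw [N2, Finset.prod_ne_zero_iff]
  intro i _
  exact (map_ne_zero _).2 hx

include hF in
lemma fr_comm (i j : ZMod n) (x : F) : fr p r n i (fr p r n j x) = fr p r n j (fr p r n i x) := by
  rw [← fr_add p r n hF, ← fr_add p r n hF, add_comm]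

include hF in
lemma prod_shift (k : ZMod n) (c : ZMod 2) (x : F) :
    ∏ i ∈ Finset.univ.filter (fun i : ZMod n => par n h2 i = c), fr p r n i (fr p r n k x) =
    ∏ i ∈ Finset.univ.filter (fun i : ZMod n => par n h2 i = c + par n h2 k), fr p r n i x := by
  apply Finset.prod_bij (fun i _ => i + k)
  · intro i hi
    simp only [Finset.mem_filter, Finset.mem_univ, true_and] at hi ⊢
    rw [map_add, hi]
  · intro i _ j _ h
    exact add_right_cancel h
  · intro j hj
    simp only [Finset.mem_filter, Finset.mem_univ, true_and] at hj
    refine ⟨j - k, ?_, by ring⟩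
    simp only [Finset.mem_filter, Finset.mem_univ, true_and]
    rw [map_sub, hj]; ring
  · intro i _
    rw [fr_add p r n hF]

include hF in
lemma N2_fr (k : ZMod n) (x : F) : N2 p r n h2 (fr p r n k x) = fr p r n k (N2 p r n h2 x) := by
  rw [N2, N2, map_prod]
  apply Finset.prod_congr rfl
  intro i _
  exact fr_comm p r n hF i k x

include hF in
lemma fr_even_N2 (k : ZMod n) (hk : par n h2 k = 0) (x : F) :
    fr p r n k (N2 p r n h2 x) = N2 p r n h2 x := by
  rw [← N2_fr p r n hF, N2, prod_shift p r n hF, hk, add_zero, N2]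

include hF in
lemma fr_odd_N2 (k : ZMod n) (hk : par n h2 k = 1) (x : F) :
    fr p r n k (N2 p r n h2 x) = fr p r n 1 (N2 p r n h2 x) := by
  rw [← N2_fr p r n hF, N2, prod_shift p r n hF, hk, ← N2_fr p r n hF, N2, prod_shift p r n hF, map_one]

include hF in
lemma fr_one_one_N2 (x : F) : fr p r n 1 (fr p r n 1 (N2 p r n h2 x)) = N2 p r n h2 x := by
  rw [← fr_add p r n hF, fr_even_N2 p r n hF h2]
  rw [map_add, map_one]; decide

include hF in
lemma prod_odd (x : F) :
    ∏ i ∈ Finset.univ.filter (fun i : ZMod n => par n h2 i = 1), fr p r n i x =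
      fr p r n 1 (N2 p r n h2 x) := by
  rw [← N2_fr p r n hF, N2, prod_shift p r n hF, map_one, zero_add]

/-- the four cyclic permutations -/
def fourPerm (t : ZMod n) (ht : par n h2 t = 1) (e o : Bool) : Equiv.Perm (ZMod n) where
  toFun i := if par n h2 i = 0 then i + (if e then t else -t) else i + (if o then t else -t)
  invFun j := if par n h2 j = 0 then j - (if o then t else -t) else j - (if e then t else -t)
  left_inv i := by
    have h1 : par n h2 (-t) = 1 := by rw [map_neg, ht]; decide
    have h3 : (1 : ZMod 2) + 1 = 0 := by decide
    have h4 : (1 : ZMod 2) ≠ 0 := by decide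
    rcases zmod2 (par n h2 i) with h | h <;> cases e <;> cases o <;> simp [h, ht, h3]
  right_inv j := by
    have h1 : par n h2 (-t) = 1 := by rw [map_neg, ht]; decide
    have h3 : (1 : ZMod 2) + 1 = 0 := by decide
    have h4 : (1 : ZMod 2) ≠ 0 := by decide
    rcases zmod2 (par n h2 j) with h | h <;> cases e <;> cases o <;> simp [h, ht, h3]

lemma perm_prop (t : ZMod n) (ht : par n h2 t = 1) (htu : IsUnit t) (htt : t ≠ -t)
    (π : Equiv.Perm (ZMod n)) (hπ : ∀ i, π i = i + t ∨ π i = i - t)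
    (i i' : ZMod n) (hii : par n h2 i = par n h2 i') (h : π i = i + t) : π i' = i' + t := by
  have step : ∀ k : ℕ, π (i + (2 * k : ℕ) * t) = i + (2 * k : ℕ) * t + t := by
    intro k
    induction k with
    | zero => simpa using h
    | succ k ih =>
      rcases hπ (i + (2 * (k+1) : ℕ) * t) with h1 | h1
      · exact h1
      · exfalso
        have h3 : i + ((2 * (k+1) : ℕ) : ZMod n) * t - t = i + ((2 * k : ℕ) : ZMod n) * t + t := by
          push_cast; ring
        rw [h3, ← ih] at h1
        have h4 := π.injective h1
        apply htt
        push_cast at h4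
        linear_combination h4
  obtain ⟨u, hu⟩ := htu
  set x := (i' - i) * (u⁻¹ : (ZMod n)ˣ) with hx
  have hxt : x * t = i' - i := by
    rw [hx, mul_assoc, ← hu, Units.inv_mul, mul_one]
  have hpx : par n h2 x = 0 := by
    have := congrArg (par n h2) hxt
    rw [map_mul, ht, mul_one, map_sub, hii, sub_self] at this
    exact this
  have hev : 2 ∣ x.val := by
    rw [← ZMod.natCast_zmod_val x, map_natCast] at hpx
    exact (ZMod.natCast_eq_zero_iff _ 2).1 hpx
  obtain ⟨k, hk⟩ := hev
  have := step k
  rw [← hk, ZMod.natCast_zmod_val, hxt] at this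
  simpa using this

include hF in
lemma full_perm (t : ZMod n) (ht : par n h2 t = 1) (htu : IsUnit t) (htt : t ≠ -t)
    (a : ZMod n → F) (ha : ∀ k, k ≠ t → k ≠ -t → a k = 0) :
    ∑ π : Equiv.Perm (ZMod n), ∏ i, fr p r n i (a (π i - i)) =
      (N2 p r n h2 (a t) + N2 p r n h2 (a (-t))) *
        (fr p r n 1 (N2 p r n h2 (a t)) + fr p r n 1 (N2 p r n h2 (a (-t)))) := by
  have hsplit : ∀ G : ZMod n → F, ∏ i, G i =
      (∏ i ∈ Finset.univ.filter (fun i : ZMod n => par n h2 i = 0), G i) *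
      (∏ i ∈ Finset.univ.filter (fun i : ZMod n => par n h2 i = 1), G i) := by
    intro G
    rw [← Finset.prod_filter_mul_prod_filter_not Finset.univ (fun i : ZMod n => par n h2 i = 0)]
    congr 1
    apply Finset.prod_congr _ (fun _ _ => rfl)
    ext i
    simp only [Finset.mem_filter, Finset.mem_univ, true_and]
    rcases zmod2 (par n h2 i) with h | h <;> simp [h]
  let P : Bool × Bool → Equiv.Perm (ZMod n) := fun b => fourPerm n h2 t ht b.1 b.2
  have hPe : ∀ b i, par n h2 i = 0 → P b i = i + (if b.1 then t else -t) := by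
    intro b i hi
    change (if par n h2 i = 0 then _ else _) = _
    rw [if_pos hi]
  have hPo : ∀ b i, par n h2 i = 1 → P b i = i + (if b.2 then t else -t) := by
    intro b i hi
    change (if par n h2 i = 0 then _ else _) = _
    rw [if_neg (by rw [hi]; decide)]
  have hPinj : Function.Injective P := by
    rintro ⟨e, o⟩ ⟨e', o'⟩ h
    have h0 := congrArg (fun π : Equiv.Perm (ZMod n) => π 0) h
    have h1 := congrArg (fun π : Equiv.Perm (ZMod n) => π 1) h
    beta_reduce at h0 h1
    rw [hPe _ _ (map_zero _), hPe _ _ (map_zero _)] at h0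
    rw [hPo _ _ (map_one _), hPo _ _ (map_one _)] at h1
    have h0 := add_left_cancel h0
    have h1 := add_left_cancel h1
    have htt' : -t ≠ t := fun h => htt h.symm
    cases e <;> cases e' <;> cases o <;> cases o' <;> simp_all
  have h3 := Finset.sum_image (s := (Finset.univ : Finset (Bool × Bool)))
    (g := P) (f := fun π : Equiv.Perm (ZMod n) => ∏ i, fr p r n i (a (π i - i))) (hPinj.injOn)
  rw [← Finset.sum_subset (Finset.subset_univ ((Finset.univ : Finset (Bool × Bool)).image P)), h3]
  · have hterm : ∀ b : Bool × Bool, ∏ i, fr p r n i (a (P b i - i)) =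
        N2 p r n h2 (a (if b.1 then t else -t)) * fr p r n 1 (N2 p r n h2 (a (if b.2 then t else -t))) := by
      intro b
      rw [hsplit, ← prod_odd p r n hF, N2]
      congr 1
      · apply Finset.prod_congr rfl
        intro i hi
        rw [hPe b i (Finset.mem_filter.1 hi).2]
        congr 2
        ring
      · apply Finset.prod_congr rfl
        intro i hi
        rw [hPo b i (Finset.mem_filter.1 hi).2]
        congr 2
        ring
    rw [Finset.sum_congr rfl (fun b _ => hterm b), Fintype.sum_prod_type]
    simp
    ring
  · intro π _ hπ
    by_contra hne
    apply hπ
    have hall : ∀ i, π i = i + t ∨ π i = i - t := by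
      intro i
      by_contra hcon
      apply hne
      apply Finset.prod_eq_zero (Finset.mem_univ i)
      rw [ha, map_zero]
      · intro h; apply hcon; left; linear_combination h
      · intro h; apply hcon; right; linear_combination h
    rw [Finset.mem_image]
    have hpp := perm_prop n h2 t ht htu htt π hall
    have key : ∀ i0 : ZMod n, ∃ e : Bool, ∀ i, par n h2 i = par n h2 i0 → π i = i + (if e then t else -t) := by
      intro i0
      rcases hall i0 with h | h
      · exact ⟨true, fun i hi => by simpa using hpp i0 i hi.symm h⟩
      · refine ⟨false, fun i hi => ?_⟩
        rcases hall i with h' | h'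
        · exfalso
          have := hpp i i0 hi h'
          rw [this] at h
          apply htt
          linear_combination h
        · rw [h']; simp; ring
    obtain ⟨e, he⟩ := key 0
    obtain ⟨o, ho⟩ := key 1
    refine ⟨(e, o), Finset.mem_univ _, ?_⟩
    refine Equiv.ext (fun i => ?_)
    rcases zmod2 (par n h2 i) with h | h
    · rw [hPe _ _ h, he i (by rw [h, map_zero])]
    · rw [hPo _ _ h, ho i (by rw [h, map_one])]

include hF in
/-- A `q`-polynomial with the slopes of a Lunardon-Polverino polynomial. -/
lemma lemmaA [DecidableEq F] (hr : 0 < r) (hq : p ^ r ≠ 2) (hn : 4 ≤ n)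
    (t : ZMod n) (ht : par n h2 t = 1) (htu : IsUnit t) (a b : ZMod n → F) (δ : F)
    (hδ : δ ≠ 0) (hbt : b t = 1) (hbt' : b (-t) = δ) (hb : ∀ k, k ≠ t → k ≠ -t → b k = 0)
    (hs : slopes (fun x : F => ∑ k, a k * fr p r n k x) = slopes (fun x : F => ∑ k, b k * fr p r n k x)) :
    (∀ k, k ≠ t → k ≠ -t → a k = 0) ∧ a t ≠ 0 ∧ a (-t) ≠ 0 ∧
    (N2 p r n h2 (a (-t)) = N2 p r n h2 δ * N2 p r n h2 (a t) ∨
      N2 p r n h2 (a (-t)) * fr p r n 1 (N2 p r n h2 δ) = N2 p r n h2 (a t)) := by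
  have hsame : SamePerm p r n a b := fun m ι hι => perm_eq p r n hF hr hq ι hι a b hs
  have htt : t ≠ -t := by
    intro h
    have : ((2 : ℕ) : ZMod n) * t = 0 := by push_cast; linear_combination h
    rw [htu.mul_left_eq_zero] at this
    have := Nat.le_of_dvd (by omega) ((ZMod.natCast_eq_zero_iff 2 n).1 this)
    omega
  have ht0 : t ≠ 0 := by
    rintro rfl
    simp at htt
  have hb0 : b 0 = 0 := hb 0 ht0.symm (by intro h0; exact ht0 (by linear_combination h0))
  have ha := supp p r n hF hn a b hsame t htu (by rw [hbt]; exact one_ne_zero) (by rwa [hbt']) hb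
  have htwo := same_two p r n a b hsame hb0 t ht0
  rw [hbt, hbt', one_mul] at htwo
  have hprod : a t * fr p r n t (a (-t)) ≠ 0 := by
    rw [htwo]; exact (map_ne_zero _).2 hδ
  have hat : a t ≠ 0 := left_ne_zero_of_mul hprod
  have hat' : a (-t) ≠ 0 := by
    intro h0; apply right_ne_zero_of_mul hprod; rw [h0, map_zero]
  refine ⟨ha, hat, hat', ?_⟩
  have hfull := perm_eq p r n hF hr hq (J := ZMod n) id Function.injective_id a b hs
  simp only [id] at hfull
  rw [full_perm p r n hF h2 t ht htu htt a ha, full_perm p r n hF h2 t ht htu htt b hb,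
    hbt, hbt', N2_one, map_one] at hfull
  have h1 := congrArg (N2 p r n h2) htwo
  rw [N2_mul, N2_fr p r n hF, N2_fr p r n hF, fr_odd_N2 p r n hF h2 t ht, fr_odd_N2 p r n hF h2 t ht] at h1
  have h1' := congrArg (fr p r n 1) h1
  rw [map_mul, fr_one_one_N2 p r n hF, fr_one_one_N2 p r n hF] at h1'
  have hA0 : N2 p r n h2 (a t) ≠ 0 := N2_ne_zero p r n h2 _ hat
  have hA0' : fr p r n 1 (N2 p r n h2 (a t)) ≠ 0 := (map_ne_zero _).2 hA0
  generalize N2 p r n h2 (a t) = A at *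
  generalize N2 p r n h2 (a (-t)) = B at *
  generalize N2 p r n h2 δ = D at *
  generalize fr p r n 1 A = A' at *
  generalize fr p r n 1 B = B' at *
  generalize fr p r n 1 D = D' at *
  have hsum : A * A' + B * B' = 1 + D * D' := by linear_combination hfull - h1 - h1'
  have hpr : (A * A') * (B * B') = D * D' := by linear_combination (A' * B) * h1 + D' * h1'
  have hfac : (A * A' - 1) * (A * A' - D * D') = 0 := by
    linear_combination (A * A') * hsum - hpr
  rcases mul_eq_zero.1 hfac with h | h
  · left
    linear_combination (-B) * h + A * h1'
  · right
    apply mul_left_cancel₀ hA0'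
    linear_combination D' * h1' - h

end Full
end LPC


set_option linter.unusedSectionVars false
set_option linter.style.haveILetI false

namespace LPC

lemma card_par4 : (Finset.univ.filter (fun i : ZMod 4 =>
    ZMod.castHom (show 2 ∣ 4 by decide) (ZMod 2) i = 0)).card = 2 := by decide

section LemB
variable (p r n : ℕ) [Fact p.Prime] [NeZero n] {F : Type*} [Field F] [Fintype F] [CharP F p]
  (hF : Fintype.card F = (p ^ r) ^ n) (h2 : 2 ∣ n)

lemma par_ne (i j : ZMod n) (hi : par n h2 i = 0) (hj : par n h2 j = 1) : i ≠ j := by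
  rintro rfl
  rw [hi] at hj
  exact absurd hj (by decide)

include hF in
/-- Comparison of the coefficients of two `q`-polynomials related by a matrix. -/
lemma lemmaB (hr : 0 < r) (hn : 4 ≤ n) (s t : ZMod n) (hs : par n h2 s = 1) (ht : par n h2 t = 1)
    (hsu : IsUnit s) (htu : IsUnit t) (hst : s + t ≠ 0) (hst' : 2 * (s - t) = 0 → s = t)
    (θ α β : F) (hθ : θ ≠ 0) (hα : α ≠ 0) (hβ : β ≠ 0) (a b c d : F)
    (hb : b = 0 → d ≠ 0)
    (h : ∀ x : F, c * x + d * (fr p r n s x + θ * fr p r n (-s) x) =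
      α * fr p r n t (a * x + b * (fr p r n s x + θ * fr p r n (-s) x)) +
      β * fr p r n (-t) (a * x + b * (fr p r n s x + θ * fr p r n (-s) x))) :
    s = t ∧ (N2 p r n h2 β = N2 p r n h2 θ * N2 p r n h2 α ∨
      N2 p r n h2 β * fr p r n 1 (N2 p r n h2 θ) = N2 p r n h2 α) := by
  have htwo : ∀ u : ZMod n, IsUnit u → 2 * u ≠ 0 := by
    intro u hu h0
    have : ((2 : ℕ) : ZMod n) * u = 0 := by push_cast; exact h0
    rw [hu.mul_left_eq_zero] at this
    have := Nat.le_of_dvd (by omega) ((ZMod.natCast_eq_zero_iff 2 n).1 this)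
    omega
  have hs2 := htwo s hsu
  have ht2 := htwo t htu
  let C : ZMod n → F := Pi.single 0 c + Pi.single s d + Pi.single (-s) (d * θ)
    - Pi.single t (α * fr p r n t a) - Pi.single (-t) (β * fr p r n (-t) a)
    - Pi.single (t + s) (α * fr p r n t b) - Pi.single (t - s) (α * fr p r n t b * fr p r n t θ)
    - Pi.single (s - t) (β * fr p r n (-t) b)
    - Pi.single (-t - s) (β * fr p r n (-t) b * fr p r n (-t) θ)
  have hC : ∀ k, C k = 0 := by
    apply fr_indep p r n hF hr
    intro x
    have e1 : fr p r n (t + s) x = fr p r n t (fr p r n s x) := fr_add p r n hF _ _ _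
    have e2 : fr p r n (t - s) x = fr p r n t (fr p r n (-s) x) := by
      rw [sub_eq_add_neg]; exact fr_add p r n hF _ _ _
    have e3 : fr p r n (s - t) x = fr p r n (-t) (fr p r n s x) := by
      rw [sub_eq_add_neg, add_comm]; exact fr_add p r n hF _ _ _
    have e4 : fr p r n (-t - s) x = fr p r n (-t) (fr p r n (-s) x) := by
      rw [sub_eq_add_neg]; exact fr_add p r n hF _ _ _
    have hx := h x
    simp only [map_add, map_mul] at hx
    simp only [C, Pi.add_apply, Pi.sub_apply, add_mul, sub_mul, Finset.sum_add_distrib,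
      Finset.sum_sub_distrib, Pi.single_apply, ite_mul, zero_mul, Finset.sum_ite_eq',
      Finset.mem_univ, if_true, fr_zero, e1, e2, e3, e4]
    linear_combination hx
  have hp2 : ∀ k, C k = (if k = 0 then c else 0) + (if k = s then d else 0) +
    (if k = -s then d * θ else 0) - (if k = t then α * fr p r n t a else 0) -
    (if k = -t then β * fr p r n (-t) a else 0) - (if k = t + s then α * fr p r n t b else 0)
    - (if k = t - s then α * fr p r n t b * fr p r n t θ else 0)
    - (if k = s - t then β * fr p r n (-t) b else 0)
    - (if k = -t - s then β * fr p r n (-t) b * fr p r n (-t) θ else 0) := by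
    intro k
    simp only [C, Pi.add_apply, Pi.sub_apply, Pi.single_apply]
  have hevodd : ∀ i j : ZMod n, par n h2 i = 0 → par n h2 j = 1 → i ≠ j ∧ j ≠ i := fun i j hi hj =>
    ⟨par_ne n h2 i j hi hj, (par_ne n h2 i j hi hj).symm⟩
  have ps : par n h2 (-s) = 1 := by rw [map_neg, hs]; decide
  have pt : par n h2 (-t) = 1 := by rw [map_neg, ht]; decide
  have p0 : par n h2 0 = 0 := map_zero _
  have pts : par n h2 (t + s) = 0 := by rw [map_add, hs, ht]; decide
  have pts' : par n h2 (t - s) = 0 := by rw [map_sub, hs, ht]; decide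
  have pst' : par n h2 (s - t) = 0 := by rw [map_sub, hs, ht]; decide
  have pnts : par n h2 (-t - s) = 0 := by rw [map_sub, map_neg, hs, ht]; decide
  have hss : s ≠ -s := fun h => hs2 (by linear_combination h)
  have htt : t ≠ -t := fun h => ht2 (by linear_combination h)
  have hsnt : s ≠ -t := fun h => hst (by linear_combination h)
  have hnst : -s ≠ t := fun h => hst (by linear_combination -h)
  by_cases hb0 : b = 0
  · have hd := hb hb0
    subst hb0
    have k1 := hC s
    rw [hp2, if_neg (hevodd _ _ p0 hs).2, if_pos rfl, if_neg hss, if_neg hsnt,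
      if_neg (hevodd _ _ pts hs).2, if_neg (hevodd _ _ pts' hs).2, if_neg (hevodd _ _ pst' hs).2,
      if_neg (hevodd _ _ pnts hs).2] at k1
    have hst : s = t := by
      by_contra hne
      rw [if_neg hne] at k1
      apply hd
      linear_combination k1
    refine ⟨hst, Or.inl ?_⟩
    subst hst
    rw [if_pos rfl] at k1
    have k2 := hC (-s)
    rw [hp2, if_neg (hevodd _ _ p0 ps).2, if_neg hss.symm, if_pos rfl, if_neg hss.symm,
      if_neg (hevodd _ _ pts ps).2, if_neg (hevodd _ _ pts' ps).2, if_neg (hevodd _ _ pst' ps).2,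
      if_neg (hevodd _ _ pnts ps).2, if_pos rfl] at k2
    have e1 : d = α * fr p r n s a := by linear_combination k1
    have e2 : d * θ = β * fr p r n (-s) a := by linear_combination k2
    have n1 := congrArg (N2 p r n h2) e1
    have n2 := congrArg (N2 p r n h2) e2
    rw [N2_mul, N2_fr p r n hF, fr_odd_N2 p r n hF h2 _ hs] at n1
    rw [N2_mul, N2_mul, N2_fr p r n hF, fr_odd_N2 p r n hF h2 _ ps] at n2
    have hd2 := N2_ne_zero p r n h2 _ hd
    have : fr p r n 1 (N2 p r n h2 a) ≠ 0 := by
      intro h0; apply hd2; rw [n1, h0, mul_zero]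
    apply mul_right_cancel₀ this
    linear_combination N2 p r n h2 θ * n1 - n2
  · have hbt : fr p r n t b ≠ 0 := (map_ne_zero _).2 hb0
    have hθt : fr p r n t θ ≠ 0 := (map_ne_zero _).2 hθ
    have q1 : t + s ≠ t - s := fun h => hs2 (by linear_combination h)
    have q2 : t + s ≠ s - t := fun h => ht2 (by linear_combination h)
    have q3 : t - s ≠ -t - s := fun h => ht2 (by linear_combination h)
    have q4 : t + s ≠ 0 := by rwa [add_comm]
    have hst : s = t := by
      by_contra hne
      have k1 := hC (t - s)
      have q5 : t - s ≠ 0 := fun h => hne (by linear_combination -h)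
      have q6 : t - s ≠ s - t := fun h => hne (hst' (by linear_combination -h))
      rw [hp2, if_neg q5, if_neg (hevodd _ _ pts' hs).1, if_neg (hevodd _ _ pts' ps).1,
        if_neg (hevodd _ _ pts' ht).1, if_neg (hevodd _ _ pts' pt).1, if_neg q1.symm, if_pos rfl,
        if_neg q6, if_neg q3] at k1
      have : α * fr p r n t b * fr p r n t θ = 0 := by linear_combination -k1
      exact mul_ne_zero (mul_ne_zero hα hbt) hθt this
    refine ⟨hst, Or.inr ?_⟩
    subst hst
    have k1 := hC (s + s)
    rw [hp2, if_neg q4, if_neg (hevodd _ _ pts hs).1, if_neg (hevodd _ _ pts ps).1,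
      if_neg (hevodd _ _ pts ps).1, if_neg (hevodd _ _ pts hs).1, if_pos rfl, if_neg q1,
      if_neg q1] at k1
    have h4 : s + s = -s - s := by
      by_contra hne
      rw [if_neg hne] at k1
      have : α * fr p r n s b = 0 := by linear_combination -k1
      exact mul_ne_zero hα hbt this
    rw [if_pos h4] at k1
    have hn4 : n = 4 := by
      have : ((4 : ℕ) : ZMod n) * s = 0 := by push_cast; linear_combination h4
      rw [hsu.mul_left_eq_zero] at this
      have := Nat.le_of_dvd (by omega) ((ZMod.natCast_eq_zero_iff 4 n).1 this)
      omega
    have hneg : N2 p r n h2 (-1 : F) = 1 := by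
      subst hn4
      have hcard : (Finset.univ.filter (fun i : ZMod 4 => par 4 h2 i = 0)).card = 2 := by
        have := card_par4
        convert this
        rfl
      unfold N2
      simp only [map_neg, map_one, Finset.prod_const]
      rw [hcard]; norm_num
    have e1 : α * fr p r n s b = (-1) * (β * fr p r n (-s) b * fr p r n (-s) θ) := by
      linear_combination -k1
    have n1 := congrArg (N2 p r n h2) e1
    rw [N2_mul, N2_mul, N2_mul, N2_mul, hneg, N2_fr p r n hF, fr_odd_N2 p r n hF h2 _ hs,
      N2_fr p r n hF, fr_odd_N2 p r n hF h2 _ ps, N2_fr p r n hF, fr_odd_N2 p r n hF h2 _ ps] at n1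
    have : fr p r n 1 (N2 p r n h2 b) ≠ 0 := (map_ne_zero _).2 (N2_ne_zero p r n h2 _ hb0)
    apply mul_right_cancel₀ this
    linear_combination -n1

end LemB
end LPC


set_option linter.unusedSectionVars false
set_option linter.style.haveILetI false

namespace LPC

section Fwd
variable (p r n : ℕ) [Fact p.Prime] [NeZero n] {F : Type*} [Field F] [Fintype F] [CharP F p]
  (hF : Fintype.card F = (p ^ r) ^ n) (h2 : 2 ∣ n)

lemma par_natCast (s : ℕ) (hs : Nat.gcd s n = 1) : par n h2 (s : ZMod n) = 1 := by
  rw [map_natCast]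
  have hodd : ¬ 2 ∣ s := fun h => by
    have := Nat.dvd_gcd h h2
    rw [hs] at this
    omega
  rcases zmod2 (s : ZMod 2) with h | h
  · exact absurd ((ZMod.natCast_eq_zero_iff s 2).1 h) hodd
  · exact h

lemma isUnit_natCast (s : ℕ) (hs : Nat.gcd s n = 1) : IsUnit (s : ZMod n) :=
  (ZMod.isUnit_iff_coprime s n).2 hs

include hF in
lemma poly_eq (s : ℕ) (hs : 2 * s < n) (θ : F) :
    (fun x : F => x ^ (p ^ r) ^ s + θ * x ^ (p ^ r) ^ (n - s)) =
      fun x => fr p r n (s : ZMod n) x + θ * fr p r n (-(s : ZMod n)) x := by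
  funext x
  have : (-(s : ZMod n)) = ((n - s : ℕ) : ZMod n) := by
    rw [Nat.cast_sub (by omega)]; simp
  rw [this, fr_natCast p r n hF, fr_natCast p r n hF]

/-- Description of a semilinear map of the plane. -/
lemma phi_apply (τ : F ≃+* F) (φ : (Fin 2 → F) ≃ (Fin 2 → F))
    (h1 : ∀ v w : Fin 2 → F, φ (v + w) = φ v + φ w)
    (h2 : ∀ (c : F) (v : Fin 2 → F), φ (c • v) = τ c • φ v) (x y : F) :
    φ ![x, y] = ![φ ![1, 0] 0 * τ x + φ ![0, 1] 0 * τ y, φ ![1, 0] 1 * τ x + φ ![0, 1] 1 * τ y] := by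
  have : (![x, y] : Fin 2 → F) = x • ![1, 0] + y • ![0, 1] := by
    ext i; fin_cases i <;> simp
  rw [this, h1, h2, h2]
  ext i
  fin_cases i <;> simp <;> ring

lemma lset_slopes (g : F → F) (A B : F → F) (hA : ∀ z, z ≠ 0 → ∀ h : (![A z, B z] : Fin 2 → F) ≠ 0,
    Projectivization.mk F ![A z, B z] h ∈ LSet F g) (hnz : ∀ z, z ≠ 0 → (![A z, B z] : Fin 2 → F) ≠ 0) :
    ∀ z, z ≠ 0 → A z ≠ 0 ∧ ∃ y : Fˣ, g y / y = B z / A z := by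
  intro z hz
  obtain ⟨y, hy, hy', h⟩ := hA z hz (hnz z hz)
  rw [Projectivization.mk_eq_mk_iff'] at h
  obtain ⟨u, hu⟩ := h
  have e0 : u * y = A z := by simpa using congrFun hu 0
  have e1 : u * g y = B z := by simpa using congrFun hu 1
  have hu0 : u ≠ 0 := by
    rintro rfl
    apply hnz z hz
    rw [← e0, ← e1]; simp
  refine ⟨by rw [← e0]; exact mul_ne_zero hu0 hy, Units.mk0 y hy, ?_⟩
  rw [← e0, ← e1]
  simp only [Units.val_mk0]
  field_simp

include hF in
lemma fwd_aux [DecidableEq F] (hr : 0 < r) (hq : p ^ r ≠ 2) (hn : 4 ≤ n) (s t : ZMod n) (hs : par n h2 s = 1) (ht : par n h2 t = 1)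
    (hsu : IsUnit s) (htu : IsUnit t) (hst : s + t ≠ 0) (hst' : 2 * (s - t) = 0 → s = t)
    (θ δ : F) (hθ : θ ≠ 0) (hδ : δ ≠ 0)
    (h : PGammaLEquiv F (fun x => fr p r n s x + θ * fr p r n (-s) x)
      (fun x => fr p r n t x + δ * fr p r n (-t) x)) :
    s = t ∧ ∃ τ : F ≃+* F, N2 p r n h2 δ = N2 p r n h2 (τ θ) ∨
      N2 p r n h2 δ * fr p r n 1 (N2 p r n h2 (τ θ)) = 1 := by
  obtain ⟨τ, φ, hφ1, hφ2, hL⟩ := h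
  have hφ := phi_apply τ φ hφ1 hφ2
  have hφ0 : φ 0 = 0 := by
    have := hφ1 0 0
    simpa using this
  have hφne : ∀ v, v ≠ 0 → φ v ≠ 0 := fun v hv h0 => hv (φ.injective (h0.trans hφ0.symm))
  have hd : φ ![0, 1] 0 = 0 → φ ![0, 1] 1 ≠ 0 := by
    intro h0 h1
    apply hφne ![0, 1]
    · intro h; simpa using congrFun h 1
    · ext i; fin_cases i <;> simp [h0, h1]
  generalize φ ![1, 0] 0 = a at *
  generalize φ ![1, 0] 1 = c at *
  generalize φ ![0, 1] 0 = b at *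
  generalize φ ![0, 1] 1 = d at *
  have hτfr : ∀ (k : ZMod n) (x : F), τ (fr p r n k x) = fr p r n k (τ x) := by
    intro k x
    rw [fr_apply, fr_apply, map_pow]
  set f : F → F := fun z => fr p r n s z + τ θ * fr p r n (-s) z with hf
  have hτf : ∀ x, τ (fr p r n s x + θ * fr p r n (-s) x) = f (τ x) := by
    intro x
    rw [map_add, map_mul, hτfr, hτfr]
  set A : F → F := fun z => a * z + b * f z with hA
  set B : F → F := fun z => c * z + d * f z with hB
  set g : F → F := fun x => fr p r n t x + δ * fr p r n (-t) x with hg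
  have hφx : ∀ x, φ ![x, fr p r n s x + θ * fr p r n (-s) x] = ![A (τ x), B (τ x)] := by
    intro x
    rw [hφ, hτf]
  have hnz : ∀ z, z ≠ 0 → (![A z, B z] : Fin 2 → F) ≠ 0 := by
    intro z hz
    have := hφx (τ.symm z)
    rw [τ.apply_symm_apply] at this
    rw [← this]
    apply hφne
    intro h0
    have := congrFun h0 0
    simp at this
    exact hz this
  have hmem : ∀ z, z ≠ 0 → ∀ h : (![A z, B z] : Fin 2 → F) ≠ 0,
    Projectivization.mk F ![A z, B z] h ∈ LSet F g := by
    intro z hz h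
    rw [← hL]
    have := hφx (τ.symm z)
    rw [τ.apply_symm_apply] at this
    refine ⟨τ.symm z, by simpa using hz, by simpa only [this] using h, ?_⟩
    simp only [this]
  have hsl := lset_slopes g A B hmem hnz
  have hsl' : ∀ y : Fˣ, ∃ z, z ≠ 0 ∧ g y / y = B z / A z := by
    intro y
    have hy : (![(y : F), g y] : Fin 2 → F) ≠ 0 := by
      intro h0
      have := congrFun h0 0
      simp at this
    have hmy : Projectivization.mk F ![(y : F), g y] hy ∈ LSet F g := ⟨y, y.ne_zero, hy, rfl⟩
    rw [← hL] at hmy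
    obtain ⟨x, hx, hx', hxe⟩ := hmy
    have hz : τ x ≠ 0 := by simpa using hx
    refine ⟨τ x, hz, ?_⟩
    simp only [hφx] at hxe
    rw [Projectivization.mk_eq_mk_iff'] at hxe
    obtain ⟨u, hu⟩ := hxe
    have e0 : u * A (τ x) = y := by simpa using congrFun hu 0
    have e1 : u * B (τ x) = g y := by simpa using congrFun hu 1
    have hu0 : u ≠ 0 := by
      rintro rfl
      simp at e0
      exact y.ne_zero e0.symm
    rw [← e1, ← e0, mul_div_mul_left _ _ hu0]
  have hfadd : ∀ x y, f (x + y) = f x + f y := by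
    intro x y; simp only [hf, map_add]; ring
  have hfsm : ∀ e x, e ^ p ^ r = e → f (e * x) = e * f x := by
    intro e x he
    have hfe : ∀ k : ZMod n, fr p r n k e = e := by
      intro k
      rw [fr_apply]
      induction k.val with
      | zero => simp
      | succ m ih => rw [pow_succ, pow_mul, ih, he]
    simp only [hf, map_mul, hfe]; ring
  have hAadd : ∀ x y, A (x + y) = A x + A y := by
    intro x y; simp only [hA, hfadd]; ring
  have hBadd : ∀ x y, B (x + y) = B x + B y := by
    intro x y; simp only [hB, hfadd]; ring
  have hAinj : Function.Injective A := by
    intro x y hxy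
    by_contra hne
    apply (hsl (x - y) (sub_ne_zero.2 hne)).1
    have := hAadd (x - y) y
    rw [sub_add_cancel] at this
    rw [hxy] at this
    linear_combination -this
  have hAbij : Function.Bijective A := Finite.injective_iff_bijective.1 hAinj
  let E := Equiv.ofBijective A hAbij
  have hEA : ∀ x, A (E.symm x) = x := fun x => E.apply_symm_apply x
  have hA0 : A 0 = 0 := by simpa using hAadd 0 0
  obtain ⟨a', ha'⟩ := fr_rep p r n hF hr (fun x => B (E.symm x))
    (by
      intro x y
      have : E.symm (x + y) = E.symm x + E.symm y := hAinj (by rw [hAadd, hEA, hEA, hEA])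
      simp only [this, hBadd])
    (by
      intro e x he
      have : E.symm (e * x) = e * E.symm x := hAinj (by
        rw [hEA]
        simp only [hA, hfsm e _ he]
        have := hEA x
        simp only [hA] at this
        linear_combination -e * this)
      simp only [this, hB, hfsm e _ he]; ring)
  have htt : t ≠ -t := by
    intro h
    have : ((2 : ℕ) : ZMod n) * t = 0 := by push_cast; linear_combination h
    rw [htu.mul_left_eq_zero] at this
    have := Nat.le_of_dvd (by omega) ((ZMod.natCast_eq_zero_iff 2 n).1 this)
    omega
  have hgs : (fun x : F => ∑ k, (Pi.single t 1 + Pi.single (-t) δ : ZMod n → F) k * fr p r n k x) = g := by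
    funext x
    simp only [Pi.add_apply, add_mul, Finset.sum_add_distrib, Pi.single_apply, ite_mul, zero_mul,
      Finset.sum_ite_eq', Finset.mem_univ, if_true, hg, one_mul]
  have hA' := lemmaA p r n hF h2 hr hq hn t ht htu a' (Pi.single t 1 + Pi.single (-t) δ) δ hδ
    (by simp [Pi.single_apply, htt]) (by simp [Pi.single_apply, htt.symm])
    (by intro k h1 h2; simp [Pi.single_apply, h1, h2])
    (by
      rw [hgs]
      ext e
      constructor
      · rintro ⟨x, hx⟩
        simp only [← ha'] at hx
        have hz : E.symm (x : F) ≠ 0 := by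
          intro h0
          have := hEA x
          rw [h0, hA0] at this
          exact x.ne_zero this.symm
        obtain ⟨_, y, hy⟩ := hsl _ hz
        refine ⟨y, ?_⟩
        rw [hy, hEA, hx]
      · rintro ⟨y, hy⟩
        obtain ⟨z, hz, hzy⟩ := hsl' y
        refine ⟨Units.mk0 (A z) (hsl z hz).1, ?_⟩
        simp only [← ha', Units.val_mk0]
        have : E.symm (A z) = z := hAinj (by rw [hEA])
        rw [this, ← hzy, hy])
  obtain ⟨hsup, hαn, hβn, halt⟩ := hA'
  have hB' := lemmaB p r n hF h2 hr hn s t hs ht hsu htu hst hst' (τ θ) (a' t) (a' (-t))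
    (by simpa using hθ) hαn hβn a b c d hd
    (by
      intro x
      change B x = a' t * fr p r n t (A x) + a' (-t) * fr p r n (-t) (A x)
      have := ha' (A x)
      have h1 : E.symm (A x) = x := hAinj (by rw [hEA])
      rw [h1] at this
      rw [this, ← Finset.sum_subset (Finset.subset_univ ({t, -t} : Finset (ZMod n))),
        Finset.sum_pair htt]
      intro k _ hk
      simp only [Finset.mem_insert, Finset.mem_singleton, not_or] at hk
      rw [hsup k hk.1 hk.2, zero_mul])
  refine ⟨hB'.1, τ, ?_⟩
  have hfr1 := fr_one_one_N2 p r n hF h2 δ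
  have hfr2 := fr_one_one_N2 p r n hF h2 (τ θ)
  have hα0 := N2_ne_zero p r n h2 _ hαn
  have hβ0 := N2_ne_zero p r n h2 _ hβn
  rcases halt with h1 | h1 <;> rcases hB'.2 with h3 | h3
  · left
    apply mul_right_cancel₀ hα0
    rw [← h1, ← h3]
  · right
    apply mul_right_cancel₀ hα0
    rw [h1] at h3
    linear_combination h3
  · right
    have : N2 p r n h2 (τ θ) * fr p r n 1 (N2 p r n h2 δ) = 1 := by
      apply mul_right_cancel₀ hα0
      rw [h3] at h1
      linear_combination h1
    have := congrArg (fr p r n 1) this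
    rw [map_mul, map_one, hfr1] at this
    rw [mul_comm]; exact this
  · left
    have : fr p r n 1 (N2 p r n h2 δ) = fr p r n 1 (N2 p r n h2 (τ θ)) := by
      apply mul_left_cancel₀ hβ0
      rw [h1, h3]
    rw [← hfr1, this, hfr2]

end Fwd
end LPC


set_option linter.unusedSectionVars false
set_option linter.style.haveILetI false

namespace LPC

section Conv
variable (p r n : ℕ) [Fact p.Prime] [NeZero n] {F : Type*} [Field F] [Fintype F] [CharP F p]
  (hF : Fintype.card F = (p ^ r) ^ n) (h2 : 2 ∣ n)

/-- The relation on the norms: equality up to automorphisms and inversion. -/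
def Rel {F : Type*} [Field F] (p : ℕ) (z w : F) : Prop := ∃ k : ℕ, w = z ^ p ^ k ∨ w * z ^ p ^ k = 1

lemma N2_pow (x : F) (m : ℕ) : N2 p r n h2 (x ^ m) = (N2 p r n h2 x) ^ m := by
  simp [N2, Finset.prod_pow]

lemma exists_pow_of_aut (τ : F ≃+* F) : ∃ k : ℕ, ∀ x, τ x = x ^ p ^ k := by
  letI : Algebra (ZMod p) F := ZMod.algebra F p
  let g : F ≃ₐ[ZMod p] F := AlgEquiv.ofRingEquiv (f := τ) (by
    intro x
    have : (τ : F →+* F).comp (algebraMap (ZMod p) F) = algebraMap (ZMod p) F := Subsingleton.elim _ _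
    exact RingHom.congr_fun this x)
  obtain ⟨i, hi⟩ := (FiniteField.bijective_frobeniusAlgEquivOfAlgebraic_pow (ZMod p) F).2 g
  refine ⟨i, fun x => ?_⟩
  have : g x = x ^ p ^ (i : ℕ) := by
    rw [← hi]
    simp only [AlgEquiv.coe_pow, FiniteField.coe_frobeniusAlgEquivOfAlgebraic, ZMod.card]
    rw [pow_iterate]
  exact this

include hF in
theorem fwd [DecidableEq F] (hr : 0 < r) (hq : p ^ r ≠ 2) (hn : 4 ≤ n) (s t : ℕ) (θ δ : F)
    (h1 : (s, θ) ∈ LPparams (p ^ r) n F) (h1' : (t, δ) ∈ LPparams (p ^ r) n F)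
    (h : PGammaLEquiv F (fun x => x ^ (p ^ r) ^ s + θ * x ^ (p ^ r) ^ (n - s))
      (fun x => x ^ (p ^ r) ^ t + δ * x ^ (p ^ r) ^ (n - t))) :
    s = t ∧ Rel p (N2 p r n h2 θ) (N2 p r n h2 δ) := by
  obtain ⟨a1, a2, a3, a4, -⟩ := h1
  obtain ⟨b1, b2, b3, b4, -⟩ := h1'
  simp only at a1 a2 a3 a4 b1 b2 b3 b4
  rw [poly_eq p r n hF s a2, poly_eq p r n hF t b2] at h
  have hz : ∀ m : ℤ, (m : ZMod n) = 0 → |m| < n → m = 0 := by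
    intro m hm hlt
    exact Int.eq_zero_of_abs_lt_dvd ((ZMod.intCast_zmod_eq_zero_iff_dvd m n).1 hm) hlt
  have hsteq : 2 * ((s : ZMod n) - t) = 0 → s = t := by
    intro h0
    have := hz (2 * (s - t)) (by push_cast; exact h0) (by rw [abs_lt]; omega)
    omega
  obtain ⟨e1, τ, e2⟩ := fwd_aux p r n hF h2 hr hq hn s t (par_natCast n h2 s a3)
    (par_natCast n h2 t b3) (isUnit_natCast n s a3) (isUnit_natCast n t b3)
    (by
      intro h0
      have := hz (s + t) (by push_cast; exact h0) (by rw [abs_lt]; omega)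
      omega)
    (fun h0 => by rw [hsteq h0]) θ δ a4 b4 h
  refine ⟨hsteq (by rw [e1]; ring), ?_⟩
  obtain ⟨k, hk⟩ := exists_pow_of_aut p τ
  rw [hk] at e2
  rcases e2 with e2 | e2
  · exact ⟨k, Or.inl (by rw [e2, N2_pow])⟩
  · refine ⟨k + r, Or.inr ?_⟩
    rw [← e2, N2_pow]
    congr 1
    have := fr_natCast p r n hF 1 (N2 p r n h2 θ ^ p ^ k)
    rw [Nat.cast_one] at this
    rw [this, ← pow_mul, pow_one, pow_add]

omit [CharP F p] [Fact p.Prime] in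
lemma gen_surj (h : Fˣ →* Fˣ) (M K : ℕ) (hM : Nat.card Fˣ = M * K)
    (hker : ∀ x, h x = 1 → x ^ K = 1) (hran : ∀ x, (h x) ^ M = 1) (w : Fˣ) (hw : w ^ M = 1) :
    ∃ x, h x = w := by
  classical
  have hpos : 0 < M * K := by rw [← hM]; exact Nat.card_pos
  have hMp : 0 < M := Nat.pos_of_mul_pos_right hpos
  have hKp : 0 < K := Nat.pos_of_mul_pos_left hpos
  have hle : ∀ m, 0 < m → Nat.card (powMonoidHom m : Fˣ →* Fˣ).ker ≤ m := by
    intro m hm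
    have := IsCyclic.card_pow_eq_one_le (α := Fˣ) hm
    refine le_trans (le_of_eq ?_) this
    rw [Nat.card_eq_fintype_card, ← Fintype.card_coe]
    apply Fintype.card_congr
    apply Equiv.subtypeEquivRight
    intro x
    simp [MonoidHom.mem_ker]
  have h1 : h.range ≤ (powMonoidHom M : Fˣ →* Fˣ).ker := by
    rintro _ ⟨x, rfl⟩
    rw [MonoidHom.mem_ker]
    exact hran x
  have h3 : h.ker ≤ (powMonoidHom K : Fˣ →* Fˣ).ker := by
    intro x hx
    rw [MonoidHom.mem_ker] at *
    exact hker x hx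
  have c1 : Nat.card h.ker ≤ K := le_trans (Subgroup.card_le_of_le h3) (hle K hKp)
  have c2 : Nat.card h.ker * Nat.card h.range = M * K := by
    rw [← hM, ← Subgroup.card_mul_index h.ker, Subgroup.index_ker]
  have c3 : M ≤ Nat.card h.range := by
    by_contra hlt
    push Not at hlt
    have : Nat.card h.ker * Nat.card h.range < M * K := by
      calc _ ≤ K * Nat.card h.range := Nat.mul_le_mul_right _ c1
        _ < K * M := Nat.mul_lt_mul_of_pos_left hlt hKp
        _ = M * K := mul_comm _ _
    omega
  have heq := Subgroup.eq_of_le_of_card_ge h1 (le_trans (hle M hMp) c3)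
  have : w ∈ (powMonoidHom M : Fˣ →* Fˣ).ker := by
    rw [MonoidHom.mem_ker]; exact hw
  rw [← heq] at this
  exact this

/-- The exponent of the norm to `F_{q^2}`. -/
def MM : ℕ := ∑ j ∈ Finset.range (n / 2), (p ^ r) ^ (2 * j)

include h2 in
lemma MM_mul (hr : 0 < r) : MM p r n * ((p ^ r) ^ 2 - 1) = (p ^ r) ^ n - 1 := by
  obtain ⟨m, rfl⟩ := h2
  have : 1 ≤ (p ^ r) ^ 2 := Nat.one_le_pow _ _ (Nat.pow_pos (Fact.out : p.Prime).pos)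
  rw [MM, Nat.mul_div_cancel_left _ (by norm_num)]
  simp only [pow_mul (p ^ r) 2]
  have hg := Nat.geomSum_eq (m := (p ^ r) ^ 2) (Nat.one_lt_pow (by norm_num) (Nat.one_lt_pow hr.ne' (Fact.out : p.Prime).one_lt)) m
  rw [hg, Nat.div_mul_cancel (Nat.sub_one_dvd_pow_sub_one _ _)]

lemma N2_eq (x : F) : N2 p r n h2 x = x ^ MM p r n := by
  unfold N2 MM
  simp only [fr_apply]
  rw [Finset.prod_pow_eq_pow_sum]
  congr 1
  rw [Finset.sum_filter, sum_zmod n (fun k => if par n h2 k = 0 then (p ^ r) ^ k.val else 0)]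
  have h0 : ∀ i ∈ Finset.range n, (if par n h2 ((i : ℕ) : ZMod n) = 0 then (p ^ r) ^ ((i : ℕ) : ZMod n).val else 0)
      = if 2 ∣ i then (p ^ r) ^ i else 0 := by
    intro i hi
    rw [ZMod.val_natCast, Nat.mod_eq_of_lt (Finset.mem_range.1 hi), map_natCast]
    simp only [ZMod.natCast_eq_zero_iff]
  rw [Finset.sum_congr rfl h0]
  obtain ⟨m, hm⟩ := h2
  rw [hm, Nat.mul_div_cancel_left _ (by norm_num)]
  clear h0 hm
  induction m with
  | zero => simp
  | succ m ih =>
    rw [show 2 * (m + 1) = 2 * m + 1 + 1 by ring, Finset.sum_range_succ, Finset.sum_range_succ, ih,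
      Finset.sum_range_succ, if_pos (by omega), if_neg (by omega), add_zero]

include hF h2 in
lemma card_units' (hr : 0 < r) : Nat.card Fˣ = MM p r n * ((p ^ r) ^ 2 - 1) := by
  classical
  rw [Nat.card_eq_fintype_card, Fintype.card_units, hF, MM_mul p r n h2 hr]

include hF in
lemma N2_surj (hr : 0 < r) (z : F) (hz0 : z ≠ 0) (hz : z ^ (p ^ r) ^ 2 = z) :
    ∃ θ : F, θ ≠ 0 ∧ N2 p r n h2 θ = z := by
  have hc := card_units' p r n hF h2 hr
  have h1 : 1 ≤ (p ^ r) ^ 2 := Nat.one_le_pow _ _ (Nat.pow_pos (Fact.out : p.Prime).pos)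
  obtain ⟨x, hx⟩ := gen_surj (powMonoidHom (MM p r n)) ((p ^ r) ^ 2 - 1) (MM p r n) (by rw [hc, mul_comm])
    (fun x hx => hx) (fun x => by
      rw [powMonoidHom_apply, ← pow_mul, ← hc, pow_card_eq_one']) (Units.mk0 z hz0)
      (by
        apply mul_right_cancel (b := Units.mk0 z hz0)
        rw [← pow_succ, Nat.sub_add_cancel h1, one_mul]
        ext; simpa using hz)
  refine ⟨x, x.ne_zero, ?_⟩
  rw [N2_eq]
  have := congrArg Units.val hx
  simpa using this

include hF in
lemma fr_mul_nat (k : ZMod n) (x : F) (h : fr p r n k x = x) (m : ℕ) : fr p r n (m * k) x = x := by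
  induction m with
  | zero => simp [fr_zero]
  | succ m ih =>
    rw [Nat.cast_succ, add_mul, one_mul, fr_add p r n hF, h, ih]

include hF in
lemma hilbert90 (hr : 0 < r) (s : ZMod n) (hsu : IsUnit s) (w : F) (hw0 : w ≠ 0)
    (hw : N2 p r n h2 w = 1) : ∃ l : F, l ≠ 0 ∧ fr p r n s l = w * fr p r n (-s) l := by
  have hc := card_units' p r n hF h2 hr
  have h1 : 1 ≤ (p ^ r) ^ 2 := Nat.one_le_pow _ _ (Nat.pow_pos (Fact.out : p.Prime).pos)
  have hp2 : par n h2 (s + s) = 0 := by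
    rw [map_add]; rcases zmod2 (par n h2 s) with h | h <;> rw [h] <;> decide
  let h : Fˣ →* Fˣ := Units.map ((fr p r n (s + s) : F →+* F) : F →* F) * (MonoidHom.id Fˣ)⁻¹
  have hh : ∀ x : Fˣ, ((h x : Fˣ) : F) = fr p r n (s + s) (x : F) * (x : F)⁻¹ := by
    intro x
    simp [h]
  obtain ⟨x, hx⟩ := gen_surj h (MM p r n) ((p ^ r) ^ 2 - 1) hc
    (by
      intro x hx
      have h3 : fr p r n (s + s) (x : F) = x := by
        have := congrArg Units.val hx
        rw [hh] at this
        have hx0 := x.ne_zero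
        field_simp at this
        simpa using this
      obtain ⟨u, hu⟩ := hsu.exists_left_inv
      have h4 := fr_mul_nat p r n hF (s + s) (x : F) h3 u.val
      rw [ZMod.natCast_val, ZMod.cast_id] at h4
      have h5 : u * (s + s) = ((2 : ℕ) : ZMod n) := by push_cast; linear_combination 2 * hu
      rw [h5, fr_natCast p r n hF] at h4
      apply mul_right_cancel (b := x)
      rw [← pow_succ, Nat.sub_add_cancel h1, one_mul]
      ext; simpa using h4)
    (by
      intro x
      ext
      rw [Units.val_pow_eq_pow_val, hh, ← N2_eq p r n h2, N2_mul, N2_inv, N2_fr p r n hF,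
        fr_even_N2 p r n hF h2 _ hp2, Units.val_one]
      exact mul_inv_cancel₀ (N2_ne_zero p r n h2 _ x.ne_zero))
    (Units.mk0 w hw0) (by ext; simp [← N2_eq p r n h2, hw])
  have hx' := congrArg Units.val hx
  rw [hh, Units.val_mk0] at hx'
  refine ⟨fr p r n s (x : F), (map_ne_zero _).2 x.ne_zero, ?_⟩
  rw [fr_neg_apply p r n hF, ← fr_add p r n hF, ← hx', mul_assoc, inv_mul_cancel₀ x.ne_zero, mul_one]

omit [Fintype F] [CharP F p] [Fact p.Prime] [NeZero n] in
lemma equiv_of_slopes {F : Type*} [Field F] (f g : F → F) (τ : F ≃+* F) (ν : F) (hν : ν ≠ 0)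
    (h : ∀ c, c ∈ slopes g ↔ ∃ e ∈ slopes f, c = ν * τ e) : PGammaLEquiv F f g := by
  let φ : (Fin 2 → F) ≃ (Fin 2 → F) :=
    { toFun := fun v => ![τ (v 0), ν * τ (v 1)]
      invFun := fun v => ![τ.symm (v 0), τ.symm (ν⁻¹ * v 1)]
      left_inv := by
        intro v; ext i; fin_cases i <;> simp [hν]
      right_inv := by
        intro v; ext i; fin_cases i <;> simp [hν] }
  have hφ : ∀ v, φ v = ![τ (v 0), ν * τ (v 1)] := fun v => rfl
  refine ⟨τ, φ, ?_, ?_, ?_⟩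
  · intro v w; rw [hφ, hφ, hφ]; ext i; fin_cases i <;> simp; ring
  · intro c v; rw [hφ, hφ]; ext i; fin_cases i <;> simp; ring
  · have key : ∀ (x y : F) (_ : x ≠ 0) (_ : y ≠ 0) (hx : φ ![x, f x] ≠ 0) (hy : (![y, g y] : Fin 2 → F) ≠ 0),
        (Projectivization.mk F (φ ![x, f x]) hx = Projectivization.mk F ![y, g y] hy ↔
          g y / y = ν * τ (f x / x)) := by
      intro x y hx0 hy0 hx hy
      have hτx : τ x ≠ 0 := by simpa using hx0
      rw [Projectivization.mk_eq_mk_iff', hφ]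
      simp only [Matrix.cons_val_zero, Matrix.cons_val_one, map_div₀]
      constructor
      · rintro ⟨u, hu⟩
        have e0 : u * y = τ x := by simpa using congrFun hu 0
        have e1 : u * g y = ν * τ (f x) := by simpa using congrFun hu 1
        have hu0 : u ≠ 0 := by rintro rfl; simp only [zero_mul] at e0; exact hτx e0.symm
        rw [mul_div_assoc', ← e1, ← e0, mul_div_mul_left _ _ hu0]
      · intro he
        refine ⟨τ x / y, ?_⟩
        ext i
        fin_cases i
        · simp [hy0]
        · simp
          field_simp at he ⊢
          linear_combination he
    ext P
    constructor
    · rintro ⟨x, hx, hx', rfl⟩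
      have : ν * τ (f x / x) ∈ slopes g := (h _).2 ⟨f x / x, ⟨Units.mk0 x hx, rfl⟩, rfl⟩
      obtain ⟨y, hy⟩ := this
      have hy' : (![(y : F), g y] : Fin 2 → F) ≠ 0 := by
        intro h0
        have := congrFun h0 0
        simp at this
      exact ⟨y, y.ne_zero, hy', (key x y hx y.ne_zero hx' hy').2 hy⟩
    · rintro ⟨y, hy, hy', rfl⟩
      obtain ⟨_, ⟨x, rfl⟩, hx⟩ := (h (g y / y)).1 ⟨Units.mk0 y hy, rfl⟩
      have hx' : φ ![(x : F), f x] ≠ 0 := by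
        intro h0
        have := congrFun h0 0
        simp [hφ] at this
      exact ⟨x, x.ne_zero, hx', ((key x y x.ne_zero hy hx' hy').2 hx).symm⟩

include hF in
lemma slopes_conv1 (hr : 0 < r) (s : ZMod n) (hsu : IsUnit s) (θ δ : F) (hθ : θ ≠ 0) (hδ : δ ≠ 0)
    (τ : F ≃+* F) (h : N2 p r n h2 δ = N2 p r n h2 (τ θ)) : ∃ ν : F, ν ≠ 0 ∧
    ∀ c, c ∈ slopes (fun x => fr p r n s x + δ * fr p r n (-s) x) ↔
      ∃ e ∈ slopes (fun x => fr p r n s x + θ * fr p r n (-s) x), c = ν * τ e := by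
  have hτθ : τ θ ≠ 0 := by simpa using hθ
  obtain ⟨l, hl0, hl⟩ := hilbert90 p r n hF h2 hr s hsu (δ * (τ θ)⁻¹)
    (mul_ne_zero hδ (inv_ne_zero hτθ)) (by
      rw [N2_mul, N2_inv, h, mul_inv_cancel₀ (N2_ne_zero p r n h2 _ hτθ)])
  have hτfr : ∀ (k : ZMod n) (x : F), τ (fr p r n k x) = fr p r n k (τ x) := by
    intro k x
    rw [fr_apply, fr_apply, map_pow]
  have hl' : fr p r n s l * τ θ = δ * fr p r n (-s) l := by
    rw [hl]; field_simp
  have key : ∀ x : F, x ≠ 0 → (fr p r n s (l * τ x) + δ * fr p r n (-s) (l * τ x)) / (l * τ x) =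
      fr p r n s l / l * τ ((fr p r n s x + θ * fr p r n (-s) x) / x) := by
    intro x hx
    have hτx : τ x ≠ 0 := by simpa using hx
    rw [map_div₀, map_add, map_mul τ, hτfr, hτfr, map_mul, map_mul, div_mul_div_comm]
    congr 1
    linear_combination (-fr p r n (-s) (τ x)) * hl'
  refine ⟨fr p r n s l / l, div_ne_zero ((map_ne_zero _).2 hl0) hl0, fun c => ?_⟩
  constructor
  · rintro ⟨y, rfl⟩
    have hx : τ.symm (l⁻¹ * y) ≠ 0 := by simp [hl0]
    refine ⟨_, ⟨Units.mk0 _ hx, rfl⟩, ?_⟩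
    have := key _ hx
    rw [Units.val_mk0, ← this, τ.apply_symm_apply, mul_inv_cancel_left₀ hl0]
  · rintro ⟨_, ⟨x, rfl⟩, rfl⟩
    have hy : l * τ x ≠ 0 := mul_ne_zero hl0 (by simp)
    exact ⟨Units.mk0 _ hy, key x x.ne_zero⟩

include hF in
lemma adj (hr : 0 < r) (s : ZMod n) (α β c x : F) (hx0 : x ≠ 0)
    (hx : α * fr p r n s x + β * fr p r n (-s) x = c * x) :
    ∃ y, y ≠ 0 ∧ fr p r n (-s) (α * y) + fr p r n s (β * y) = c * y := by
  by_contra hcon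
  push Not at hcon
  let L : F → F := fun y => fr p r n (-s) (α * y) + fr p r n s (β * y) - c * y
  have hL : Function.Injective L := by
    intro y z hyz
    by_contra hne
    apply hcon (y - z) (sub_ne_zero.2 hne)
    simp only [L] at hyz
    rw [mul_sub, mul_sub, map_sub, map_sub]
    linear_combination hyz
  have hsurj : Function.Surjective L := Finite.injective_iff_surjective.1 hL
  have htr : ∀ (j : ZMod n) (z : F), ∑ k, fr p r n k (fr p r n j z) = ∑ k, fr p r n k z := by
    intro j z
    rw [← Equiv.sum_comp (Equiv.addRight j) (fun k => fr p r n k z)]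
    apply Finset.sum_congr rfl
    intro k _
    rw [Equiv.coe_addRight, fr_add p r n hF]
  have hzero : ∀ u : F, ∑ k, fr p r n k x * fr p r n k u = 0 := by
    intro u
    obtain ⟨y, rfl⟩ := hsurj u
    simp only [← map_mul]
    have e1 : x * L y = x * fr p r n (-s) (α * y) + x * fr p r n s (β * y) - c * x * y := by
      simp only [L]; ring
    have e2 : ∑ k, fr p r n k (x * fr p r n (-s) (α * y)) = ∑ k, fr p r n k (fr p r n s x * (α * y)) := by
      rw [← htr s]
      apply Finset.sum_congr rfl
      intro k _
      rw [map_mul (fr p r n s), fr_apply_neg p r n hF]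
    have e3 : ∑ k, fr p r n k (x * fr p r n s (β * y)) = ∑ k, fr p r n k (fr p r n (-s) x * (β * y)) := by
      rw [← htr (-s)]
      apply Finset.sum_congr rfl
      intro k _
      rw [map_mul (fr p r n (-s)), fr_neg_apply p r n hF]
    simp only [e1, ← hx, map_sub, map_add (fr p r n _) (x * _), Finset.sum_add_distrib, Finset.sum_sub_distrib]
    rw [e2, e3, ← Finset.sum_add_distrib, ← Finset.sum_sub_distrib]
    apply Finset.sum_eq_zero
    intro k _
    rw [← map_add, ← map_sub]
    ring_nf
    exact map_zero _
  have := fr_indep p r n hF hr (fun k => fr p r n k x) hzero 0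
  simp only [fr_zero] at this
  exact hx0 this

include hF in
lemma slopes_inv (hr : 0 < r) (s : ZMod n) (δ : F) (hδ : δ ≠ 0) (c : F) :
    c ∈ slopes (fun x => fr p r n s x + δ * fr p r n (-s) x) ↔
      ∃ e ∈ slopes (fun x => fr p r n s x + (fr p r n s δ)⁻¹ * fr p r n (-s) x), c = fr p r n s δ * e := by
  have hD : fr p r n s δ ≠ 0 := (map_ne_zero _).2 hδ
  constructor
  · rintro ⟨x, rfl⟩
    obtain ⟨y, hy0, hy⟩ := adj p r n hF hr s 1 δ ((fr p r n s (x : F) + δ * fr p r n (-s) (x : F)) / (x : F)) x x.ne_zero (by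
      have := x.ne_zero; field_simp)
    refine ⟨_, ⟨Units.mk0 y hy0, rfl⟩, ?_⟩
    simp only [Units.val_mk0]
    generalize (fr p r n s (x : F) + δ * fr p r n (-s) (x : F)) / x = c at *
    rw [one_mul, map_mul] at hy
    field_simp
    linear_combination -hy
  · rintro ⟨_, ⟨x, rfl⟩, rfl⟩
    generalize he : (fr p r n s (x : F) + (fr p r n s δ)⁻¹ * fr p r n (-s) (x : F)) / x = e
    have hx0 := x.ne_zero
    obtain ⟨y, hy0, hy⟩ := adj p r n hF hr s (fr p r n s δ) 1 (fr p r n s δ * e) x x.ne_zero (by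
      rw [← he]; field_simp)
    refine ⟨Units.mk0 y hy0, ?_⟩
    rw [map_mul, fr_neg_apply p r n hF, one_mul] at hy
    simp only [Units.val_mk0]
    rw [div_eq_iff hy0]
    linear_combination hy

lemma exists_aut (k : ℕ) : ∃ τ : F ≃+* F, ∀ x, τ x = x ^ p ^ k :=
  ⟨RingEquiv.ofBijective (iterateFrobenius F p k)
    (Finite.injective_iff_bijective.1 (RingHom.injective _)), fun x => by
      simp [iterateFrobenius_def]⟩

include hF in
theorem bwd (hr : 0 < r) (s : ℕ) (θ δ : F)
    (h1 : (s, θ) ∈ LPparams (p ^ r) n F) (h1' : (s, δ) ∈ LPparams (p ^ r) n F)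
    (h : Rel p (N2 p r n h2 θ) (N2 p r n h2 δ)) :
    PGammaLEquiv F (fun x => x ^ (p ^ r) ^ s + θ * x ^ (p ^ r) ^ (n - s))
      (fun x => x ^ (p ^ r) ^ s + δ * x ^ (p ^ r) ^ (n - s)) := by
  obtain ⟨a1, a2, a3, a4, -⟩ := h1
  obtain ⟨b1, b2, b3, b4, -⟩ := h1'
  simp only at a1 a2 a3 a4 b4
  rw [poly_eq p r n hF s a2, poly_eq p r n hF s a2]
  have hsu := isUnit_natCast n s a3
  have hps := par_natCast n h2 s a3
  generalize (s : ZMod n) = S at *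
  obtain ⟨k, hk | hk⟩ := h
  · obtain ⟨τ, hτ⟩ := exists_aut (F := F) p k
    obtain ⟨ν, hν, hsl⟩ := slopes_conv1 p r n hF h2 hr S hsu θ δ a4 b4 τ (by rw [hτ, hk, N2_pow])
    exact equiv_of_slopes _ _ τ ν hν hsl
  · obtain ⟨τ, hτ⟩ := exists_aut (F := F) p (k + r)
    have hD : fr p r n S δ ≠ 0 := (map_ne_zero _).2 b4
    obtain ⟨ν, hν, hsl⟩ := slopes_conv1 p r n hF h2 hr S hsu θ (fr p r n S δ)⁻¹ a4 (inv_ne_zero hD) τ (by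
      rw [hτ, N2_inv, N2_fr p r n hF, fr_odd_N2 p r n hF h2 _ hps, N2_pow, ← map_inv₀,
        inv_eq_of_mul_eq_one_right hk]
      have := fr_natCast p r n hF 1 (N2 p r n h2 θ ^ p ^ k)
      rw [Nat.cast_one] at this
      rw [this, ← pow_mul, pow_one, pow_add])
    apply equiv_of_slopes _ _ τ (fr p r n S δ * ν) (mul_ne_zero hD hν)
    intro c
    rw [slopes_inv p r n hF hr S δ b4]
    constructor
    · rintro ⟨e, he, rfl⟩
      obtain ⟨e', he', rfl⟩ := (hsl e).1 he
      exact ⟨e', he', by ring⟩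
    · rintro ⟨e, he, rfl⟩
      exact ⟨ν * τ e, (hsl _).2 ⟨e, he, rfl⟩, by ring⟩

end Conv
end LPC


set_option linter.unusedSectionVars false
set_option linter.style.haveILetI false

namespace LPC

section Per
variable (p : ℕ) [hp : Fact p.Prime] {F : Type*} [Field F] [Fintype F] [CharP F p]

/-- The Frobenius period of an element. -/
noncomputable def per {F : Type*} [Field F] (p : ℕ) (z : F) : ℕ := Function.minimalPeriod (fun x : F => x ^ p) z

lemma per_dvd_iff {F : Type*} [Field F] (p : ℕ) (z : F) (k : ℕ) : per p z ∣ k ↔ z ^ p ^ k = z := by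
  rw [per, ← Function.isPeriodicPt_iff_minimalPeriod_dvd, Function.IsPeriodicPt, Function.IsFixedPt,
    pow_iterate]

lemma per_pos (m : ℕ) (hm : 0 < m) (z : F) (h : z ^ p ^ m = z) : 0 < per p z :=
  Nat.pos_of_dvd_of_pos ((per_dvd_iff p z m).2 h) hm

lemma pow_mod_per {F : Type*} [Field F] (p : ℕ) (z : F) (k : ℕ) : z ^ p ^ (k % per p z) = z ^ p ^ k := by
  have := Function.iterate_mod_minimalPeriod_eq (f := fun x : F => x ^ p) (x := z) (n := k)
  rw [pow_iterate, pow_iterate] at this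
  exact this

lemma pow_inj_per {F : Type*} [Field F] (p : ℕ) (z : F) (i j : ℕ) (hi : i < per p z) (hj : j < per p z)
    (h : z ^ p ^ i = z ^ p ^ j) : i = j := by
  rw [← Function.iterate_eq_iterate_iff_of_lt_minimalPeriod (f := fun x : F => x ^ p) (x := z) hi hj,
    pow_iterate, pow_iterate]
  exact h

/-- `z` is conjugate to its inverse. -/
def Jp {F : Type*} [Field F] (p : ℕ) (z : F) : Prop := ∃ k, k < per p z ∧ z ^ (p ^ k + 1) = 1

open scoped Classical in
lemma orbit_card (m : ℕ) (hm : 0 < m) (z : F) (hz0 : z ≠ 0) (h : z ^ p ^ m = z) :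
    ((Finset.univ.filter (fun w : F => Rel p z w)).card : ℚ) = if Jp p z then (per p z : ℚ) else 2 * per p z := by
  have hpos := per_pos p m hm z h
  set O1 := (Finset.range (per p z)).image (fun k => z ^ p ^ k) with hO1
  set O2 := (Finset.range (per p z)).image (fun k => (z ^ p ^ k)⁻¹) with hO2
  have c1 : O1.card = per p z := by
    rw [Finset.card_image_of_injOn, Finset.card_range]
    intro i hi j hj hij
    exact pow_inj_per p z i j (by simpa using hi) (by simpa using hj) hij
  have c2 : O2.card = per p z := by
    rw [Finset.card_image_of_injOn, Finset.card_range]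
    intro i hi j hj hij
    exact pow_inj_per p z i j (by simpa using hi) (by simpa using hj) (inv_injective hij)
  have hz : ∀ k, z ^ p ^ k ≠ 0 := fun k => pow_ne_zero _ hz0
  have m1 : ∀ w, w ∈ O1 ↔ ∃ k, w = z ^ p ^ k := by
    intro w
    simp only [hO1, Finset.mem_image, Finset.mem_range]
    constructor
    · rintro ⟨k, -, rfl⟩; exact ⟨k, rfl⟩
    · rintro ⟨k, rfl⟩; exact ⟨k % per p z, Nat.mod_lt _ hpos, pow_mod_per p z k⟩
  have m2 : ∀ w, w ∈ O2 ↔ ∃ k, w * z ^ p ^ k = 1 := by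
    intro w
    simp only [hO2, Finset.mem_image, Finset.mem_range]
    constructor
    · rintro ⟨k, -, rfl⟩; exact ⟨k, inv_mul_cancel₀ (hz k)⟩
    · rintro ⟨k, hk⟩
      exact ⟨k % per p z, Nat.mod_lt _ hpos, by rw [pow_mod_per p z k]; exact (eq_inv_of_mul_eq_one_left hk).symm⟩
  have hU : Finset.univ.filter (fun w : F => Rel p z w) = O1 ∪ O2 := by
    ext w
    rw [Finset.mem_filter, Finset.mem_union, m1, m2, Rel, exists_or]
    simp only [Finset.mem_univ, true_and]
  rw [hU]
  split_ifs with hJ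
  · obtain ⟨k, hk, hk'⟩ := hJ
    have : O2 ⊆ O1 := by
      intro w hw
      obtain ⟨j, hj⟩ := (m2 w).1 hw
      refine (m1 w).2 ⟨k + j, ?_⟩
      rw [pow_succ] at hk'
      have e : z ^ p ^ k = z⁻¹ := eq_inv_of_mul_eq_one_left hk'
      rw [pow_add, pow_mul, e, inv_pow]
      exact eq_inv_of_mul_eq_one_left hj
    rw [Finset.union_eq_left.2 this, c1]
  · rw [Finset.card_union_of_disjoint, c1, c2]
    · push_cast; ring
    · rw [Finset.disjoint_left]
      intro w h1 h2
      obtain ⟨i, rfl⟩ := (m1 w).1 h1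
      obtain ⟨j, hj⟩ := (m2 _).1 h2
      apply hJ
      -- raise to a power making the second exponent trivial
      have hper : z ^ p ^ (j + (per p z - 1) * j) = z := by
        rw [← per_dvd_iff]
        exact ⟨j, by
          obtain ⟨c, hc⟩ := Nat.exists_eq_add_of_lt hpos
          rw [hc]; simp; ring⟩
      refine ⟨(i + (per p z - 1) * j) % per p z, Nat.mod_lt _ hpos, ?_⟩
      rw [pow_succ, pow_mod_per]
      have := congrArg (fun x => x ^ p ^ ((per p z - 1) * j)) hj
      beta_reduce at this
      rw [mul_pow, one_pow, ← pow_mul, ← pow_mul, ← pow_add p i, ← pow_add p j, hper] at this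
      exact this

omit [Fintype F] hp [CharP F p] in
open scoped Classical in
lemma class_count (Z : Finset F) (R : F → F → Prop) (hrefl : ∀ z ∈ Z, R z z)
    (hsymm : ∀ z ∈ Z, ∀ w ∈ Z, R z w → R w z)
    (htrans : ∀ x ∈ Z, ∀ y ∈ Z, ∀ z ∈ Z, R x y → R y z → R x z) :
    ((Z.image (fun z => Z.filter (R z))).card : ℚ) = ∑ z ∈ Z, 1 / ((Z.filter (R z)).card : ℚ) := by
  rw [← Finset.sum_fiberwise_of_maps_to (t := Z.image (fun z => Z.filter (R z)))
    (g := fun z => Z.filter (R z)) (fun z hz => Finset.mem_image_of_mem _ hz), Finset.card_eq_sum_ones]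
  push_cast
  apply Finset.sum_congr rfl
  intro O hO
  obtain ⟨z, hz, rfl⟩ := Finset.mem_image.1 hO
  have : Z.filter (fun w => Z.filter (R w) = Z.filter (R z)) = Z.filter (R z) := by
    apply Finset.filter_congr
    intro w hw
    constructor
    · intro h
      have : w ∈ Z.filter (R w) := Finset.mem_filter.2 ⟨hw, hrefl w hw⟩
      rw [h] at this
      exact (Finset.mem_filter.1 this).2
    · intro h
      apply Finset.filter_congr
      intro x hx
      exact ⟨fun h1 => htrans z hz w hw x hx h h1,
        fun h1 => htrans w hw z hz x hx (hsymm z hz w hw h) h1⟩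
  rw [Finset.sum_congr rfl (fun w hw => by rw [(Finset.mem_filter.1 hw).2]), Finset.sum_const, this]
  have hne : ((Z.filter (R z)).card : ℚ) ≠ 0 := by
    have : z ∈ Z.filter (R z) := Finset.mem_filter.2 ⟨hz, hrefl z hz⟩
    have := Finset.card_pos.2 ⟨z, this⟩
    positivity
  rw [nsmul_eq_mul]
  field_simp

end Per
end LPC


set_option linter.unusedSectionVars false
set_option linter.style.haveILetI false

namespace LPC

section Emb
variable (p N : ℕ) [hp : Fact p.Prime] {F : Type*} [Field F] [Fintype F] [CharP F p]
  (hF : Fintype.card F = p ^ N)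

include hF in
lemma exists_emb (m : ℕ) (hm : 0 < m) (hmN : m ∣ N) : Nonempty (GaloisField p m →+* F) := by
  letI : Algebra (ZMod p) F := ZMod.algebra F p
  have hf : Module.finrank (ZMod p) F = N := by
    have := FiniteField.pow_finrank_eq_card p F
    rw [hF] at this
    exact Nat.pow_right_injective (Fact.out : p.Prime).two_le this
  have : Nonempty (GaloisField p m →ₐ[ZMod p] F) := by
    apply FiniteField.nonempty_algHom_of_finrank_dvd
    rw [hf, GaloisField.finrank p hm.ne']
    exact hmN
  exact ⟨this.some.toRingHom⟩

lemma galois_fixed (m : ℕ) (hm : 0 < m) (x : GaloisField p m) : x ^ p ^ m = x := by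
  have hc := GaloisField.card p m hm.ne'
  haveI : Fintype (GaloisField p m) := Fintype.ofFinite _
  rw [← hc, Nat.card_eq_fintype_card]
  exact FiniteField.pow_card x

lemma fixed_range (m : ℕ) (hm : 0 < m) (i : GaloisField p m →+* F) :
    Set.range i = {x : F | x ^ p ^ m = x} := by
  classical
  apply Set.eq_of_subset_of_ncard_le
  · rintro _ ⟨x, rfl⟩
    rw [Set.mem_ofPred_eq, ← map_pow, galois_fixed p m hm]
  · rw [← Set.image_univ, Set.ncard_image_of_injective _ i.injective, Set.ncard_univ,
      GaloisField.card p m hm.ne']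
    have hne : (Polynomial.X ^ p ^ m - Polynomial.X : Polynomial F) ≠ 0 :=
      FiniteField.X_pow_card_pow_sub_X_ne_zero F hm.ne' hp.out.one_lt
    have hdeg := FiniteField.X_pow_card_pow_sub_X_natDegree_eq F hm.ne' hp.out.one_lt
    calc _ ≤ ((Polynomial.X ^ p ^ m - Polynomial.X : Polynomial F).roots.toFinset : Set F).ncard := by
          apply Set.ncard_le_ncard _ (Finset.finite_toSet _)
          intro x hx
          simp only [Set.mem_ofPred_eq] at hx
          simp [hne, hx, sub_eq_zero]
      _ ≤ p ^ m := by
          rw [Set.ncard_coe_finset]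
          calc _ ≤ _ := Multiset.toFinset_card_le _
            _ ≤ _ := Polynomial.card_roots' _
            _ = _ := hdeg
  · exact Set.toFinite _

lemma per_emb {K L : Type*} [Field K] [Field L] (i : K →+* L) (x : K) : per p (i x) = per p x := by
  apply Nat.dvd_antisymm
  · rw [per_dvd_iff, ← map_pow, (per_dvd_iff p x _).1 dvd_rfl]
  · rw [per_dvd_iff]
    apply i.injective
    rw [map_pow, (per_dvd_iff p (i x) _).1 dvd_rfl]

lemma mem_noProper (m : ℕ) (hm : 0 < m) (x : GaloisField p m) : x ∈ noProperSubfield p m ↔ per p x = m := by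
  have h1 := (per_dvd_iff p x m).2 (galois_fixed p m hm x)
  constructor
  · intro h
    by_contra hne
    exact h _ h1 (lt_of_le_of_ne (Nat.le_of_dvd hm h1) hne) ((per_dvd_iff p x _).1 dvd_rfl)
  · intro h d hd hlt hx
    have := (per_dvd_iff p x d).2 hx
    rw [h] at this
    have hd0 : 0 < d := Nat.pos_of_dvd_of_pos hd hm
    have := Nat.le_of_dvd hd0 this
    omega

include hF in
lemma ncard_F (m : ℕ) (hm : 0 < m) (hmN : m ∣ N) :
    (noProperSubfield p m).ncard = {z : F | per p z = m}.ncard := by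
  obtain ⟨i⟩ := exists_emb p N hF m hm hmN
  rw [← Set.ncard_image_of_injective _ i.injective]
  congr 1
  ext z
  constructor
  · rintro ⟨x, hx, rfl⟩
    rw [Set.mem_ofPred_eq, per_emb, (mem_noProper p m hm x).1 hx]
  · intro hz
    have : z ∈ Set.range i := by
      rw [fixed_range p m hm i, Set.mem_ofPred_eq, ← per_dvd_iff, hz]
    obtain ⟨x, rfl⟩ := this
    rw [Set.mem_ofPred_eq, per_emb] at hz
    exact ⟨x, (mem_noProper p m hm x).2 hz, rfl⟩

include hF in
lemma ncard_K (m : ℕ) (hm : 0 < m) (hmN : m ∣ N) :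
    (Kset p m).ncard = {z : F | per p z = m ∧ Jp p z}.ncard := by
  obtain ⟨i⟩ := exists_emb p N hF m hm hmN
  rw [← Set.ncard_image_of_injective _ i.injective]
  congr 1
  ext z
  have hpow : ∀ (x : GaloisField p m) k, i x ^ k = 1 ↔ x ^ k = 1 := by
    intro x k
    rw [← map_pow, map_eq_one_iff i i.injective]
  constructor
  · rintro ⟨x, ⟨hx, k, hk, hk'⟩, rfl⟩
    have := (mem_noProper p m hm x).1 hx
    refine ⟨by rw [per_emb, this], k, ?_, (hpow x _).2 hk'⟩
    rw [per_emb, this]; exact hk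
  · rintro ⟨hz, k, hk, hk'⟩
    have : z ∈ Set.range i := by
      rw [fixed_range p m hm i, Set.mem_ofPred_eq, ← per_dvd_iff, hz]
    obtain ⟨x, rfl⟩ := this
    rw [per_emb] at hz hk
    exact ⟨x, ⟨(mem_noProper p m hm x).2 hz, k, by omega, (hpow x _).1 hk'⟩, rfl⟩

include hF in
lemma ncard_fixed (hN : 0 < N) : {z : F | z ^ p = z}.ncard = p := by
  obtain ⟨i⟩ := exists_emb p N hF 1 one_pos (one_dvd _)
  have := fixed_range p 1 one_pos i
  rw [pow_one] at this
  rw [← this, ← Set.image_univ, Set.ncard_image_of_injective _ i.injective, Set.ncard_univ,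
      GaloisField.card p 1 one_ne_zero, pow_one]

include hF in
lemma ncard_one (hN : 0 < N) : (({z : F | z ≠ 0 ∧ z ^ p = z ∧ z * z ≠ 1}.ncard : ℕ) : ℚ) / 2 =
    if p = 2 then 0 else ((p : ℚ) - 3) / 2 := by
  classical
  have h1 := ncard_fixed p N hF hN
  have hp0 := hp.out.pos
  by_cases h2 : p = 2
  · rw [if_pos h2]
    have : {z : F | z ≠ 0 ∧ z ^ p = z ∧ z * z ≠ 1} = ∅ := by
      rw [Set.eq_empty_iff_forall_notMem]
      rintro z ⟨h0, h3, h4⟩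
      rw [h2, pow_two] at h3
      apply h4
      have : z = 1 := by
        apply mul_left_cancel₀ h0
        rw [h3, mul_one]
      rw [this, mul_one]
    rw [this]; simp
  · rw [if_neg h2]
    have hodd : Odd p := hp.out.odd_of_ne_two h2
    have hne : (-1 : F) ≠ 1 := by
      haveI : Fact (2 < p) := ⟨lt_of_le_of_ne hp.out.two_le (Ne.symm h2)⟩
      exact CharP.neg_one_ne_one F p
    have hd : {z : F | z ≠ 0 ∧ z ^ p = z ∧ z * z ≠ 1} = {z : F | z ^ p = z} \ {0, 1, -1} := by
      ext z
      simp only [Set.mem_ofPred_eq, Set.mem_sdiff, Set.mem_insert_iff, Set.mem_singleton_iff, not_or,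
        ne_eq, mul_self_eq_one_iff]
      tauto
    have hc3 : ({0, 1, -1} : Set F).ncard = 3 := by
      rw [Set.ncard_eq_three]
      exact ⟨0, 1, -1, zero_ne_one, by simp, hne.symm, rfl⟩
    have := Set.ncard_sdiff_add_ncard_of_subset (s := ({0, 1, -1} : Set F)) (t := {z : F | z ^ p = z}) (by
      rintro z (rfl | rfl | rfl)
      · simp [hp0.ne']
      · simp
      · simp [hodd.neg_one_pow]) (Set.toFinite _)
    rw [← hd, h1, hc3] at this
    have : (({z : F | z ≠ 0 ∧ z ^ p = z ∧ z * z ≠ 1}.ncard : ℕ) : ℚ) + 3 = p := by exact_mod_cast this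
    rw [← this]; ring

end Emb

lemma totient_half (n : ℕ) (hn : 3 ≤ n) :
    (({s : ℕ | 1 ≤ s ∧ 2 * s < n ∧ Nat.gcd s n = 1}.ncard : ℕ) : ℚ) = (Nat.totient n : ℚ) / 2 := by
  set A := (Finset.range n).filter (fun s => 1 ≤ s ∧ 2 * s < n ∧ Nat.gcd s n = 1) with hA
  have hS : {s : ℕ | 1 ≤ s ∧ 2 * s < n ∧ Nat.gcd s n = 1} = (A : Set ℕ) := by
    ext s
    simp only [hA, Set.mem_ofPred_eq, Finset.coe_filter, Finset.mem_range]
    constructor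
    · intro h; exact ⟨by omega, h⟩
    · intro h; exact h.2
  rw [hS, Set.ncard_coe_finset]
  have hgcd : ∀ s, s ≤ n → Nat.gcd (n - s) n = Nat.gcd s n := by
    intro s hs
    rw [Nat.gcd_self_sub_left hs]
  have hU : (Finset.range n).filter (fun s => n.Coprime s) = A ∪ A.image (fun s => n - s) := by
    ext s
    simp only [hA, Finset.mem_filter, Finset.mem_union, Finset.mem_image, Finset.mem_range]
    constructor
    · rintro ⟨h1, h2⟩
      have h2' : Nat.gcd s n = 1 := by rw [Nat.gcd_comm]; exact h2
      have hs0 : 1 ≤ s := by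
        rcases Nat.eq_zero_or_pos s with rfl | h
        · simp at h2'; omega
        · exact h
      rcases lt_trichotomy (2 * s) n with h | h | h
      · exact Or.inl ⟨h1, hs0, h, h2'⟩
      · exfalso
        rw [← h, Nat.gcd_mul_left_right] at h2'
        omega
      · exact Or.inr ⟨n - s, ⟨by omega, by omega, by omega, by rw [hgcd s h1.le]; exact h2'⟩, by omega⟩
    · rintro (⟨h1, h2, h3, h4⟩ | ⟨t, ⟨h1, h2, h3, h4⟩, rfl⟩)
      · exact ⟨h1, by rw [Nat.coprime_comm]; exact h4⟩
      · exact ⟨by omega, by rw [Nat.coprime_comm]; exact (hgcd t h1.le).trans h4⟩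
  have hcard := congrArg Finset.card hU
  rw [Finset.card_union_of_disjoint, Finset.card_image_of_injOn] at hcard
  · have : Nat.totient n = A.card + A.card := by
      rw [← hcard]; rfl
    rw [this]; push_cast; ring
  · intro x hx y hy hxy
    simp only [hA, Finset.coe_filter, Finset.mem_range, Set.mem_ofPred_eq] at hx hy hxy
    omega
  · rw [Finset.disjoint_left]
    intro x hx hx'
    obtain ⟨y, hy, rfl⟩ := Finset.mem_image.1 hx'
    simp only [hA, Finset.mem_filter, Finset.mem_range] at hx hy
    omega

end LPC


set_option linter.unusedSectionVars false
set_option linter.style.haveILetI false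

namespace LPC

section ZZ
variable (p r N : ℕ) [hp : Fact p.Prime] {F : Type*} [Field F] [Fintype F] [CharP F p]
  (hF : Fintype.card F = p ^ N)

/-- The admissible norms. -/
def Zset (p r : ℕ) (F : Type*) [Field F] : Set F :=
  {z | z ≠ 0 ∧ z ^ p ^ (2 * r) = z ∧ z ^ (p ^ r + 1) ≠ 1}

lemma pow_p_inj (k : ℕ) (x y : F) (h : x ^ p ^ k = y ^ p ^ k) : x = y := by
  apply RingHom.injective (iterateFrobenius F p k)
  simpa [iterateFrobenius_def] using h

lemma Rel_mem (z w : F) (hz : z ∈ Zset p r F) (h : Rel p z w) : w ∈ Zset p r F := by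
  obtain ⟨h0, h1, h2⟩ := hz
  obtain ⟨k, hk⟩ := h
  have a0 : z ^ p ^ k ≠ 0 := pow_ne_zero _ h0
  have a1 : (z ^ p ^ k) ^ p ^ (2 * r) = z ^ p ^ k := by
    rw [← pow_mul, mul_comm, pow_mul, h1]
  have a2 : (z ^ p ^ k) ^ (p ^ r + 1) ≠ 1 := by
    intro h
    apply h2
    apply pow_p_inj p k
    rw [one_pow, ← pow_mul, mul_comm, pow_mul, h]
  rcases hk with rfl | hk
  · exact ⟨a0, a1, a2⟩
  · have : w = (z ^ p ^ k)⁻¹ := eq_inv_of_mul_eq_one_left hk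
    rw [this]
    refine ⟨inv_ne_zero a0, by rw [inv_pow, a1], ?_⟩
    rw [inv_pow, ne_eq, inv_eq_one]
    exact a2

lemma Rel_refl (z : F) : Rel p z z := ⟨0, Or.inl (by simp)⟩

lemma Rel_symm (hr : 0 < r) (z w : F) (hz : z ∈ Zset p r F) (h : Rel p z w) : Rel p w z := by
  obtain ⟨h0, h1, h2⟩ := hz
  obtain ⟨k, hk⟩ := h
  have hper : z ^ p ^ (k + (2 * r - 1) * k) = z := by
    rw [← per_dvd_iff]
    have : k + (2 * r - 1) * k = 2 * r * k := by
      obtain ⟨c, rfl⟩ := Nat.exists_eq_add_of_lt hr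
      simp; ring_nf
      rw [show 2 + c * 2 - 1 = 1 + c * 2 by omega]; ring
    rw [this]
    exact Dvd.dvd.mul_right ((per_dvd_iff p z _).2 h1) _
  refine ⟨(2 * r - 1) * k, ?_⟩
  rcases hk with rfl | hk
  · left
    rw [← pow_mul, ← pow_add, hper]
  · right
    have := congrArg (fun x => x ^ p ^ ((2 * r - 1) * k)) hk
    beta_reduce at this
    rw [mul_pow, one_pow, ← pow_mul z, ← pow_add, hper] at this
    rw [mul_comm]; exact this

lemma Rel_trans (x y z : F) (h1 : Rel p x y) (h2 : Rel p y z) : Rel p x z := by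
  obtain ⟨k, hk⟩ := h1
  obtain ⟨j, hj⟩ := h2
  refine ⟨k + j, ?_⟩
  rw [pow_add, pow_mul]
  rcases hk with rfl | hk
  · exact hj
  · have hk' : x ^ p ^ k = y⁻¹ := eq_inv_of_mul_eq_one_right hk
    have hy : y ≠ 0 := left_ne_zero_of_mul_eq_one hk
    have hyj : y ^ p ^ j ≠ 0 := pow_ne_zero _ hy
    rw [hk', inv_pow]
    rcases hj with rfl | hj
    · right; exact mul_inv_cancel₀ hyj
    · left; exact eq_inv_of_mul_eq_one_left hj

lemma per_one_of_sq (z : F) (h : z * z = 1) : z ^ p = z := by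
  rcases mul_self_eq_one_iff.1 h with rfl | rfl
  · simp
  · rcases hp.out.eq_two_or_odd' with h2 | h2
    · subst h2
      have : (-1 : F) = 1 := by
        have := CharP.cast_eq_zero F 2
        push_cast at this
        linear_combination -this
      rw [this]; simp
    · exact h2.neg_one_pow

lemma mem_Z_dvd (hr : 0 < r) (m : ℕ) (hm : m ∣ r) (z : F) (hz : per p z = m) :
    z ∈ Zset p r F ↔ z ≠ 0 ∧ z * z ≠ 1 := by
  have h1 : z ^ p ^ r = z := by rw [← per_dvd_iff, hz]; exact hm
  have h2 : z ^ p ^ (2 * r) = z := by rw [← per_dvd_iff, hz]; exact Dvd.dvd.mul_left hm 2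
  constructor
  · rintro ⟨a, -, b⟩
    rw [pow_succ, h1] at b
    exact ⟨a, b⟩
  · rintro ⟨a, b⟩
    refine ⟨a, h2, ?_⟩
    rw [pow_succ, h1]
    exact b

lemma per_zero : per p (0 : F) ∣ 1 := by
  rw [per_dvd_iff]; simp [hp.out.pos.ne']

lemma mem_Z_big (hr : 0 < r) (m : ℕ) (hm : m ∣ r) (hm1 : 1 < m) (z : F) (hz : per p z = m) :
    z ∈ Zset p r F := by
  rw [mem_Z_dvd p r hr m hm z hz]
  constructor
  · rintro rfl
    have := Nat.le_of_dvd one_pos (per_zero (F := F) p)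
    omega
  · intro h
    have : per p z ∣ 1 := by
      rw [per_dvd_iff, pow_one]; exact per_one_of_sq p z h
    have := Nat.le_of_dvd one_pos this
    omega

lemma mem_Z_not (hr : 0 < r) (m : ℕ) (hm : m ∣ 2 * r) (hmr : ¬ m ∣ r) (z : F) (hz : per p z = m) :
    z ∈ Zset p r F ↔ ¬ Jp p z := by
  have hm0 : 0 < m := Nat.pos_of_dvd_of_pos hm (by omega)
  have hm1 : 1 < m := by
    rcases Nat.lt_or_ge 1 m with h | h
    · exact h
    · exfalso; apply hmr
      have : m = 1 := by omega
      rw [this]; exact one_dvd _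
  have h2 : z ^ p ^ (2 * r) = z := by rw [← per_dvd_iff, hz]; exact hm
  have h0 : z ≠ 0 := by
    rintro rfl
    have := Nat.le_of_dvd one_pos (per_zero (F := F) p)
    omega
  have hJ : Jp p z ↔ z ^ (p ^ r + 1) = 1 := by
    constructor
    · rintro ⟨k, hk, hk'⟩
      rw [pow_succ] at hk'
      have e : z ^ p ^ k = z⁻¹ := eq_inv_of_mul_eq_one_left hk'
      have e2 : z ^ p ^ (k + k) = z := by
        rw [pow_add, pow_mul, e, inv_pow, e, inv_inv]
      have hd := (per_dvd_iff p z _).2 e2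
      rw [hz] at hd hk
      obtain ⟨c, hc⟩ := hd
      have hc2 : c = 0 ∨ c = 1 := by
        rcases c with _ | _ | c
        · left; rfl
        · right; rfl
        · exfalso; nlinarith
      rcases hc2 with rfl | rfl
      · exfalso
        have hk0 : k = 0 := by omega
        rw [hk0, pow_zero, pow_one] at hk'
        have : per p z ∣ 1 := by
          rw [per_dvd_iff, pow_one]; exact per_one_of_sq p z hk'
        have := Nat.le_of_dvd one_pos this
        omega
      · obtain ⟨d, hd⟩ := hm
        have hrd : r = k * d := by nlinarith
        rcases Nat.even_or_odd' d with ⟨i, hi | hi⟩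
        · exfalso; apply hmr
          refine ⟨i, ?_⟩
          rw [hrd, hi]; nlinarith
        · have : r = m * i + k := by rw [hrd, hi]; nlinarith
          have h3 : z ^ p ^ (m * i) = z := by
            rw [← per_dvd_iff, hz]; exact dvd_mul_right _ _
          rw [this, pow_succ, pow_add, pow_mul, h3]
          exact hk'
    · intro h
      refine ⟨r % per p z, Nat.mod_lt _ (by omega), ?_⟩
      rw [pow_succ, pow_mod_per, ← pow_succ]
      exact h
  rw [hJ]
  exact ⟨fun h => h.2.2, fun h => ⟨h0, h2, h⟩⟩

open scoped Classical in
include hF in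
lemma orbit_sum (hr : 0 < r) (hN : 2 * r ∣ N) (hN0 : 0 < N) :
    ∑ z ∈ Finset.univ.filter (fun z : F => z ∈ Zset p r F),
      1 / (((Finset.univ.filter (fun z : F => z ∈ Zset p r F)).filter (Rel p z)).card : ℚ) =
    (∑ r' ∈ r.divisors.filter (fun d => 1 < d),
          (((noProperSubfield p r').ncard : ℚ) + ((Kset p r').ncard : ℚ)) / (2 * r') +
        ∑ r' ∈ (2 * r).divisors.filter (fun d => ¬ d ∣ r),
          (((noProperSubfield p r').ncard : ℚ) - ((Kset p r').ncard : ℚ)) / (2 * r') +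
        (if p = 2 then 0 else ((p : ℚ) - 3) / 2)) := by
  set Z := Finset.univ.filter (fun z : F => z ∈ Zset p r F) with hZ
  have hmemZ : ∀ z, z ∈ Z ↔ z ∈ Zset p r F := by intro z; simp [hZ]
  clear_value Z
  have s1 : ∀ z ∈ Z, 1 / ((Z.filter (Rel p z)).card : ℚ) = (1 + if Jp p z then 1 else 0) / (2 * per p z) := by
    intro z hz
    rw [hmemZ] at hz
    have : Z.filter (Rel p z) = Finset.univ.filter (fun w : F => Rel p z w) := by
      ext w
      rw [Finset.mem_filter, Finset.mem_filter, hmemZ]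
      exact ⟨fun h => ⟨Finset.mem_univ _, h.2⟩, fun h => ⟨Rel_mem p r z w hz h.2, h.2⟩⟩
    rw [this, orbit_card p (2 * r) (by omega) z hz.1 hz.2.1]
    have hpos := per_pos p (2 * r) (by omega) z hz.2.1
    have : (per p z : ℚ) ≠ 0 := by positivity
    split_ifs
    · field_simp; norm_num
    · field_simp; norm_num
  rw [Finset.sum_congr rfl s1, ← Finset.sum_fiberwise_of_maps_to (s := Z) (t := (2 * r).divisors) (g := fun z => per p z)
    (fun z hz => by
      rw [Nat.mem_divisors, per_dvd_iff]
      exact ⟨((hmemZ z).1 hz).2.1, by omega⟩)]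
  have hsplit : (2 * r).divisors = insert 1 (r.divisors.filter (fun d => 1 < d) ∪
      (2 * r).divisors.filter (fun d => ¬ d ∣ r)) := by
    ext d
    simp only [Nat.mem_divisors, Finset.mem_insert, Finset.mem_union, Finset.mem_filter]
    constructor
    · rintro ⟨h1, h2⟩
      have : 0 < d := Nat.pos_of_dvd_of_pos h1 (by omega)
      by_cases hd : d ∣ r
      · by_cases hd1 : d = 1
        · exact Or.inl hd1
        · exact Or.inr (Or.inl ⟨⟨hd, by omega⟩, by omega⟩)
      · exact Or.inr (Or.inr ⟨⟨h1, h2⟩, hd⟩)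
    · rintro (rfl | ⟨⟨h1, h2⟩, h3⟩ | ⟨h1, h2⟩)
      · exact ⟨one_dvd _, by omega⟩
      · exact ⟨Dvd.dvd.mul_left h1 2, by omega⟩
      · exact h1
  refine (Finset.sum_congr hsplit (fun _ _ => rfl)).trans ?_
  rw [Finset.sum_insert, Finset.sum_union, add_comm]
  · congr 1
    · congr 1
      · apply Finset.sum_congr rfl
        intro m hm
        rw [Finset.mem_filter, Nat.mem_divisors] at hm
        obtain ⟨⟨hm, -⟩, hm1⟩ := hm
        have hmN : m ∣ N := dvd_trans (Dvd.dvd.mul_left hm 2) hN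
        have hZm : Z.filter (fun z => per p z = m) = Finset.univ.filter (fun z : F => per p z = m) := by
          ext z
          rw [Finset.mem_filter, Finset.mem_filter, hmemZ]
          exact ⟨fun h => ⟨Finset.mem_univ _, h.2⟩, fun h => ⟨mem_Z_big p r hr m hm hm1 z h.2, h.2⟩⟩
        rw [hZm, ncard_F p N hF m (by omega) hmN, ncard_K p N hF m (by omega) hmN]
        have e : ∀ z ∈ Finset.univ.filter (fun z : F => per p z = m),
            (1 + if Jp p z then 1 else 0 : ℚ) / (2 * per p z) = (1 + if Jp p z then 1 else 0) / (2 * m) := by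
          intro z hz
          rw [(Finset.mem_filter.1 hz).2]
        rw [Finset.sum_congr rfl e, ← Finset.sum_div, Finset.sum_add_distrib, Finset.sum_boole,
          Finset.filter_filter]
        congr 2
        · rw [Set.ncard_eq_toFinset_card']
          simp
        · rw [Set.ncard_eq_toFinset_card']
          simp
      · apply Finset.sum_congr rfl
        intro m hm
        rw [Finset.mem_filter, Nat.mem_divisors] at hm
        obtain ⟨⟨hm, -⟩, hmr⟩ := hm
        have hm0 : 0 < m := Nat.pos_of_dvd_of_pos hm (by omega)
        have hmN : m ∣ N := dvd_trans hm hN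
        have hZm : Z.filter (fun z => per p z = m) =
            Finset.univ.filter (fun z : F => per p z = m ∧ ¬ Jp p z) := by
          ext z
          rw [Finset.mem_filter, Finset.mem_filter, hmemZ]
          exact ⟨fun h => ⟨Finset.mem_univ _, h.2, (mem_Z_not p r hr m hm hmr z h.2).1 h.1⟩,
            fun h => ⟨(mem_Z_not p r hr m hm hmr z h.2.1).2 h.2.2, h.2.1⟩⟩
        rw [hZm, ncard_F p N hF m (by omega) hmN, ncard_K p N hF m (by omega) hmN]
        have e : ∀ z ∈ Finset.univ.filter (fun z : F => per p z = m ∧ ¬ Jp p z),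
            (1 + if Jp p z then 1 else 0 : ℚ) / (2 * per p z) = 1 / (2 * m) := by
          intro z hz
          rw [(Finset.mem_filter.1 hz).2.1, if_neg (Finset.mem_filter.1 hz).2.2, add_zero]
        rw [Finset.sum_congr rfl e, Finset.sum_const, nsmul_eq_mul, mul_one_div]
        congr 1
        rw [Set.ncard_eq_toFinset_card', Set.ncard_eq_toFinset_card']
        have := Finset.card_filter_add_card_filter_not (s := Finset.univ.filter (fun z : F => per p z = m)) (fun z => Jp p z)
        rw [Finset.filter_filter, Finset.filter_filter] at this
        rw [eq_sub_iff_add_eq']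
        simp only [Set.toFinset_ofPred]
        exact_mod_cast this
    · rw [← ncard_one p N hF hN0]
      have hZm : Z.filter (fun z => per p z = 1) =
            Finset.univ.filter (fun z : F => z ≠ 0 ∧ z ^ p = z ∧ z * z ≠ 1) := by
        ext z
        rw [Finset.mem_filter, Finset.mem_filter, hmemZ]
        constructor
        · rintro ⟨h1, h2⟩
          have := (mem_Z_dvd p r hr 1 (one_dvd _) z h2).1 h1
          refine ⟨Finset.mem_univ _, this.1, ?_, this.2⟩
          have := (per_dvd_iff p z 1).1 (by rw [h2])
          rwa [pow_one] at this
        · rintro ⟨-, h1, h2, h3⟩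
          have : per p z = 1 := by
            rw [← Nat.dvd_one, per_dvd_iff, pow_one]; exact h2
          exact ⟨(mem_Z_dvd p r hr 1 (one_dvd _) z this).2 ⟨h1, h3⟩, this⟩
      have e : ∀ z ∈ Z.filter (fun z => per p z = 1),
            (1 + if Jp p z then 1 else 0 : ℚ) / (2 * per p z) = 1 / 2 := by
        intro z hz
        have h1 := (Finset.mem_filter.1 hz).2
        rw [hZm] at hz
        have h3 := (Finset.mem_filter.1 hz).2.2.2
        rw [h1, if_neg]
        · norm_num
        · rintro ⟨k, hk, hk'⟩
          have : k = 0 := by omega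
          rw [this, pow_zero, pow_succ, pow_one] at hk'
          exact h3 hk'
      rw [Finset.sum_congr rfl e, Finset.sum_const, nsmul_eq_mul, mul_one_div, hZm]
      congr 2
      rw [Set.ncard_eq_toFinset_card']
      simp
  · rw [Finset.disjoint_left]
    intro d h1 h2
    rw [Finset.mem_filter, Nat.mem_divisors] at h1 h2
    exact h2.2 h1.1.1
  · simp

end ZZ
end LPC


set_option linter.unusedSectionVars false
set_option linter.style.haveILetI false

namespace LPC

section Fin
variable (p r n : ℕ) [Fact p.Prime] [NeZero n] {F : Type*} [Field F] [Fintype F] [CharP F p]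
  (hF : Fintype.card F = (p ^ r) ^ n) (h2 : 2 ∣ n)

include h2 in
lemma norm_exp (hr : 0 < r) : ((p ^ r) ^ n - 1) / (p ^ r - 1) = MM p r n * (p ^ r + 1) := by
  have h1 : 1 < p ^ r := Nat.one_lt_pow hr.ne' (Fact.out : p.Prime).one_lt
  rw [← MM_mul p r n h2 hr]
  have : (p ^ r) ^ 2 - 1 = (p ^ r + 1) * (p ^ r - 1) := by
    have := Nat.sq_sub_sq (p ^ r) 1
    rwa [one_pow] at this
  rw [this, ← mul_assoc, Nat.mul_div_cancel _ (by omega)]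

include hF in
lemma N2_fixed (hr : 0 < r) (x : F) (hx : x ≠ 0) :
    (N2 p r n h2 x) ^ p ^ (2 * r) = N2 p r n h2 x := by
  have h1 : 1 ≤ (p ^ r) ^ 2 := Nat.one_le_pow _ _ (Nat.pow_pos (Fact.out : p.Prime).pos)
  have e : p ^ (2 * r) = ((p ^ r) ^ 2 - 1) + 1 := by
    rw [Nat.sub_add_cancel h1, ← pow_mul, mul_comm]
  rw [e, pow_succ, N2_eq, ← pow_mul, MM_mul p r n h2 hr, ← hF, FiniteField.pow_card_sub_one_eq_one x hx,
    one_mul]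

include hF in
lemma mem_params (hr : 0 < r) (s : ℕ) (x : F) :
    (s, x) ∈ LPparams (p ^ r) n F ↔
      (1 ≤ s ∧ 2 * s < n ∧ Nat.gcd s n = 1) ∧ x ≠ 0 ∧ N2 p r n h2 x ∈ Zset p r F := by
  have key : x ≠ 0 → (x ^ (((p ^ r) ^ n - 1) / (p ^ r - 1)) ≠ 1 ↔ N2 p r n h2 x ∈ Zset p r F) := by
    intro hx
    rw [norm_exp p r n h2 hr, pow_mul, ← N2_eq p r n h2]
    exact ⟨fun h => ⟨N2_ne_zero p r n h2 x hx, N2_fixed p r n hF h2 hr x hx, h⟩, fun h => h.2.2⟩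
  constructor
  · rintro ⟨a, b, c, d, e⟩
    exact ⟨⟨a, b, c⟩, d, (key d).1 e⟩
  · rintro ⟨⟨a, b, c⟩, d, e⟩
    exact ⟨a, b, c, d, (key d).2 e⟩

open scoped Classical in
include hF h2 in
theorem main_count (hr : 0 < r) (hq : p ^ r ≠ 2) (hn : 4 ≤ n) :
    Set.ncard {C : Set (ℕ × F) | ∃ a ∈ LPparams (p ^ r) n F,
        C = {b ∈ LPparams (p ^ r) n F |
          PGammaLEquiv F (fun x => x ^ (p ^ r) ^ a.1 + a.2 * x ^ (p ^ r) ^ (n - a.1))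
            (fun x => x ^ (p ^ r) ^ b.1 + b.2 * x ^ (p ^ r) ^ (n - b.1))}} =
    {s | 1 ≤ s ∧ 2 * s < n ∧ Nat.gcd s n = 1}.ncard *
      ((Finset.univ.filter (fun z : F => z ∈ Zset p r F)).image (fun z =>
        (Finset.univ.filter (fun z : F => z ∈ Zset p r F)).filter (Rel p z))).card := by
  set Z := Finset.univ.filter (fun z : F => z ∈ Zset p r F) with hZ
  have hmemZ : ∀ z, z ∈ Z ↔ z ∈ Zset p r F := by intro z; simp [hZ]
  clear_value Z
  set Orb := Z.image (fun z => Z.filter (Rel p z)) with hOrb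
  set S : Set ℕ := {s | 1 ≤ s ∧ 2 * s < n ∧ Nat.gcd s n = 1} with hS
  let Ψ : ℕ × Finset F → Set (ℕ × F) := fun a =>
    {b | b ∈ LPparams (p ^ r) n F ∧ b.1 = a.1 ∧ N2 p r n h2 b.2 ∈ a.2}
  have hcls : ∀ s x, (s, x) ∈ LPparams (p ^ r) n F →
      {b ∈ LPparams (p ^ r) n F |
          PGammaLEquiv F (fun y => y ^ (p ^ r) ^ s + x * y ^ (p ^ r) ^ (n - s))
            (fun y => y ^ (p ^ r) ^ b.1 + b.2 * y ^ (p ^ r) ^ (n - b.1))} =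
        Ψ (s, Z.filter (Rel p (N2 p r n h2 x))) := by
    intro s x hsx
    ext ⟨t, y⟩
    constructor
    · rintro ⟨h, h'⟩
      obtain ⟨e1, e2⟩ := fwd p r n hF h2 hr hq hn s t x y hsx h h'
      refine ⟨h, e1.symm, ?_⟩
      rw [Finset.mem_filter, hmemZ]
      exact ⟨((mem_params p r n hF h2 hr t y).1 h).2.2, e2⟩
    · rintro ⟨h, h', h''⟩
      rw [Finset.mem_filter] at h''
      simp only at h'
      subst h'
      exact ⟨h, bwd p r n hF h2 hr t x y hsx h h''.2⟩
  have himg : {C : Set (ℕ × F) | ∃ a ∈ LPparams (p ^ r) n F,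
        C = {b ∈ LPparams (p ^ r) n F |
          PGammaLEquiv F (fun x => x ^ (p ^ r) ^ a.1 + a.2 * x ^ (p ^ r) ^ (n - a.1))
            (fun x => x ^ (p ^ r) ^ b.1 + b.2 * x ^ (p ^ r) ^ (n - b.1))}} =
      Ψ '' (S ×ˢ (Orb : Set (Finset F))) := by
    ext C
    constructor
    · rintro ⟨⟨s, x⟩, h, rfl⟩
      have hm := (mem_params p r n hF h2 hr s x).1 h
      refine ⟨(s, Z.filter (Rel p (N2 p r n h2 x))), ⟨hm.1, ?_⟩, (hcls s x h).symm⟩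
      exact Finset.mem_coe.2 (Finset.mem_image_of_mem _ ((hmemZ _).2 hm.2.2))
    · rintro ⟨⟨s, O⟩, ⟨hs, hO⟩, rfl⟩
      obtain ⟨z, hz, rfl⟩ := Finset.mem_image.1 (Finset.mem_coe.1 hO)
      have hz' := (hmemZ z).1 hz
      obtain ⟨x, hx0, hx⟩ := N2_surj p r n hF h2 hr z hz'.1 (by
        rw [← pow_mul p, mul_comm r 2]; exact hz'.2.1)
      have hsx : (s, x) ∈ LPparams (p ^ r) n F :=
        (mem_params p r n hF h2 hr s x).2 ⟨hs, hx0, by rw [hx]; exact hz'⟩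
      refine ⟨(s, x), hsx, ?_⟩
      rw [hcls s x hsx, hx]
  have hsub : ∀ s t : ℕ, ∀ O O' : Finset F, s ∈ S → O ∈ Orb → Ψ (s, O) = Ψ (t, O') →
      s = t ∧ O ⊆ O' := by
    intro s t O O' hs hO h
    obtain ⟨z, hz, rfl⟩ := Finset.mem_image.1 hO
    have key : ∀ w ∈ Z.filter (Rel p z), s = t ∧ w ∈ O' := by
      intro w hw
      have hw' := (hmemZ w).1 (Finset.mem_filter.1 hw).1
      obtain ⟨x, hx0, hx⟩ := N2_surj p r n hF h2 hr w hw'.1 (by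
        rw [← pow_mul p, mul_comm r 2]; exact hw'.2.1)
      have hsx : (s, x) ∈ LPparams (p ^ r) n F :=
        (mem_params p r n hF h2 hr s x).2 ⟨hs, hx0, by rw [hx]; exact hw'⟩
      have : (s, x) ∈ Ψ (s, Z.filter (Rel p z)) := ⟨hsx, rfl, by rw [hx]; exact hw⟩
      rw [h] at this
      obtain ⟨-, a, b⟩ := this
      rw [hx] at b
      exact ⟨a, b⟩
    exact ⟨(key z (Finset.mem_filter.2 ⟨hz, Rel_refl p z⟩)).1, fun w hw => (key w hw).2⟩
  have hinj : Set.InjOn Ψ (S ×ˢ (Orb : Set (Finset F))) := by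
    rintro ⟨s, O⟩ ⟨hs, hO⟩ ⟨t, O'⟩ ⟨ht, hO'⟩ h
    obtain ⟨a, b⟩ := hsub s t O O' hs (Finset.mem_coe.1 hO) h
    obtain ⟨-, c⟩ := hsub t s O' O ht (Finset.mem_coe.1 hO') h.symm
    rw [a, Finset.Subset.antisymm b c]
  rw [himg, Set.ncard_image_of_injOn hinj, Set.ncard_prod, Set.ncard_coe_finset]

end Fin
end LPC

/-- **The number of inequivalent Lunardon–Polverino linear sets, `n` even
(Theorem 4.2, even case).** -/
theorem LP_count_even (p r q n : ℕ) [Fact p.Prime] (hr : 0 < r) (hq : q = p ^ r)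
    (hq2 : q ≠ 2) (hn : 3 ≤ n) (heven : Even n)
    (F : Type*) [Field F] [Fintype F] (hF : Fintype.card F = q ^ n) :
    ((Set.ncard {C : Set (ℕ × F) | ∃ a ∈ LPparams q n F,
        C = {b ∈ LPparams q n F |
          PGammaLEquiv F (fun x => x ^ q ^ a.1 + a.2 * x ^ q ^ (n - a.1))
            (fun x => x ^ q ^ b.1 + b.2 * x ^ q ^ (n - b.1))}} : ℚ)) =
      (∑ r' ∈ r.divisors.filter (fun d => 1 < d),
          (((noProperSubfield p r').ncard : ℚ) + ((Kset p r').ncard : ℚ)) / (2 * r') +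
        ∑ r' ∈ (2 * r).divisors.filter (fun d => ¬ d ∣ r),
          (((noProperSubfield p r').ncard : ℚ) - ((Kset p r').ncard : ℚ)) / (2 * r') +
        (if p = 2 then 0 else ((p : ℚ) - 3) / 2)) * (Nat.totient n) / 2 := by
  classical
  subst hq
  have h2 : 2 ∣ n := heven.two_dvd
  have hn4 : 4 ≤ n := by omega
  have : NeZero n := ⟨by omega⟩
  have hF' : Fintype.card F = p ^ (r * n) := by rw [hF, pow_mul]
  have : CharP F p := charP_of_card_eq_prime_pow (f := r * n) hF'
  have hos := LPC.orbit_sum p r (r * n) (F := F) hF' hr (by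
    rw [mul_comm 2 r]; exact Nat.mul_dvd_mul_left r h2) (Nat.mul_pos hr (by omega))
  have hcc := LPC.class_count (Finset.univ.filter (fun z : F => z ∈ LPC.Zset p r F)) (LPC.Rel p)
    (fun z _ => LPC.Rel_refl p z)
    (fun z hz w _ h => LPC.Rel_symm p r hr z w (Finset.mem_filter.1 hz).2 h)
    (fun x _ y _ z _ h h' => LPC.Rel_trans p x y z h h')
  have hmain := LPC.main_count p r n hF h2 hr hq2 hn4
  rw [hmain, Nat.cast_mul, LPC.totient_half n hn]
  have hfin := hcc.trans hos
  rw [← hfin]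
  ring_nf
  try (congr!)
end

section
/- Let p be a prime and r > 1 an integer, and let σ(m) = Σ_{d | m} d. Set T = Σ_{r' | r, r' > 1} (|F(r')| + |K(r')|)/(2r') + Σ_{r' | 2r, r' ∤ r} (|F(r')| − |K(r')|)/(2r'), a rational number (which equals Λ(n,q)/(φ(n)/2) − ε for even n). Then: (upper bounds) if r is odd, T < (p^{2r}/(4r))·(1 + (σ(2r) − 2r − 1)/p^r); if r = 2^{s₁} is a power of 2, T < (p^{2r}/(4r))·(1 + (σ(2r) − 2r − 1)/p^r) + Σ_{i=1}^{s₁} p^{2^{i−1}}; if r is even and not a power of 2, T < (p^{2r}/(4r))·(1 + (σ(2r) − 2r − 1)/p^r + 2/p^{3r/2} + 2(σ(r) − r − 1)/p^{7r/4}); (lower bounds) if r = 2^{s₁} is a power of 2, T > (p^{2r} − p)/(4r) − Σ_{i=1}^{s₁+1} p^{2^{i−1}}; otherwise, T > (p^{2r}/(4r))·(1 − 1/p^r − (σ(2r) − 2r − 1)/p^{3r/2} − 1/p^{2r−1}). -/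
/-- The quantity
`T = Σ_{r' ∣ r, r' > 1} (|F(r')| + |K(r')|)/(2r')
   + Σ_{r' ∣ 2r, r' ∤ r} (|F(r')| − |K(r')|)/(2r')`. -/
noncomputable def Tsum (p r : ℕ) [Fact p.Prime] : ℝ :=
  ∑ r' ∈ r.divisors.filter (fun d => 1 < d),
    (((noProperSubfield p r').ncard : ℝ) + ((Kset p r').ncard : ℝ)) / (2 * r') +
  ∑ r' ∈ (2 * r).divisors.filter (fun d => ¬ d ∣ r),
    (((noProperSubfield p r').ncard : ℝ) - ((Kset p r').ncard : ℝ)) / (2 * r')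

section helpers
open Finset

lemma gf_pow_card (p m : ℕ) [Fact p.Prime] (hm : m ≠ 0) (x : GaloisField p m) :
    x ^ p ^ m = x := by
  have : Fintype (GaloisField p m) := Fintype.ofFinite _
  have h := GaloisField.card p m hm
  rw [Nat.card_eq_fintype_card] at h
  rw [← h]; exact FiniteField.pow_card x

lemma Fcard_lt (p m : ℕ) [Fact p.Prime] (hm : 1 < m) :
    (noProperSubfield p m).ncard < p ^ m := by
  rw [← GaloisField.card p m (by omega), ← Set.ncard_univ]
  refine Set.ncard_lt_ncard ?_ (Set.toFinite _)
  rw [Set.ssubset_univ_iff]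
  intro h
  have h0 : (0 : GaloisField p m) ∈ noProperSubfield p m := h ▸ Set.mem_univ _
  refine h0 1 (one_dvd _) hm ?_
  have := (Fact.out : p.Prime).ne_zero
  simp [this]

lemma gf_gcd (p m a b : ℕ) [Fact p.Prime] (x : GaloisField p m)
    (ha : x ^ p ^ a = x) (hb : x ^ p ^ b = x) : x ^ p ^ (a.gcd b) = x := by
  have h1 : Function.IsPeriodicPt (frobenius (GaloisField p m) p) a x := by
    rw [Function.IsPeriodicPt, Function.IsFixedPt, iterate_frobenius, ha]
  have h2 : Function.IsPeriodicPt (frobenius (GaloisField p m) p) b x := by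
    rw [Function.IsPeriodicPt, Function.IsFixedPt, iterate_frobenius, hb]
  have h3 := h1.gcd h2
  rwa [Function.IsPeriodicPt, Function.IsFixedPt, iterate_frobenius] at h3

lemma Kset_mem (p m : ℕ) [Fact p.Prime] (hm : 1 < m) (x : GaloisField p m)
    (hx : x ∈ Kset p m) : ∃ h, m = 2 * h ∧ x ^ (p ^ h + 1) = 1 := by
  obtain ⟨hF, k, hk, hxk⟩ := hx
  have hp := (Fact.out : p.Prime)
  have h1 : x ^ p ^ (2 * k) = x := by
    have e1 : x ^ p ^ k * x = 1 := by rw [← pow_succ]; exact hxk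
    have hx0 : x ≠ 0 := by rintro rfl; simp at e1
    have e2 : x ^ p ^ k = x⁻¹ := eq_inv_of_mul_eq_one_left e1
    rw [two_mul, pow_add, pow_mul, e2, inv_pow, e2, inv_inv]
  have h2 := gf_gcd p m (2 * k) m x h1 (gf_pow_card p m (by omega) x)
  have h3 : (2 * k).gcd m = m := by
    by_contra hne
    exact hF _ (Nat.gcd_dvd_right _ _)
      (lt_of_le_of_ne (Nat.le_of_dvd (by omega) (Nat.gcd_dvd_right _ _)) hne) h2
  have h4 : m ∣ 2 * k := h3 ▸ Nat.gcd_dvd_left _ _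
  obtain ⟨c, hc⟩ := h4
  have hc2 : c < 2 := by
    by_contra hcc
    push Not at hcc
    have : m * 2 ≤ m * c := Nat.mul_le_mul_left _ hcc
    omega
  interval_cases c
  · exfalso
    have hk0 : k = 0 := by omega
    subst hk0
    have hx2 : x ^ 2 = 1 := by simpa using hxk
    refine hF 1 (one_dvd _) hm ?_
    rw [pow_one]
    rcases hp.eq_two_or_odd' with h | ⟨j, hj⟩
    · subst h
      have : (x - 1) ^ 2 = 0 := by
        rw [sub_pow_char, hx2]; simp
      have h5 : x = 1 := by
        have := pow_eq_zero_iff (two_ne_zero) |>.1 this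
        exact sub_eq_zero.1 this
      rw [h5, one_pow]
    · have h6 : x ^ p = x ^ (2 * j + 1) := by rw [← hj]
      rw [h6, pow_succ, pow_mul, hx2, one_pow, one_mul]
  · exact ⟨k, by omega, hxk⟩

lemma Kcard_le (p h : ℕ) [Fact p.Prime] (hh : 1 < 2 * h) :
    (Kset p (2 * h)).ncard ≤ p ^ h := by
  classical
  have hsub : Kset p (2 * h) ⊆
      ((Polynomial.nthRootsFinset (p ^ h + 1) (1 : GaloisField p (2 * h))).erase 1 :
        Finset (GaloisField p (2 * h))) := by
    intro x hx
    obtain ⟨h', e, hx1⟩ := Kset_mem p _ hh x hx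
    have : h' = h := by omega
    subst this
    rw [Finset.mem_coe, Finset.mem_erase, Polynomial.mem_nthRootsFinset (by omega)]
    refine ⟨?_, hx1⟩
    rintro rfl
    exact hx.1 1 (one_dvd _) hh (by simp)
  have h1 := Set.ncard_le_ncard hsub (Finset.finite_toSet _)
  rw [Set.ncard_coe_finset, Finset.card_erase_of_mem
    (by rw [Polynomial.mem_nthRootsFinset (by omega)]; simp)] at h1
  have h2 : (Polynomial.nthRootsFinset (p ^ h + 1) (1 : GaloisField p (2 * h))).card
      ≤ p ^ h + 1 := by
    rw [Polynomial.nthRootsFinset_def]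
    exact (Multiset.toFinset_card_le _).trans (Polynomial.card_nthRoots _ _)
  omega

lemma Kcard_odd (p m : ℕ) [Fact p.Prime] (hm : 1 < m) (ho : Odd m) :
    (Kset p m).ncard = 0 := by
  have : Kset p m = ∅ := by
    ext x
    simp only [Set.mem_empty_iff_false, iff_false]
    intro hx
    obtain ⟨h, e, -⟩ := Kset_mem p m hm x hx
    obtain ⟨j, hj⟩ := ho
    omega
  rw [this, Set.ncard_empty]

/-- real form of the bound for `K`, with any exponent at least `m / 2`. -/
lemma Kcard_le_rpow (p m : ℕ) [Fact p.Prime] (hm : 1 < m) (t : ℝ) (ht : (m : ℝ) ≤ 2 * t) :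
    ((Kset p m).ncard : ℝ) ≤ (p : ℝ) ^ t := by
  have hp : (1 : ℝ) ≤ p := by exact_mod_cast (Fact.out : p.Prime).one_lt.le
  rcases Nat.even_or_odd' m with ⟨h, rfl | ho⟩
  · have h1 : ((Kset p (2 * h)).ncard : ℝ) ≤ (p : ℝ) ^ h := by exact_mod_cast Kcard_le p h hm
    refine h1.trans ?_
    rw [← Real.rpow_natCast]
    refine Real.rpow_le_rpow_of_exponent_le hp ?_
    push_cast at ht; linarith
  · rw [Kcard_odd p m hm ⟨h, ho⟩]
    simp only [Nat.cast_zero]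
    positivity

lemma gf_lift (p d n : ℕ) [Fact p.Prime] (hd : d ∣ n) (hn : n ≠ 0) :
    ∃ f : GaloisField p d →+* GaloisField p n,
      ∀ x : GaloisField p n, x ^ p ^ d = x → ∃ y, f y = x := by
  classical
  have hd0 : d ≠ 0 := fun h => hn (by rw [h] at hd; exact Nat.eq_zero_of_zero_dvd hd)
  have hp := (Fact.out : p.Prime)
  obtain ⟨f⟩ := FiniteField.nonempty_algHom_of_finrank_dvd (F := ZMod p)
    (K := GaloisField p d) (L := GaloisField p n)
    (by rw [GaloisField.finrank p hd0, GaloisField.finrank p hn]; exact hd)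
  refine ⟨f.toRingHom, fun x hx => ?_⟩
  have : Fintype (GaloisField p d) := Fintype.ofFinite _
  have hne := FiniteField.X_pow_card_pow_sub_X_ne_zero (GaloisField p n) hd0 hp.one_lt
  have hdeg := FiniteField.X_pow_card_pow_sub_X_natDegree_eq (GaloisField p n) hd0 hp.one_lt
  set P : Polynomial (GaloisField p n) := Polynomial.X ^ p ^ d - Polynomial.X with hP
  have hmem : ∀ z : GaloisField p n, z ^ p ^ d = z → z ∈ P.roots.toFinset := by
    intro z hz
    rw [Multiset.mem_toFinset, Polynomial.mem_roots hne]
    simp [hP, hz]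
  have hsub : (Finset.univ : Finset (GaloisField p d)).image f ⊆ P.roots.toFinset := by
    intro z hz
    obtain ⟨y, -, rfl⟩ := Finset.mem_image.1 hz
    apply hmem
    rw [← map_pow, gf_pow_card p d hd0]
  have hcard : P.roots.toFinset.card ≤ ((Finset.univ : Finset (GaloisField p d)).image f).card := by
    rw [Finset.card_image_of_injective _ (show Function.Injective f from f.toRingHom.injective), Finset.card_univ,
      ← Nat.card_eq_fintype_card, GaloisField.card p d hd0]
    exact (Multiset.toFinset_card_le _).trans ((Polynomial.card_roots' _).trans hdeg.le)
  have heq := Finset.eq_of_subset_of_card_le hsub hcard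
  have hx' := hmem x hx
  rw [← heq] at hx'
  obtain ⟨y, -, hy⟩ := Finset.mem_image.1 hx'
  exact ⟨y, hy⟩

lemma Fsum_ge (p n : ℕ) [Fact p.Prime] (hn : n ≠ 0) :
    p ^ n ≤ ∑ d ∈ n.divisors, (noProperSubfield p d).ncard := by
  classical
  have hl : ∀ d : ℕ, ∃ S : Set (GaloisField p n),
      d ∈ n.divisors → (S.ncard ≤ (noProperSubfield p d).ncard ∧
      ∀ x : GaloisField p n, x ^ p ^ d = x → (∀ e, e ∣ d → e < d → x ^ p ^ e ≠ x) → x ∈ S) := by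
    intro d
    by_cases hd : d ∈ n.divisors
    · obtain ⟨f, hf⟩ := gf_lift p d n (Nat.dvd_of_mem_divisors hd) hn
      refine ⟨f '' noProperSubfield p d, fun _ => ⟨Set.ncard_image_le (Set.toFinite _), ?_⟩⟩
      intro x hx hmin
      obtain ⟨y, rfl⟩ := hf x hx
      refine ⟨y, ?_, rfl⟩
      intro e he hlt hy
      exact hmin e he hlt (by rw [← map_pow, hy])
    · exact ⟨∅, fun h => absurd h hd⟩
  choose S hS using hl
  have hcov : (Set.univ : Set (GaloisField p n)) ⊆ ⋃ d ∈ n.divisors, S d := by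
    intro x _
    have hex : ∃ d, d ∣ n ∧ x ^ p ^ d = x := ⟨n, dvd_rfl, gf_pow_card p n hn x⟩
    have hsp := Nat.find_spec hex
    have hd : Nat.find hex ∈ n.divisors := Nat.mem_divisors.2 ⟨hsp.1, hn⟩
    refine Set.mem_biUnion (show Nat.find hex ∈ n.divisors from hd) ?_
    refine (hS _ hd).2 x hsp.2 ?_
    intro e he hlt hxe
    exact Nat.find_min hex hlt ⟨he.trans hsp.1, hxe⟩
  rw [← GaloisField.card p n hn, ← Set.ncard_univ]
  refine (Set.ncard_le_ncard hcov (Set.toFinite _)).trans ?_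
  refine (Finset.set_ncard_biUnion_le _ _).trans ?_
  exact Finset.sum_le_sum fun d hd => (hS d hd).1

/-- nontrivial divisors -/
def ntd (n : ℕ) : Finset ℕ := (n.divisors.filter (fun d => 1 < d)).erase n

lemma mem_ntd {n d : ℕ} (hn : 1 < n) : d ∈ ntd n ↔ d ∣ n ∧ 1 < d ∧ d ≠ n := by
  simp only [ntd, Finset.mem_erase, Finset.mem_filter, Nat.mem_divisors]
  constructor
  · rintro ⟨a, ⟨b, _⟩, c⟩; exact ⟨b, c, a⟩
  · rintro ⟨b, c, a⟩; exact ⟨a, ⟨b, by omega⟩, c⟩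

lemma ntd_le_half {n d : ℕ} (hn : 1 < n) (hd : d ∈ ntd n) : 2 * d ≤ n := by
  obtain ⟨⟨c, hc⟩, h2, h3⟩ := (mem_ntd hn).1 hd
  have : 2 ≤ c := by
    by_contra hcc
    have : c = 0 ∨ c = 1 := by omega
    rcases this with rfl | rfl <;> omega
  have : d * 2 ≤ d * c := Nat.mul_le_mul_left _ this
  omega

lemma sum_split (n : ℕ) (hn : 1 < n) (f : ℕ → ℝ) :
    ∑ d ∈ n.divisors.filter (fun d => 1 < d), f d = f n + ∑ d ∈ ntd n, f d := by
  rw [ntd, Finset.add_sum_erase]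
  simp [hn]; omega

lemma sum_divisors_split (n : ℕ) (hn : 1 < n) (f : ℕ → ℝ) :
    ∑ d ∈ n.divisors, f d = f 1 + ∑ d ∈ n.divisors.filter (fun d => 1 < d), f d := by
  have : n.divisors.filter (fun d => 1 < d) = n.divisors.erase 1 := by
    ext d
    simp only [Finset.mem_erase, Finset.mem_filter, Nat.mem_divisors]
    constructor
    · rintro ⟨a, b⟩; exact ⟨by omega, a⟩
    · rintro ⟨a, b⟩
      have := Nat.pos_of_dvd_of_pos b.1 (by omega)
      exact ⟨b, by omega⟩
  rw [this, Finset.add_sum_erase]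
  simp; omega

lemma recip_sum (n : ℕ) (hn : 1 < n) :
    ∑ d ∈ ntd n, 1 / (d : ℝ) = ((∑ d ∈ n.divisors, (d : ℝ)) - n - 1) / n := by
  have hn0 : (n : ℝ) ≠ 0 := by positivity
  have h1 : ∑ d ∈ n.divisors, (d : ℝ) = ∑ d ∈ n.divisors, (n : ℝ) * (1 / (d : ℝ)) := by
    rw [← Nat.sum_div_divisors n (fun d => (d : ℝ))]
    refine Finset.sum_congr rfl fun d hd => ?_
    have hd' := Nat.dvd_of_mem_divisors hd
    have : (d : ℝ) ≠ 0 := by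
      have := Nat.pos_of_mem_divisors hd
      positivity
    rw [Nat.cast_div hd' this]; ring
  rw [← Finset.mul_sum, sum_divisors_split n hn (fun d => 1 / (d : ℝ)), sum_split n hn] at h1
  rw [h1]
  field_simp
  push_cast
  ring

lemma Tsum_eq (p r : ℕ) [Fact p.Prime] (hr : 1 < r) :
    Tsum p r = ∑ d ∈ (2 * r).divisors.filter (fun d => 1 < d),
        ((noProperSubfield p d).ncard : ℝ) / (2 * d) +
      ∑ d ∈ r.divisors.filter (fun d => 1 < d), ((Kset p d).ncard : ℝ) / (2 * d) -
      ∑ d ∈ (2 * r).divisors.filter (fun d => ¬ d ∣ r), ((Kset p d).ncard : ℝ) / (2 * d) := by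
  have hu : (2 * r).divisors.filter (fun d => 1 < d) =
      r.divisors.filter (fun d => 1 < d) ∪ (2 * r).divisors.filter (fun d => ¬ d ∣ r) := by
    ext d
    simp only [Finset.mem_union, Finset.mem_filter, Nat.mem_divisors]
    constructor
    · rintro ⟨⟨a, b⟩, c⟩
      by_cases hd : d ∣ r
      · exact Or.inl ⟨⟨hd, by omega⟩, c⟩
      · exact Or.inr ⟨⟨a, b⟩, hd⟩
    · rintro (⟨⟨a, b⟩, c⟩ | ⟨⟨a, b⟩, c⟩)
      · exact ⟨⟨a.mul_left _, by omega⟩, c⟩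
      · refine ⟨⟨a, b⟩, ?_⟩
        have h0 := Nat.pos_of_dvd_of_pos a (by omega)
        have : d ≠ 1 := by rintro rfl; exact c (one_dvd _)
        omega
  have hdis : Disjoint (r.divisors.filter (fun d => 1 < d))
      ((2 * r).divisors.filter (fun d => ¬ d ∣ r)) := by
    rw [Finset.disjoint_left]
    intro d h1 h2
    simp only [Finset.mem_filter, Nat.mem_divisors] at h1 h2
    exact h2.2 h1.1.1
  rw [hu, Finset.sum_union hdis, Tsum]
  simp only [add_div, sub_div, Finset.sum_add_distrib, Finset.sum_sub_distrib]
  ring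

lemma A_upper (p r : ℕ) [Fact p.Prime] (hr : 1 < r) :
    ∑ d ∈ (2 * r).divisors.filter (fun d => 1 < d),
        ((noProperSubfield p d).ncard : ℝ) / (2 * d) <
      ((p : ℝ) ^ (2 * r) / (4 * r)) *
        (1 + ((∑ d ∈ (2 * r).divisors, (d : ℝ)) - 2 * r - 1) / (p : ℝ) ^ r) := by
  have hp : (1 : ℝ) ≤ p := by exact_mod_cast (Fact.out : p.Prime).one_lt.le
  have hr0 : (0 : ℝ) < r := by positivity
  rw [sum_split _ (by omega)]
  have h1 : ((noProperSubfield p (2 * r)).ncard : ℝ) / (2 * (2 * r : ℕ)) <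
      (p : ℝ) ^ (2 * r) / (4 * r) := by
    have := Fcard_lt p (2 * r) (by omega)
    have h : ((noProperSubfield p (2 * r)).ncard : ℝ) < (p : ℝ) ^ (2 * r) := by exact_mod_cast this
    push_cast
    rw [show (2 * (2 * r) : ℝ) = 4 * r by ring]
    gcongr
  have h2 : ∑ d ∈ ntd (2 * r), ((noProperSubfield p d).ncard : ℝ) / (2 * d) ≤
      ∑ d ∈ ntd (2 * r), ((p : ℝ) ^ r / 2) * (1 / (d : ℝ)) := by
    refine Finset.sum_le_sum fun d hd => ?_
    have hd2 := ntd_le_half (by omega) hd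
    obtain ⟨-, hd1, -⟩ := (mem_ntd (by omega)).1 hd
    have h : ((noProperSubfield p d).ncard : ℝ) ≤ (p : ℝ) ^ d := by
      exact_mod_cast (Fcard_lt p d hd1).le
    have h' : (p : ℝ) ^ d ≤ (p : ℝ) ^ r := pow_le_pow_right₀ hp (by omega)
    have : ((p : ℝ) ^ r / 2) * (1 / (d : ℝ)) = (p : ℝ) ^ r / (2 * d) := by
      field_simp
    rw [this]
    gcongr
    exact h.trans h'
  rw [← Finset.mul_sum, recip_sum _ (by omega)] at h2
  refine (add_lt_add_of_lt_of_le h1 h2).trans_le (le_of_eq ?_)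
  rw [two_mul r, pow_add]
  push_cast
  field_simp
  ring

lemma A_lower (p r : ℕ) [Fact p.Prime] (hr : 1 < r) :
    ((p : ℝ) ^ (2 * r) - p) / (4 * r) ≤ ∑ d ∈ (2 * r).divisors.filter (fun d => 1 < d),
        ((noProperSubfield p d).ncard : ℝ) / (2 * d) := by
  have hr0 : (0 : ℝ) < r := by positivity
  have h1 : ((p : ℝ) ^ (2 * r)) ≤
      ∑ d ∈ (2 * r).divisors, ((noProperSubfield p d).ncard : ℝ) := by
    exact_mod_cast Fsum_ge p (2 * r) (by omega)
  rw [sum_divisors_split _ (by omega)] at h1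
  have h2 : ((noProperSubfield p 1).ncard : ℝ) ≤ p := by
    have : (noProperSubfield p 1).ncard ≤ p ^ 1 := by
      rw [← GaloisField.card p 1 (by omega), ← Set.ncard_univ]
      exact Set.ncard_le_ncard (Set.subset_univ _) (Set.toFinite _)
    rw [pow_one] at this
    exact_mod_cast this
  have h3 : (p : ℝ) ^ (2 * r) - p ≤ ∑ d ∈ (2 * r).divisors.filter (fun d => 1 < d),
      ((noProperSubfield p d).ncard : ℝ) := by linarith
  refine (div_le_div_of_nonneg_right h3 (by positivity)).trans ?_
  rw [Finset.sum_div]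
  refine Finset.sum_le_sum fun d hd => ?_
  simp only [Finset.mem_filter, Nat.mem_divisors] at hd
  have hle : (d : ℝ) ≤ 2 * r := by exact_mod_cast Nat.le_of_dvd (by omega) hd.1.1
  have hd0 : (0 : ℝ) < d := by have := hd.2; positivity
  refine div_le_div_of_nonneg_left (by positivity) (by positivity) (by linarith)

lemma two_mul_term (x d : ℝ) : x / (2 * d) = (x / 2) * (1 / d) := by
  rw [div_mul_div_comm, mul_one]

/-- the `K`-sum over nontrivial divisors -/
lemma K_ntd (p n : ℕ) [Fact p.Prime] (hn : 1 < n) :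
    ∑ d ∈ ntd n, ((Kset p d).ncard : ℝ) / (2 * d) ≤
      (p : ℝ) ^ ((n : ℝ) / 4) / 2 * (((∑ d ∈ n.divisors, (d : ℝ)) - n - 1) / n) := by
  rw [← recip_sum n hn, Finset.mul_sum]
  refine Finset.sum_le_sum fun d hd => ?_
  have hd2 : 2 * (d : ℝ) ≤ n := by exact_mod_cast ntd_le_half hn hd
  obtain ⟨-, hd1, -⟩ := (mem_ntd hn).1 hd
  rw [two_mul_term]
  have := Kcard_le_rpow p d hd1 ((n : ℝ) / 4) (by linarith)
  gcongr

lemma B_upper (p r : ℕ) [Fact p.Prime] (hr : 1 < r) :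
    ∑ d ∈ r.divisors.filter (fun d => 1 < d), ((Kset p d).ncard : ℝ) / (2 * d) ≤
      ((p : ℝ) ^ (2 * r) / (4 * r)) * (2 / (p : ℝ) ^ (3 * (r : ℝ) / 2) +
          2 * ((∑ d ∈ r.divisors, (d : ℝ)) - r - 1) / (p : ℝ) ^ (7 * (r : ℝ) / 4)) := by
  have hp : (0 : ℝ) < p := by exact_mod_cast (Fact.out : p.Prime).pos
  have hr0 : (0 : ℝ) < r := by positivity
  rw [sum_split _ hr]
  have h1 := Kcard_le_rpow p r hr ((r : ℝ) / 2) (by linarith)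
  have h2 := K_ntd p r hr
  have h1' : ((Kset p r).ncard : ℝ) / (2 * r) ≤ (p : ℝ) ^ ((r : ℝ) / 2) / (2 * r) := by gcongr
  refine (add_le_add h1' h2).trans (le_of_eq ?_)
  have e1 : (p : ℝ) ^ (2 * r) = (p : ℝ) ^ ((r : ℝ) / 2) * (p : ℝ) ^ (3 * (r : ℝ) / 2) := by
    rw [← Real.rpow_add hp, ← Real.rpow_natCast]; congr 1; push_cast; ring
  have e2 : (p : ℝ) ^ (2 * r) = (p : ℝ) ^ ((r : ℝ) / 4) * (p : ℝ) ^ (7 * (r : ℝ) / 4) := by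
    rw [← Real.rpow_add hp, ← Real.rpow_natCast]; congr 1; push_cast; ring
  have q1 : (0 : ℝ) < (p : ℝ) ^ (3 * (r : ℝ) / 2) := by positivity
  have q2 : (0 : ℝ) < (p : ℝ) ^ (7 * (r : ℝ) / 4) := by positivity
  rw [mul_add]
  congr 1
  · rw [e1]; field_simp; ring
  · rw [e2]; field_simp; ring

lemma B_pow_two (p s : ℕ) [Fact p.Prime] :
    ∑ d ∈ (2 ^ s).divisors.filter (fun d => 1 < d), ((Kset p d).ncard : ℝ) / (2 * d) ≤
      ∑ i ∈ Finset.Icc 1 s, (p : ℝ) ^ 2 ^ (i - 1) := by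
  have hset : (2 ^ s).divisors.filter (fun d => 1 < d) =
      (Finset.Icc 1 s).image (fun i => 2 ^ i) := by
    ext d
    simp only [Finset.mem_filter, Finset.mem_image, Finset.mem_Icc,
      Nat.mem_divisors_prime_pow Nat.prime_two]
    constructor
    · rintro ⟨⟨j, hj, rfl⟩, h⟩
      refine ⟨j, ⟨?_, hj⟩, rfl⟩
      by_contra hc
      have : j = 0 := by omega
      subst this; simp at h
    · rintro ⟨j, ⟨h1, h2⟩, rfl⟩
      exact ⟨⟨j, h2, rfl⟩, Nat.one_lt_pow (by omega) (by norm_num)⟩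
  rw [hset, Finset.sum_image (fun a _ b _ h => Nat.pow_right_injective le_rfl h)]
  refine Finset.sum_le_sum fun i hi => ?_
  obtain ⟨h1, -⟩ := Finset.mem_Icc.1 hi
  obtain ⟨j, rfl⟩ : ∃ j, i = j + 1 := ⟨i - 1, by omega⟩
  have e : 2 ^ (j + 1) = 2 * 2 ^ j := by ring
  have hpos : 1 ≤ 2 ^ j := Nat.one_le_two_pow
  rw [e]
  have hk : ((Kset p (2 * 2 ^ j)).ncard : ℝ) ≤ (p : ℝ) ^ 2 ^ j := by
    exact_mod_cast Kcard_le p (2 ^ j) (by omega)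
  have hposR : (1 : ℝ) ≤ ((2 * 2 ^ j : ℕ) : ℝ) := by exact_mod_cast (by omega)
  rw [Nat.add_sub_cancel]
  exact (div_le_self (by positivity) (by linarith)).trans hk

lemma C_upper (p r : ℕ) [Fact p.Prime] (hr : 1 < r) :
    ∑ d ∈ (2 * r).divisors.filter (fun d => ¬ d ∣ r), ((Kset p d).ncard : ℝ) / (2 * d) <
      (p : ℝ) ^ r / (4 * r) + (p : ℝ) ^ ((r : ℝ) / 2) / 2 *
        (((∑ d ∈ (2 * r).divisors, (d : ℝ)) - 2 * r - 1) / (2 * r)) := by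
  have hp : (0 : ℝ) < p := by exact_mod_cast (Fact.out : p.Prime).pos
  have hr0 : (0 : ℝ) < r := by positivity
  have hmem : 2 * r ∈ (2 * r).divisors.filter (fun d => ¬ d ∣ r) := by
    simp only [Finset.mem_filter, Nat.mem_divisors]
    exact ⟨⟨dvd_rfl, by omega⟩, fun h => by have := Nat.le_of_dvd (by omega) h; omega⟩
  rw [← Finset.add_sum_erase _ _ hmem]
  have h1 : ((Kset p (2 * r)).ncard : ℝ) / (2 * (2 * r : ℕ)) ≤ (p : ℝ) ^ r / (4 * r) := by
    have h : ((Kset p (2 * r)).ncard : ℝ) ≤ (p : ℝ) ^ r := by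
      exact_mod_cast Kcard_le p r (by omega)
    push_cast
    rw [show (2 * (2 * r) : ℝ) = 4 * r by ring]
    gcongr
  have hrec := recip_sum (2 * r) (by omega)
  push_cast at hrec
  rw [← hrec, Finset.mul_sum]
  refine add_lt_add_of_le_of_lt h1 ?_
  have hrm : r ∈ ntd (2 * r) := (mem_ntd (by omega)).2 ⟨⟨2, by ring⟩, hr, by omega⟩
  rw [← Finset.sum_erase_add _ _ hrm]
  have hlast : 0 < (p : ℝ) ^ ((r : ℝ) / 2) / 2 * (1 / (r : ℝ)) := by positivity
  refine lt_of_le_of_lt ?_ (lt_add_of_pos_right _ hlast)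
  have hsub : ((2 * r).divisors.filter (fun d => ¬ d ∣ r)).erase (2 * r) ⊆ (ntd (2 * r)).erase r := by
    intro d hd
    simp only [Finset.mem_erase, Finset.mem_filter, Nat.mem_divisors] at hd
    obtain ⟨h2, ⟨h3, h4⟩, h5⟩ := hd
    rw [Finset.mem_erase, mem_ntd (by omega)]
    refine ⟨fun h => h5 (h ▸ dvd_rfl), h3, ?_, h2⟩
    have h0 := Nat.pos_of_dvd_of_pos h3 (by omega)
    have : d ≠ 1 := by rintro rfl; exact h5 (one_dvd _)
    omega
  refine (Finset.sum_le_sum_of_subset_of_nonneg hsub (fun _ _ _ => by positivity)).trans ?_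
  refine Finset.sum_le_sum fun d hd => ?_
  have hd' := Finset.mem_of_mem_erase hd
  have hd2 : 2 * (d : ℝ) ≤ 2 * r := by exact_mod_cast ntd_le_half (by omega) hd'
  obtain ⟨-, hd1, -⟩ := (mem_ntd (by omega)).1 hd'
  rw [two_mul_term]
  have := Kcard_le_rpow p d hd1 ((r : ℝ) / 2) (by linarith)
  gcongr

lemma C_pow_two (p s : ℕ) [Fact p.Prime] (hs : 1 ≤ s) :
    ∑ d ∈ (2 * 2 ^ s).divisors.filter (fun d => ¬ d ∣ 2 ^ s), ((Kset p d).ncard : ℝ) / (2 * d) <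
      ∑ i ∈ Finset.Icc 1 (s + 1), (p : ℝ) ^ 2 ^ (i - 1) := by
  have hp : (0 : ℝ) < p := by exact_mod_cast (Fact.out : p.Prime).pos
  have h1 := B_pow_two p (s + 1)
  have e : 2 ^ (s + 1) = 2 * 2 ^ s := by ring
  have hpos : 1 ≤ 2 ^ s := Nat.one_le_two_pow
  have hset : (2 * 2 ^ s).divisors.filter (fun d => ¬ d ∣ 2 ^ s) = {2 * 2 ^ s} := by
    ext d
    rw [← e]
    simp only [Finset.mem_filter, Finset.mem_singleton, Nat.mem_divisors_prime_pow Nat.prime_two]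
    constructor
    · rintro ⟨⟨j, hj, rfl⟩, h⟩
      have : ¬ j ≤ s := fun hjs => h (pow_dvd_pow _ hjs)
      have : j = s + 1 := by omega
      rw [this]
    · rintro rfl
      refine ⟨⟨s + 1, le_rfl, rfl⟩, fun h => ?_⟩
      have := Nat.le_of_dvd (by omega) h
      omega
  rw [hset, Finset.sum_singleton, Finset.sum_Icc_succ_top (by omega), Nat.add_sub_cancel]
  have hk : ((Kset p (2 * 2 ^ s)).ncard : ℝ) ≤ (p : ℝ) ^ 2 ^ s := by
    exact_mod_cast Kcard_le p (2 ^ s) (by omega)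
  have hposR : (1 : ℝ) ≤ ((2 * 2 ^ s : ℕ) : ℝ) := by exact_mod_cast (by omega)
  have h2 := (div_le_self (a := ((Kset p (2 * 2 ^ s)).ncard : ℝ)) (by positivity)
    (show (1 : ℝ) ≤ 2 * ((2 * 2 ^ s : ℕ) : ℝ) by linarith)).trans hk
  have h3 : 0 < ∑ i ∈ Finset.Icc 1 s, (p : ℝ) ^ 2 ^ (i - 1) :=
    Finset.sum_pos (fun _ _ => by positivity) ⟨1, Finset.mem_Icc.2 ⟨le_rfl, hs⟩⟩
  linarith

end helpers

/-- **Bounds on `T = Λ(n,q)/(φ(n)/2) − ε` for `n` even (Theorem 4.3, even case).** -/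
theorem LP_count_bounds_even (p r : ℕ) [Fact p.Prime] (hr : 1 < r) :
    (Odd r → Tsum p r <
      ((p : ℝ) ^ (2 * r) / (4 * r)) *
        (1 + ((∑ d ∈ (2 * r).divisors, (d : ℝ)) - 2 * r - 1) / (p : ℝ) ^ r)) ∧
    (∀ s₁ : ℕ, 1 ≤ s₁ → r = 2 ^ s₁ → Tsum p r <
      ((p : ℝ) ^ (2 * r) / (4 * r)) *
        (1 + ((∑ d ∈ (2 * r).divisors, (d : ℝ)) - 2 * r - 1) / (p : ℝ) ^ r) +
      ∑ i ∈ Finset.Icc 1 s₁, (p : ℝ) ^ 2 ^ (i - 1)) ∧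
    (Even r → (¬ ∃ k : ℕ, r = 2 ^ k) → Tsum p r <
      ((p : ℝ) ^ (2 * r) / (4 * r)) *
        (1 + ((∑ d ∈ (2 * r).divisors, (d : ℝ)) - 2 * r - 1) / (p : ℝ) ^ r +
          2 / (p : ℝ) ^ (3 * (r : ℝ) / 2) +
          2 * ((∑ d ∈ r.divisors, (d : ℝ)) - r - 1) / (p : ℝ) ^ (7 * (r : ℝ) / 4))) ∧
    (∀ s₁ : ℕ, 1 ≤ s₁ → r = 2 ^ s₁ →
      ((p : ℝ) ^ (2 * r) - p) / (4 * r) -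
        ∑ i ∈ Finset.Icc 1 (s₁ + 1), (p : ℝ) ^ 2 ^ (i - 1) < Tsum p r) ∧
    ((¬ ∃ k : ℕ, r = 2 ^ k) →
      ((p : ℝ) ^ (2 * r) / (4 * r)) *
        (1 - 1 / (p : ℝ) ^ r -
          ((∑ d ∈ (2 * r).divisors, (d : ℝ)) - 2 * r - 1) / (p : ℝ) ^ (3 * (r : ℝ) / 2) -
          1 / (p : ℝ) ^ (2 * r - 1)) < Tsum p r) := by
  have hp : (0 : ℝ) < p := by exact_mod_cast (Fact.out : p.Prime).pos
  have hr0 : (0 : ℝ) < r := by positivity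
  have hT := Tsum_eq p r hr
  have hA := A_upper p r hr
  have hA' := A_lower p r hr
  have hC0 : 0 ≤ ∑ d ∈ (2 * r).divisors.filter (fun d => ¬ d ∣ r),
      ((Kset p d).ncard : ℝ) / (2 * d) := Finset.sum_nonneg fun _ _ => by positivity
  have hB0 : 0 ≤ ∑ d ∈ r.divisors.filter (fun d => 1 < d),
      ((Kset p d).ncard : ℝ) / (2 * d) := Finset.sum_nonneg fun _ _ => by positivity
  refine ⟨?_, ?_, ?_, ?_, ?_⟩
  · intro hodd
    have hB : ∑ d ∈ r.divisors.filter (fun d => 1 < d),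
        ((Kset p d).ncard : ℝ) / (2 * d) = 0 := by
      refine Finset.sum_eq_zero fun d hd => ?_
      simp only [Finset.mem_filter, Nat.mem_divisors] at hd
      rw [Kcard_odd p d hd.2 (hodd.of_dvd_nat hd.1.1)]
      simp
    linarith
  · intro s hs hrs
    have hB := B_pow_two p s
    rw [← hrs] at hB
    linarith
  · intro _ _
    have hB := B_upper p r hr
    rw [mul_add] at hA hB
    rw [mul_add, mul_add, mul_add]
    linarith
  · intro s hs hrs
    have hC := C_pow_two p s hs
    rw [← hrs] at hC
    linarith
  · intro _
    have hC := C_upper p r hr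
    refine lt_of_eq_of_lt ?_ (show ((p : ℝ) ^ (2 * r) - p) / (4 * r) -
      ((p : ℝ) ^ r / (4 * r) + (p : ℝ) ^ ((r : ℝ) / 2) / 2 *
        (((∑ d ∈ (2 * r).divisors, (d : ℝ)) - 2 * r - 1) / (2 * r))) < Tsum p r by linarith)
    have q1 : (0 : ℝ) < (p : ℝ) ^ (3 * (r : ℝ) / 2) := by positivity
    have t1 : (p : ℝ) ^ (2 * r) / (p : ℝ) ^ r = (p : ℝ) ^ r := by
      rw [div_eq_iff (by positivity)]; ring
    have t2 : (p : ℝ) ^ (2 * r) / (p : ℝ) ^ (3 * (r : ℝ) / 2) = (p : ℝ) ^ ((r : ℝ) / 2) := by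
      rw [div_eq_iff (by positivity), ← Real.rpow_add hp, ← Real.rpow_natCast]
      congr 1; push_cast; ring
    have t3 : (p : ℝ) ^ (2 * r) / (p : ℝ) ^ (2 * r - 1) = p := by
      rw [div_eq_iff (by positivity), ← pow_succ']; congr 1; omega
    generalize (∑ d ∈ (2 * r).divisors, (d : ℝ)) - 2 * r - 1 = S
    calc (p : ℝ) ^ (2 * r) / (4 * r) * (1 - 1 / (p : ℝ) ^ r -
          S / (p : ℝ) ^ (3 * (r : ℝ) / 2) - 1 / (p : ℝ) ^ (2 * r - 1))
        = ((p : ℝ) ^ (2 * r) - (p : ℝ) ^ (2 * r) / (p : ℝ) ^ r -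
          S * ((p : ℝ) ^ (2 * r) / (p : ℝ) ^ (3 * (r : ℝ) / 2)) -
          (p : ℝ) ^ (2 * r) / (p : ℝ) ^ (2 * r - 1)) / (4 * r) := by ring
      _ = _ := by rw [t1, t2, t3]; field_simp; ring
end
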